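/- Let φ be a norm on ℝ², let Ω ⊆ ℝ² be a bounded convex open set, let m ∈ (0, |Ω|), and let E be a minimizer of problem (10), identified with its set of Lebesgue-density-1 points. Then there exists r > 0 (depending on m) such that E satisfies the rW_φ-condition, and every connected component of ∂E ∩ Ω is contained in ∂W_r(x) for some Wulff ball W_r(x) ⊆ Ω (with the center x depending on the connected component). -/

import Mathlib

open MeasureTheory Set ENNReal Filter

noncomputable section

/-- `φ` is a norm on `ℝⁿ` (represented as `Fin n → ℝ`). -/
structure IsNorm {n : ℕ} (φ : (Fin n → ℝ) → ℝ) : Prop where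
  nonneg : ∀ x, 0 ≤ φ x
  eq_zero_iff : ∀ x, φ x = 0 ↔ x = 0
  smul_eq : ∀ (a : ℝ) (x : Fin n → ℝ), φ (a • x) = |a| * φ x
  add_le : ∀ x y, φ (x + y) ≤ φ x + φ y

/-- The divergence of a vector field `η : ℝⁿ → ℝⁿ`. -/
def diverg {n : ℕ} (η : (Fin n → ℝ) → (Fin n → ℝ)) (x : Fin n → ℝ) : ℝ :=
  ∑ i, fderiv ℝ η x (Pi.single i 1) i

/-- The anisotropic total variation `∫ φ*(Du)` of `u : ℝⁿ → ℝ`: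
`sup { ∫ u div η dx : η ∈ C¹_c(ℝⁿ;ℝⁿ), φ(η(x)) ≤ 1 ∀ x }`, as an extended real. -/
def anisoTV {n : ℕ} (φ : (Fin n → ℝ) → ℝ) (u : (Fin n → ℝ) → ℝ) : ℝ≥0∞ :=
  ⨆ η ∈ {η : (Fin n → ℝ) → (Fin n → ℝ) |
      ContDiff ℝ 1 η ∧ HasCompactSupport η ∧ ∀ x, φ (η x) ≤ 1},
    ENNReal.ofReal (∫ x, u x * diverg η x)

/-- `u ∈ BV(ℝⁿ)` (with respect to the anisotropic total variation). -/
def IsBV {n : ℕ} (φ : (Fin n → ℝ) → ℝ) (u : (Fin n → ℝ) → ℝ) : Prop :=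
  Integrable u volume ∧ anisoTV φ u ≠ ⊤

/-- `u` is admissible for problem (1): `u ∈ BV(ℝⁿ)`, `u = 0` a.e. outside `Ω`,
`u` is a.e. `ℕ`-valued, and `∫_Ω u = m`. -/
def Admissible {n : ℕ} (φ : (Fin n → ℝ) → ℝ) (Ω : Set (Fin n → ℝ)) (m : ℝ)
    (u : (Fin n → ℝ) → ℝ) : Prop :=
  IsBV φ u ∧ (∀ᵐ x ∂volume, x ∉ Ω → u x = 0) ∧
    (∀ᵐ x ∂volume, ∃ k : ℕ, u x = k) ∧ (∫ x in Ω, u x) = m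

/-- `u` is a minimizer of problem (1). -/
def IsMinimizer {n : ℕ} (φ : (Fin n → ℝ) → ℝ) (Ω : Set (Fin n → ℝ)) (m : ℝ)
    (u : (Fin n → ℝ) → ℝ) : Prop :=
  Admissible φ Ω m u ∧ ∀ v, Admissible φ Ω m v → anisoTV φ u ≤ anisoTV φ v

/-- The anisotropic perimeter `P_φ(E)` of a set `E ⊆ ℝⁿ`. -/
def anisoPerimeter {n : ℕ} (φ : (Fin n → ℝ) → ℝ) (E : Set (Fin n → ℝ)) : ℝ≥0∞ :=
  anisoTV φ (E.indicator (1 : (Fin n → ℝ) → ℝ))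

/-- The Wulff ball `W_r(x) = {y : φ(y-x) < r}`. -/
def wulffBall {n : ℕ} (φ : (Fin n → ℝ) → ℝ) (x : Fin n → ℝ) (r : ℝ) : Set (Fin n → ℝ) :=
  {y | φ (y - x) < r}

/-- `E` satisfies the `rW_φ`-condition. -/
def rWCond {n : ℕ} (φ : (Fin n → ℝ) → ℝ) (E : Set (Fin n → ℝ)) (r : ℝ) : Prop :=
  ∀ x ∈ frontier E, ∃ y, wulffBall φ y r ⊆ E ∧ x ∈ frontier (wulffBall φ y r)

/-- The Wulff plaquette `E^r`, the union of all Wulff balls of radius `r` contained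
in `E` (with `E^0 = E`). -/
def plaquette {n : ℕ} (φ : (Fin n → ℝ) → ℝ) (E : Set (Fin n → ℝ)) (r : ℝ) :
    Set (Fin n → ℝ) :=
  if r = 0 then E else ⋃ (x) (_ : wulffBall φ x r ⊆ E), wulffBall φ x r

/-- `R_Ω`: the maximal `R > 0` such that some Wulff ball of radius `R` is contained in `Ω`. -/
def maxInradius {n : ℕ} (φ : (Fin n → ℝ) → ℝ) (Ω : Set (Fin n → ℝ)) : ℝ :=
  sSup {R | 0 < R ∧ ∃ x, wulffBall φ x R ⊆ Ω}

/-- `r_Ω`: the maximal `r > 0` such that `Ω` satisfies the `rW_φ`-condition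
(`0` if there is none, since `sSup ∅ = 0`). -/
def maxRollRadius {n : ℕ} (φ : (Fin n → ℝ) → ℝ) (Ω : Set (Fin n → ℝ)) : ℝ :=
  sSup {r | 0 < r ∧ rWCond φ Ω r}

/-- The set of points of Lebesgue density `1` of `E`. -/
def densityPoints {n : ℕ} (E : Set (Fin n → ℝ)) : Set (Fin n → ℝ) :=
  {x | Tendsto (fun r : ℝ => volume (E ∩ Metric.ball x r) / volume (Metric.ball x r))
    (nhdsWithin 0 (Ioi 0)) (nhds 1)}

/-- `E` is a minimizer of problem (10): the constrained isoperimetric problem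
minimizing `P_φ` among measurable subsets of `Ω` of prescribed measure `m`. -/
def IsIsopMinimizer {n : ℕ} (φ : (Fin n → ℝ) → ℝ) (Ω : Set (Fin n → ℝ)) (m : ℝ)
    (E : Set (Fin n → ℝ)) : Prop :=
  MeasurableSet E ∧ E ⊆ Ω ∧ (volume E).toReal = m ∧
    ∀ F, MeasurableSet F → F ⊆ Ω → (volume F).toReal = m →
      anisoPerimeter φ E ≤ anisoPerimeter φ F

/-- The Euclidean norm on `ℝ²`. -/
def euclNorm (v : Fin 2 → ℝ) : ℝ := Real.sqrt (v 0 ^ 2 + v 1 ^ 2)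

/-- The crystalline norm `φ(ν) = |ν₁| + |ν₂|` on `ℝ²`. -/
def crysNorm (v : Fin 2 → ℝ) : ℝ := |v 0| + |v 1|

/-- The open unit square `(0,1)² ⊆ ℝ²`. -/
def unitSquare : Set (Fin 2 → ℝ) := univ.pi fun _ => Ioo (0 : ℝ) 1

/-- The closed unit square `[0,1]² ⊆ ℝ²`. -/
def closedUnitSquare : Set (Fin 2 → ℝ) := univ.pi fun _ => Icc (0 : ℝ) 1

/-- `j` is the essential supremum `‖u‖_∞` of `u`. -/
def IsEssSup (u : (Fin 2 → ℝ) → ℝ) (j : ℕ) : Prop :=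
  (∀ᵐ x ∂volume, u x ≤ (j : ℝ)) ∧ ∀ c : ℝ, (∀ᵐ x ∂volume, u x ≤ c) → (j : ℝ) ≤ c

open scoped Pointwise Convolution Topology

/-- The plane `ℝ²`. -/
abbrev Plane := Fin 2 → ℝ

/-- The determinant of the pair `(d, x)`. -/
def crs (d x : Plane) : ℝ := d 0 * x 1 - d 1 * x 0

/-- The scalar product on the plane. -/
def dt (d x : Plane) : ℝ := d 0 * x 0 + d 1 * x 1

lemma continuous_crs (d : Plane) : Continuous (crs d) := by
  unfold crs; fun_prop

lemma crs_add_right (d x y : Plane) : crs d (x + y) = crs d x + crs d y := by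
  simp [crs]; ring

lemma crs_smul_right (d x : Plane) (c : ℝ) : crs d (c • x) = c * crs d x := by
  simp [crs]; ring

lemma crs_smul_left (d x : Plane) (c : ℝ) : crs (c • d) x = c * crs d x := by
  simp [crs]; ring

lemma crs_self (d : Plane) : crs d d = 0 := by
  simp [crs]; ring

lemma crs_comm (d x : Plane) : crs x d = -crs d x := by
  simp [crs]; ring

lemma sq_add_sq_pos {d : Plane} (hd : d ≠ 0) : 0 < d 0 ^ 2 + d 1 ^ 2 := by
  rcases eq_or_ne (d 0) 0 with h | h
  · rcases eq_or_ne (d 1) 0 with h' | h'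
    · exact absurd (by ext i; fin_cases i <;> simp [h, h']) hd
    · positivity
  · positivity

/-- A vector with `crs d (conj d) = 1`. -/
def conj (d : Plane) : Plane := ![-d 1 / (d 0 ^ 2 + d 1 ^ 2), d 0 / (d 0 ^ 2 + d 1 ^ 2)]

lemma crs_conj {d : Plane} (hd : d ≠ 0) : crs d (conj d) = 1 := by
  have := sq_add_sq_pos hd
  simp only [crs, conj, Matrix.cons_val_zero, Matrix.cons_val_one]
  field_simp
  ring

/-- The point with coordinates `(s, t)` in the frame `(d, conj d)`. -/
def frame (d : Plane) (p : ℝ × ℝ) : Plane := p.1 • d + p.2 • conj d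

lemma continuous_frame (d : Plane) : Continuous (frame d) := by
  unfold frame; fun_prop

lemma crs_frame {d : Plane} (hd : d ≠ 0) (p : ℝ × ℝ) : crs d (frame d p) = p.2 := by
  simp [frame, crs_add_right, crs_smul_right, crs_self, crs_conj hd]

lemma frame_inv {d : Plane} (hd : d ≠ 0) (x : Plane) :
    frame d (crs x (conj d), crs d x) = x := by
  have h := sq_add_sq_pos hd
  ext i
  fin_cases i <;> simp [frame, crs, conj] <;> field_simp <;> ring

lemma measurePreserving_frame {d : Plane} (hd : d ≠ 0) :
    MeasurePreserving (frame d) volume volume := by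
  have h1 := (volume_preserving_finTwoArrow ℝ).symm
  have hdet : (Matrix.of ![![d 0, conj d 0], ![d 1, conj d 1]]).det = 1 := by
    rw [Matrix.det_fin_two_of]
    have := crs_conj hd
    unfold crs at this
    linarith
  have h2 : MeasurePreserving
      (Matrix.toLin' (Matrix.of ![![d 0, conj d 0], ![d 1, conj d 1]]))
      (volume : Measure Plane) volume := by
    refine ⟨(LinearMap.continuous_of_finiteDimensional _).measurable, ?_⟩
    rw [Real.map_matrix_volume_pi_eq_smul_volume_pi (by rw [hdet]; norm_num), hdet]
    simp
  have h3 := h2.comp h1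
  convert h3 using 1
  ext p i
  fin_cases i <;>
    simp [frame, Matrix.toLin'_apply, Matrix.mulVec, dotProduct, Fin.sum_univ_two,
      MeasurableEquiv.finTwoArrow] <;> ring

/-- Slice of `A` by a line parallel to `d`. -/
def slice (d : Plane) (A : Set Plane) (t : ℝ) : Set ℝ := {s | frame d (s, t) ∈ A}

lemma measurableSet_slice (d : Plane) {A : Set Plane} (hA : MeasurableSet A) (t : ℝ) :
    MeasurableSet (slice d A t) := by
  have : Measurable (fun s : ℝ => frame d (s, t)) :=
    ((continuous_frame d).comp (by fun_prop)).measurable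
  exact this hA

lemma measurable_volume_slice (d : Plane) {A : Set Plane} (hA : MeasurableSet A) :
    Measurable fun t => volume (slice d A t) :=
  measurable_measure_prodMk_right ((continuous_frame d).measurable hA)

lemma volume_eq_lintegral_slice {d : Plane} (hd : d ≠ 0) {A : Set Plane}
    (hA : MeasurableSet A) : volume A = ∫⁻ t, volume (slice d A t) := by
  rw [← (measurePreserving_frame hd).measure_preimage hA.nullMeasurableSet,
    Measure.volume_eq_prod, Measure.prod_apply_symm ((continuous_frame d).measurable hA)]
  rfl

/-- Parameters of the lines parallel to `d` that meet `A` in positive length. -/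
def proj (d : Plane) (A : Set Plane) : Set ℝ := {t | 0 < volume (slice d A t)}

lemma measurableSet_proj (d : Plane) {A : Set Plane} (hA : MeasurableSet A) :
    MeasurableSet (proj d A) :=
  measurableSet_lt measurable_const (measurable_volume_slice d hA)

lemma slice_mono (d : Plane) {A B : Set Plane} (h : A ⊆ B) (t : ℝ) :
    slice d A t ⊆ slice d B t := fun _ hs => h hs

lemma proj_mono (d : Plane) {A B : Set Plane} (h : A ⊆ B) : proj d A ⊆ proj d B :=
  fun t ht => lt_of_lt_of_le ht (measure_mono (slice_mono d h t))

lemma proj_subset_image {d : Plane} (hd : d ≠ 0) (A : Set Plane) :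
    proj d A ⊆ crs d '' A := by
  intro t ht
  obtain ⟨s, hs⟩ := nonempty_of_measure_ne_zero (ne_of_gt ht)
  exact ⟨_, hs, crs_frame hd (s, t)⟩

/-- Almost every point of `A` lies on a line counted by `proj d A`. -/
lemma volume_diff_proj {d : Plane} (hd : d ≠ 0) {A : Set Plane} (hA : MeasurableSet A) :
    volume (A \ crs d ⁻¹' proj d A) = 0 := by
  have hm : MeasurableSet (A \ crs d ⁻¹' proj d A) :=
    hA.diff ((continuous_crs d).measurable (measurableSet_proj d hA))
  rw [volume_eq_lintegral_slice hd hm]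
  simp only [lintegral_eq_zero_iff (measurable_volume_slice d hm)]
  refine Eventually.of_forall fun t => ?_
  by_cases ht : t ∈ proj d A
  · have : slice d (A \ crs d ⁻¹' proj d A) t = ∅ := by
      ext s; simp [slice, crs_frame hd, ht]
    simp [this]
  · have h0 : volume (slice d A t) = 0 := by simpa [proj] using ht
    exact measure_mono_null (slice_mono d sdiff_subset t) h0

lemma proj_congr_ae {d : Plane} (hd : d ≠ 0) {A B : Set Plane} (hA : MeasurableSet A)
    (hB : MeasurableSet B) (hBA : B ⊆ A) (h : volume (A \ B) = 0) :
    volume (proj d B) = volume (proj d A) := by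
  rw [volume_eq_lintegral_slice hd (hA.diff hB),
    lintegral_eq_zero_iff (measurable_volume_slice d (hA.diff hB))] at h
  refine measure_congr ?_
  filter_upwards [h] with t ht
  have : volume (slice d A t) = volume (slice d B t) := by
    refine le_antisymm ?_ (measure_mono (slice_mono d hBA t))
    calc volume (slice d A t) ≤ volume (slice d B t ∪ slice d (A \ B) t) := by
          refine measure_mono fun s hs => ?_
          by_cases hsB : s ∈ slice d B t
          · exact Or.inl hsB
          · exact Or.inr ⟨hs, hsB⟩
      _ ≤ volume (slice d B t) + volume (slice d (A \ B) t) := measure_union_le _ _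
      _ = volume (slice d B t) := by simp at ht; simp [ht]
  exact propext (by change 0 < _ ↔ 0 < _; rw [this])

lemma isBounded_proj {d : Plane} (hd : d ≠ 0) {A : Set Plane} (hA : Bornology.IsBounded A) :
    Bornology.IsBounded (proj d A) := by
  have h1 : IsCompact (crs d '' closure A) :=
    hA.isCompact_closure.image (continuous_crs d)
  exact h1.isBounded.subset ((proj_subset_image hd A).trans (image_mono subset_closure))

lemma measure_tail_le (μ : Measure ℝ) [NullSingletonClass μ] (h : ℝ≥0∞) :
    μ {s | μ (Ioi s) ≤ h} ≤ h := by
  set U := {s | μ (Ioi s) ≤ h} with hU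
  have hup : ∀ s ∈ U, ∀ t, s ≤ t → t ∈ U := fun s hs t hst =>
    le_trans (measure_mono (Ioi_subset_Ioi hst)) hs
  have hV : μ (⋃ q ∈ {q : ℚ | (q : ℝ) ∈ U}, Ioi (q : ℝ)) ≤ h := by
    rw [measure_biUnion_eq_iSup (Set.to_countable _)]
    · exact iSup₂_le fun q hq => hq
    · intro a ha b hb
      rcases le_total a b with hab | hab
      · exact ⟨a, ha, subset_rfl, Ioi_subset_Ioi (by exact_mod_cast hab)⟩
      · exact ⟨b, hb, Ioi_subset_Ioi (by exact_mod_cast hab), subset_rfl⟩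
  have key : ∀ x ∈ U, (∃ y ∈ U, y < x) → x ∈ ⋃ q ∈ {q : ℚ | (q : ℝ) ∈ U}, Ioi (q : ℝ) := by
    rintro x hx ⟨y, hy, hyx⟩
    obtain ⟨q, hq1, hq2⟩ := exists_rat_btwn hyx
    exact mem_biUnion (show q ∈ {q : ℚ | (q : ℝ) ∈ U} from hup y hy _ hq1.le) hq2
  by_cases hmin : ∃ a ∈ U, ∀ y ∈ U, a ≤ y
  · obtain ⟨a, haU, ha⟩ := hmin
    have : U ⊆ Ioi a ∪ {a} := fun x hx => by
      rcases (ha x hx).lt_or_eq with h1 | h1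
      · exact Or.inl h1
      · exact Or.inr h1.symm
    calc μ U ≤ μ (Ioi a ∪ {a}) := measure_mono this
      _ ≤ μ (Ioi a) + μ {a} := measure_union_le _ _
      _ ≤ h := by rw [measure_singleton, add_zero]; exact haU
  · push Not at hmin
    exact (measure_mono fun x hx => key x hx (hmin x hx)).trans hV

lemma measure_tail_le' (μ : Measure ℝ) [NullSingletonClass μ] (h : ℝ≥0∞) :
    μ {s | μ (Iio s) ≤ h} ≤ h := by
  have : NullSingletonClass (μ.map (MeasurableEquiv.neg ℝ)) := ⟨fun x => by
    rw [MeasurableEquiv.map_apply]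
    have : MeasurableEquiv.neg ℝ ⁻¹' {x} = {-x} := by
      ext y
      simp
    rw [this, measure_singleton]⟩
  have h1 := measure_tail_le (μ.map (MeasurableEquiv.neg ℝ)) h
  simp only [MeasurableEquiv.map_apply] at h1
  convert h1 using 2
  ext s
  simp

/-- A set on the line loses at most `2h` of its length when the points with at most `h` of the
set on one of their sides are removed. -/
lemma volume_le_middle (S : Set ℝ) (hS : MeasurableSet S) (h : ℝ≥0∞) :
    volume S ≤ volume {s ∈ S | h < volume (S ∩ Ioi s) ∧ h < volume (S ∩ Iio s)} + (h + h) := by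
  have e1 := measure_tail_le (volume.restrict S) h
  have e2 := measure_tail_le' (volume.restrict S) h
  simp only [Measure.restrict_apply' hS] at e1 e2
  calc volume S ≤ volume ({s ∈ S | h < volume (S ∩ Ioi s) ∧ h < volume (S ∩ Iio s)} ∪
        (({s | volume (Ioi s ∩ S) ≤ h} ∩ S) ∪ ({s | volume (Iio s ∩ S) ≤ h} ∩ S))) := by
        refine measure_mono fun s hs => ?_
        by_cases a1 : volume (Ioi s ∩ S) ≤ h
        · exact Or.inr (Or.inl ⟨a1, hs⟩)
        by_cases a2 : volume (Iio s ∩ S) ≤ h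
        · exact Or.inr (Or.inr ⟨a2, hs⟩)
        refine Or.inl ⟨hs, ?_, ?_⟩
        · rw [inter_comm]; exact not_le.mp a1
        · rw [inter_comm]; exact not_le.mp a2
    _ ≤ _ := (measure_union_le _ _).trans
        (add_le_add_right ((measure_union_le _ _).trans (add_le_add e1 e2)) _)

/-- Length of the part of `A` on the half-line from `x` in direction `d`. -/
def fwd (d : Plane) (A : Set Plane) (x : Plane) : ℝ≥0∞ := volume {τ : ℝ | 0 < τ ∧ x + τ • d ∈ A}

/-- Length of the part of `A` on the half-line from `x` in direction `-d`. -/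
def bwd (d : Plane) (A : Set Plane) (x : Plane) : ℝ≥0∞ := volume {τ : ℝ | τ < 0 ∧ x + τ • d ∈ A}

/-- The points of `A` with more than half a copy of `d` of `A` on both sides. -/
def compress (d : Plane) (A : Set Plane) : Set Plane :=
  {x ∈ A | 1 / 2 < fwd d A x ∧ 1 / 2 < bwd d A x}

lemma compress_subset (d : Plane) (A : Set Plane) : compress d A ⊆ A := fun _ hx => hx.1

lemma measurable_fwd (d : Plane) {A : Set Plane} (hA : MeasurableSet A) :
    Measurable (fwd d A) := by
  have : MeasurableSet {p : Plane × ℝ | 0 < p.2 ∧ p.1 + p.2 • d ∈ A} := by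
    refine (measurableSet_lt measurable_const measurable_snd).inter ?_
    have : Measurable (fun p : Plane × ℝ => p.1 + p.2 • d) := by fun_prop
    exact this hA
  exact measurable_measure_prodMk_left this

lemma measurable_bwd (d : Plane) {A : Set Plane} (hA : MeasurableSet A) :
    Measurable (bwd d A) := by
  have : MeasurableSet {p : Plane × ℝ | p.2 < 0 ∧ p.1 + p.2 • d ∈ A} := by
    refine (measurableSet_lt measurable_snd measurable_const).inter ?_
    have : Measurable (fun p : Plane × ℝ => p.1 + p.2 • d) := by fun_prop
    exact this hA
  exact measurable_measure_prodMk_left this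

lemma measurableSet_compress (d : Plane) {A : Set Plane} (hA : MeasurableSet A) :
    MeasurableSet (compress d A) :=
  hA.inter ((measurableSet_lt measurable_const (measurable_fwd d hA)).inter
    (measurableSet_lt measurable_const (measurable_bwd d hA)))

lemma frame_add (d : Plane) (s t τ : ℝ) : frame d (s, t) + τ • d = frame d (s + τ, t) := by
  simp [frame, add_smul]; abel

lemma fwd_frame (d : Plane) (A : Set Plane) (s t : ℝ) :
    fwd d A (frame d (s, t)) = volume (slice d A t ∩ Ioi s) := by
  unfold fwd
  simp only [frame_add]
  rw [← measure_preimage_add volume s (slice d A t ∩ Ioi s)]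
  congr 1
  ext τ
  simp [slice, and_comm]

lemma bwd_frame (d : Plane) (A : Set Plane) (s t : ℝ) :
    bwd d A (frame d (s, t)) = volume (slice d A t ∩ Iio s) := by
  unfold bwd
  simp only [frame_add]
  rw [← measure_preimage_add volume s (slice d A t ∩ Iio s)]
  congr 1
  ext τ
  simp [slice, and_comm]

lemma volume_le_compress {d : Plane} (hd : d ≠ 0) {A : Set Plane} (hA : MeasurableSet A) :
    volume A ≤ volume (compress d A) + volume (proj d A) := by
  rw [volume_eq_lintegral_slice hd hA,
    volume_eq_lintegral_slice hd (measurableSet_compress d hA),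
    ← lintegral_indicator_one (measurableSet_proj d hA),
    ← lintegral_add_left (measurable_volume_slice d (measurableSet_compress d hA))]
  refine lintegral_mono fun t => ?_
  by_cases ht : t ∈ proj d A
  · simp only [ht, indicator_of_mem, Pi.one_apply]
    have := volume_le_middle (slice d A t) (measurableSet_slice d hA t) (1 / 2)
    rw [ENNReal.add_halves] at this
    convert this using 3
    ext s
    simp [slice, compress, fwd_frame, bwd_frame]
    tauto
  · have h0 : volume (slice d A t) = 0 := by simpa [proj] using ht
    simp [h0]

lemma mem_of_mem_compress {d : Plane} {A H : Set Plane} (hAH : A ⊆ H) (hH : Convex ℝ H)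
    {x : Plane} (hx : x ∈ compress d A) {c : ℝ} (hc : c ∈ Icc (-(1 / 2) : ℝ) (1 / 2)) :
    x + c • d ∈ H := by
  obtain ⟨-, h1, h2⟩ := hx
  have e1 : ∃ τ : ℝ, 1 / 2 < τ ∧ x + τ • d ∈ A := by
    by_contra! hcon
    have : fwd d A x ≤ volume (Ioc (0 : ℝ) (1 / 2)) :=
      measure_mono fun τ hτ => ⟨hτ.1, not_lt.mp fun h => hcon τ h hτ.2⟩
    rw [Real.volume_Ioc] at this
    have h3 : ENNReal.ofReal (1 / 2 - 0) = 1 / 2 := by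
      rw [sub_zero, ENNReal.ofReal_div_of_pos (by norm_num)]; simp
    rw [h3] at this
    exact absurd h1 (not_lt.mpr this)
  have e2 : ∃ τ : ℝ, τ < -(1 / 2) ∧ x + τ • d ∈ A := by
    by_contra! hcon
    have : bwd d A x ≤ volume (Ico (-(1 / 2) : ℝ) 0) :=
      measure_mono fun τ hτ => ⟨not_lt.mp fun h => hcon τ h hτ.2, hτ.1⟩
    rw [Real.volume_Ico] at this
    have h3 : ENNReal.ofReal (0 - -(1 / 2)) = 1 / 2 := by
      rw [zero_sub, neg_neg, ENNReal.ofReal_div_of_pos (by norm_num)]; simp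
    rw [h3] at this
    exact absurd h2 (not_lt.mpr this)
  obtain ⟨τ, hτ, hxτ⟩ := e1
  obtain ⟨σ, hσ, hxσ⟩ := e2
  have hpos : 0 < τ - σ := by linarith
  have := hH (hAH hxσ) (hAH hxτ) (a := (τ - c) / (τ - σ)) (b := (c - σ) / (τ - σ))
    (div_nonneg (by linarith [hc.2]) hpos.le) (div_nonneg (by linarith [hc.1]) hpos.le)
    (by field_simp; ring)
  convert this using 1
  ext i
  simp only [Pi.add_apply, Pi.smul_apply, smul_eq_mul]
  field_simp
  ring

lemma volume_add_le_of_tails {Y T : Set ℝ} (hYT : Y ⊆ T) (hT : MeasurableSet T)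
    (hb : Bornology.IsBounded Y) (hY0 : volume Y ≠ 0) {k : ℝ≥0∞}
    (h1 : ∀ y ∈ Y, k ≤ volume (T ∩ Ioi y)) (h2 : ∀ y ∈ Y, k ≤ volume (T ∩ Iio y)) :
    volume Y + (k + k) ≤ volume T := by
  have hne : Y.Nonempty := nonempty_of_measure_ne_zero hY0
  have hba : BddAbove Y := hb.bddAbove
  have hbb : BddBelow Y := hb.bddBelow
  have hab : sInf Y < sSup Y := by
    by_contra! hcon
    refine hY0 (measure_mono_null (t := {sInf Y}) (fun y hy => ?_) (measure_singleton _))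
    exact le_antisymm ((le_csSup hba hy).trans hcon) (csInf_le hbb hy)
  refine ENNReal.le_of_forall_pos_le_add fun ε hε _ => ?_
  set δ : ℝ := min (ε / 2) ((sSup Y - sInf Y) / 2) with hδ
  have hε' : (0 : ℝ) < ε := hε
  have hδ0 : 0 < δ := lt_min (by positivity) (by linarith)
  obtain ⟨y2, hy2, hy2'⟩ := exists_lt_of_lt_csSup hne (show sSup Y - δ < sSup Y by linarith)
  obtain ⟨y1, hy1, hy1'⟩ := exists_lt_of_csInf_lt hne (show sInf Y < sInf Y + δ by linarith)
  have h12 : y1 ≤ y2 := by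
    have := min_le_right (ε / 2 : ℝ) ((sSup Y - sInf Y) / 2)
    rw [← hδ] at this
    linarith
  have e1 : volume Y ≤ volume (T ∩ Icc y1 y2) + ε := by
    calc volume Y ≤ volume ((T ∩ Icc y1 y2) ∪
          (Ioc (sSup Y - δ) (sSup Y) ∪ Ico (sInf Y) (sInf Y + δ))) := by
          refine measure_mono fun y hy => ?_
          by_cases c2 : y2 < y
          · exact Or.inr (Or.inl ⟨hy2'.trans c2, le_csSup hba hy⟩)
          by_cases c1 : y < y1
          · exact Or.inr (Or.inr ⟨csInf_le hbb hy, c1.trans hy1'⟩)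
          exact Or.inl ⟨hYT hy, not_lt.mp c1, not_lt.mp c2⟩
      _ ≤ volume (T ∩ Icc y1 y2) + (ENNReal.ofReal δ + ENNReal.ofReal δ) := by
          refine (measure_union_le _ _).trans (add_le_add_right ?_ _)
          refine (measure_union_le _ _).trans (le_of_eq ?_)
          rw [Real.volume_Ioc, Real.volume_Ico]
          congr 2 <;> ring
      _ ≤ volume (T ∩ Icc y1 y2) + ε := by
          refine add_le_add_right ?_ _
          rw [← ENNReal.ofReal_add hδ0.le hδ0.le]
          refine ENNReal.ofReal_le_of_le_toReal ?_
          have := min_le_left (ε / 2 : ℝ) ((sSup Y - sInf Y) / 2)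
          rw [← hδ] at this
          simp
          linarith
  have e2 : volume (T ∩ Icc y1 y2) + (k + k) ≤ volume T := by
    calc volume (T ∩ Icc y1 y2) + (k + k)
        ≤ volume (T ∩ Icc y1 y2) + (volume (T ∩ Ioi y2) + volume (T ∩ Iio y1)) :=
          add_le_add_right (add_le_add (h1 _ hy2) (h2 _ hy1)) _
      _ = volume ((T ∩ Icc y1 y2) ∪ ((T ∩ Ioi y2) ∪ (T ∩ Iio y1))) := by
          rw [measure_union _ ((hT.inter measurableSet_Ioi).union (hT.inter measurableSet_Iio)),
            measure_union _ (hT.inter measurableSet_Iio)]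
          · rw [Set.disjoint_left]
            rintro x ⟨-, hx⟩ ⟨-, hx'⟩
            exact absurd (lt_trans (lt_of_lt_of_le hx' h12) hx) (lt_irrefl _)
          · rw [Set.disjoint_left]
            rintro x ⟨-, hx⟩ (⟨-, hx'⟩ | ⟨-, hx'⟩)
            · exact absurd hx' (not_lt.mpr hx.2)
            · exact absurd hx' (not_lt.mpr hx.1)
      _ ≤ volume T := by
          refine measure_mono ?_
          rintro x (⟨hx, -⟩ | ⟨hx, -⟩ | ⟨hx, -⟩) <;> exact hx
  calc volume Y + (k + k) ≤ volume (T ∩ Icc y1 y2) + ε + (k + k) := add_le_add_left e1 _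
    _ = volume (T ∩ Icc y1 y2) + (k + k) + ε := by ring
    _ ≤ volume T + ε := add_le_add_left e2 _

lemma volume_affine_preimage {k : ℝ} (hk : k ≠ 0) (u : ℝ) (S : Set ℝ) :
    volume S = ENNReal.ofReal |k| * volume {τ : ℝ | u + k * τ ∈ S} := by
  have h1 : {τ : ℝ | u + k * τ ∈ S} = (k * ·) ⁻¹' ((u + ·) ⁻¹' S) := rfl
  rw [h1, Real.volume_preimage_mul_left hk, measure_preimage_add, ← mul_assoc,
    ← ENNReal.ofReal_mul (abs_nonneg _), ← abs_mul, mul_inv_cancel₀ hk]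
  simp

lemma ae_volume_line_eq_zero (d : Plane) {N : Set Plane} (hN : MeasurableSet N)
    (h0 : volume N = 0) : ∀ᵐ x : Plane, volume {τ : ℝ | x + τ • d ∈ N} = 0 := by
  have hf : Measurable (fun p : Plane × ℝ => p.1 + p.2 • d) := by fun_prop
  have hm : MeasurableSet ((fun p : Plane × ℝ => p.1 + p.2 • d) ⁻¹' N) := hf hN
  have : (volume : Measure Plane).prod (volume : Measure ℝ)
      ((fun p : Plane × ℝ => p.1 + p.2 • d) ⁻¹' N) = 0 := by
    rw [Measure.prod_apply_symm hm, lintegral_eq_zero_iff (measurable_measure_prodMk_right hm)]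
    refine Eventually.of_forall fun τ => ?_
    have : (fun x : Plane => (x, τ)) ⁻¹' ((fun p : Plane × ℝ => p.1 + p.2 • d) ⁻¹' N)
      = (fun x : Plane => x + τ • d) ⁻¹' N := rfl
    simp only [this, measure_preimage_add_right, h0, Pi.zero_apply]
  exact (Measure.measure_prod_null hm).mp this

lemma crs_add_smul (d d' x : Plane) (τ : ℝ) :
    crs d' (x + τ • d) = crs d' x + crs d' d * τ := by
  rw [crs_add_right, crs_smul_right, mul_comm]

/-- Compression in one direction shrinks the projections in the other directions. -/
lemma proj_compress_add_le {d d' : Plane} (hd' : d' ≠ 0) {A : Set Plane}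
    (hA : MeasurableSet A) (hAb : Bornology.IsBounded A) (h0 : volume (compress d A) ≠ 0) :
    volume (proj d' (compress d A)) + ENNReal.ofReal |crs d d'| ≤ volume (proj d' A) := by
  rcases eq_or_ne (crs d' d) 0 with hk | hk
  · rw [crs_comm d' d, hk]
    simpa using measure_mono (proj_mono d' (compress_subset d A))
  have hC := measurableSet_compress d hA
  set T := proj d' A with hT
  have hTm : MeasurableSet T := measurableSet_proj d' hA
  set N := A \ crs d' ⁻¹' T with hN
  have hNm : MeasurableSet N := hA.diff ((continuous_crs d').measurable hTm)
  have hNl := ae_volume_line_eq_zero d hNm (volume_diff_proj hd' hA)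
  set G := {x : Plane | volume {τ : ℝ | x + τ • d ∈ N} = 0} with hG
  have hGm : MeasurableSet G := by
    have hf : Measurable (fun p : Plane × ℝ => p.1 + p.2 • d) := by fun_prop
    have := measurable_measure_prodMk_left (ν := (volume : Measure ℝ)) (hf hNm)
    exact this (measurableSet_singleton 0)
  set B := compress d A ∩ G with hB
  have hBm : MeasurableSet B := hC.inter hGm
  have hBnull : volume (compress d A \ B) = 0 :=
    measure_mono_null (fun x hx => fun hxG => hx.2 ⟨hx.1, hxG⟩) hNl
  have hBA : B ⊆ A := fun x hx => hx.1.1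
  rw [← proj_congr_ae hd' hC hBm inter_subset_left hBnull]
  have hB0 : volume B ≠ 0 := by
    intro h
    refine h0 (le_antisymm ?_ bot_le)
    calc volume (compress d A) ≤ volume (B ∪ (compress d A \ B)) :=
          measure_mono (by intro x hx; by_cases h : x ∈ B; exacts [Or.inl h, Or.inr ⟨hx, h⟩])
      _ ≤ volume B + volume (compress d A \ B) := measure_union_le _ _
      _ = 0 := by rw [h, hBnull, add_zero]
  have hY0 : volume (proj d' B) ≠ 0 := by
    intro h
    refine hB0 ?_
    rw [volume_eq_lintegral_slice hd' hBm,
      lintegral_eq_zero_iff (measurable_volume_slice d' hBm)]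
    filter_upwards [measure_eq_zero_iff_ae_notMem.mp h] with t ht
    simpa [proj] using ht
  have tail : ∀ x ∈ B, ∀ S : Set ℝ,
      (volume (S) < ENNReal.ofReal |crs d' d| * (1 / 2) →
        ¬ (1 / 2 : ℝ≥0∞) ≤ volume {τ : ℝ | crs d' x + crs d' d * τ ∈ S}) := by
    intro x _ S hS hcon
    rw [volume_affine_preimage hk (crs d' x) S] at hS
    exact absurd hS (not_lt.mpr (mul_le_mul_right hcon _))
  have fw : ∀ x ∈ B, (1 / 2 : ℝ≥0∞) ≤ volume {τ : ℝ | 0 < τ ∧ crs d' x + crs d' d * τ ∈ T} := by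
    intro x hx
    have h2 : fwd d A x ≤ volume {τ : ℝ | 0 < τ ∧ crs d' x + crs d' d * τ ∈ T} +
        volume {τ : ℝ | x + τ • d ∈ N} := by
      refine (measure_mono fun τ hτ => ?_).trans (measure_union_le _ _)
      by_cases hc : crs d' (x + τ • d) ∈ T
      · left; rw [crs_add_smul] at hc; exact ⟨hτ.1, hc⟩
      · right; exact ⟨hτ.2, hc⟩
    rw [hx.2, add_zero] at h2
    exact hx.1.2.1.le.trans h2
  have bw : ∀ x ∈ B, (1 / 2 : ℝ≥0∞) ≤ volume {τ : ℝ | τ < 0 ∧ crs d' x + crs d' d * τ ∈ T} := by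
    intro x hx
    have h2 : bwd d A x ≤ volume {τ : ℝ | τ < 0 ∧ crs d' x + crs d' d * τ ∈ T} +
        volume {τ : ℝ | x + τ • d ∈ N} := by
      refine (measure_mono fun τ hτ => ?_).trans (measure_union_le _ _)
      by_cases hc : crs d' (x + τ • d) ∈ T
      · left; rw [crs_add_smul] at hc; exact ⟨hτ.1, hc⟩
      · right; exact ⟨hτ.2, hc⟩
    rw [hx.2, add_zero] at h2
    exact hx.1.2.2.le.trans h2
  have hsum : ENNReal.ofReal |crs d d'| = ENNReal.ofReal |crs d' d| * (1 / 2) +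
      ENNReal.ofReal |crs d' d| * (1 / 2) := by
    rw [← mul_add, ENNReal.add_halves, mul_one, crs_comm d' d, abs_neg]
  rw [hsum]
  have rep : ∀ y ∈ proj d' B, ∃ x ∈ B, crs d' x = y := fun y hy => proj_subset_image hd' B hy
  refine volume_add_le_of_tails (proj_mono d' hBA) hTm
    (isBounded_proj hd' (hAb.subset hBA)) hY0 ?_ ?_
  · intro y hy
    obtain ⟨x, hx, rfl⟩ := rep y hy
    by_contra! hcon
    refine tail x hx _ hcon ?_
    rcases lt_or_gt_of_ne hk with hk' | hk'
    · refine (bw x hx).trans (measure_mono fun τ hτ => ⟨hτ.2, ?_⟩)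
      have := mul_pos_of_neg_of_neg hk' hτ.1
      simp; linarith
    · refine (fw x hx).trans (measure_mono fun τ hτ => ⟨hτ.2, ?_⟩)
      have := mul_pos hk' hτ.1
      simp; linarith
  · intro y hy
    obtain ⟨x, hx, rfl⟩ := rep y hy
    by_contra! hcon
    refine tail x hx _ hcon ?_
    rcases lt_or_gt_of_ne hk with hk' | hk'
    · refine (fw x hx).trans (measure_mono fun τ hτ => ⟨hτ.2, ?_⟩)
      have := mul_neg_of_neg_of_pos hk' hτ.1
      simp; linarith
    · refine (bw x hx).trans (measure_mono fun τ hτ => ⟨hτ.2, ?_⟩)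
      have := mul_neg_of_pos_of_neg hk' hτ.1
      simp; linarith

/-- The centred segment with direction and length given by `d`. -/
def seg (d : Plane) : Set Plane := (fun c : ℝ => c • d) '' Icc (-(1 / 2)) (1 / 2)

/-- The zonotope generated by a list of vectors. -/
def zono : List Plane → Set Plane
  | [] => {0}
  | d :: l => seg d + zono l

/-- Iterated compression. -/
def compressList : List Plane → Set Plane → Set Plane
  | [], A => A
  | d :: l, A => compressList l (compress d A)

/-- Sum of the lengths of the projections of `A` along the vectors of a list. -/
def projSum (l : List Plane) (A : Set Plane) : ℝ≥0∞ :=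
  (l.map fun d => volume (proj d A)).sum

/-- Sum of the areas spanned by the pairs of vectors of a list. -/
def pairSum (l : List Plane) : ℝ :=
  (l.map fun d => (l.map fun d' => |crs d d'|).sum).sum / 2

/-- The points `x` such that `x + Z ⊆ H`. -/
def erode (H Z : Set Plane) : Set Plane := {x | ∀ z ∈ Z, x + z ∈ H}

lemma abs_crs_comm (d d' : Plane) : |crs d d'| = |crs d' d| := by
  rw [crs_comm, abs_neg]

lemma pairSum_cons (d : Plane) (l : List Plane) :
    pairSum (d :: l) = (l.map fun d' => |crs d d'|).sum + pairSum l := by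
  unfold pairSum
  simp only [List.map_cons, List.sum_cons, crs_self, abs_zero, zero_add]
  have : (l.map fun d₁ => |crs d₁ d| + (l.map fun d' => |crs d₁ d'|).sum).sum =
      (l.map fun d' => |crs d d'|).sum + (l.map fun d₁ => (l.map fun d' => |crs d₁ d'|).sum).sum := by
    rw [List.sum_map_add]
    simp only [abs_crs_comm d]
  rw [this]
  ring

lemma pairSum_nonneg (l : List Plane) : 0 ≤ pairSum l := by
  unfold pairSum
  refine div_nonneg (List.sum_nonneg ?_) (by norm_num)
  simp only [List.mem_map]
  rintro _ ⟨d, -, rfl⟩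
  refine List.sum_nonneg ?_
  simp only [List.mem_map]
  rintro _ ⟨d', -, rfl⟩
  exact abs_nonneg _

lemma projSum_cons (d : Plane) (l : List Plane) (A : Set Plane) :
    projSum (d :: l) A = volume (proj d A) + projSum l A := by
  simp [projSum]

lemma projSum_mono (l : List Plane) {A B : Set Plane} (h : A ⊆ B) :
    projSum l A ≤ projSum l B :=
  List.sum_le_sum fun d _ => measure_mono (proj_mono d h)

lemma compressList_subset (l : List Plane) (A : Set Plane) : compressList l A ⊆ A := by
  induction l generalizing A with
  | nil => exact subset_rfl
  | cons d l ih => exact (ih _).trans (compress_subset d A)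

lemma measurableSet_compressList (l : List Plane) {A : Set Plane} (hA : MeasurableSet A) :
    MeasurableSet (compressList l A) := by
  induction l generalizing A with
  | nil => exact hA
  | cons d l ih => exact ih (measurableSet_compress d hA)

lemma compressList_append (l l' : List Plane) (A : Set Plane) :
    compressList (l ++ l') A = compressList l' (compressList l A) := by
  induction l generalizing A with
  | nil => rfl
  | cons d l ih => exact ih _

lemma volume_le_compressList {l : List Plane} (hl : ∀ d ∈ l, d ≠ 0) {A : Set Plane}
    (hA : MeasurableSet A) : volume A ≤ volume (compressList l A) + projSum l A := by
  induction l generalizing A with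
  | nil => simp [compressList, projSum]
  | cons d l ih =>
    have h1 := volume_le_compress (hl d (by simp)) hA
    have h2 := ih (fun d' hd' => hl d' (by simp [hd'])) (measurableSet_compress d hA)
    rw [projSum_cons]
    calc volume A ≤ volume (compress d A) + volume (proj d A) := h1
      _ ≤ volume (compressList l (compress d A)) + projSum l A + volume (proj d A) := by
          refine add_le_add_left (h2.trans (add_le_add_right ?_ _)) _
          exact projSum_mono l (compress_subset d A)
      _ = _ := by simp only [compressList]; ring

lemma volume_add_pairSum_le {l : List Plane} (hl : ∀ d ∈ l, d ≠ 0) {A : Set Plane}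
    (hA : MeasurableSet A) (hAb : Bornology.IsBounded A)
    (h0 : volume (compressList l A) ≠ 0) :
    volume A + ENNReal.ofReal (pairSum l) ≤ volume (compressList l A) + projSum l A := by
  induction l generalizing A with
  | nil => simp [compressList, projSum, pairSum]
  | cons d l ih =>
    have h1 := volume_le_compress (hl d (by simp)) hA
    have hl' : ∀ d' ∈ l, d' ≠ 0 := fun d' hd' => hl d' (by simp [hd'])
    have h2 := ih hl' (measurableSet_compress d hA) (hAb.subset (compress_subset d A)) h0
    have h0' : volume (compress d A) ≠ 0 := fun h =>
      h0 (measure_mono_null (compressList_subset l _) h)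
    have h3 : projSum l (compress d A) +
        ENNReal.ofReal ((l.map fun d' => |crs d d'|).sum) ≤ projSum l A := by
      clear ih h0 h2 hl
      induction l with
      | nil => simp [projSum]
      | cons e l ih' =>
        have a1 := ih' (fun d' hd' => hl' d' (by simp [hd']))
        have a2 := proj_compress_add_le (hl' e (by simp)) hA hAb h0'
        rw [projSum_cons, projSum_cons]
        simp only [List.map_cons, List.sum_cons]
        have hs : 0 ≤ (l.map fun d' => |crs d d'|).sum := by
          refine List.sum_nonneg ?_
          simp only [List.mem_map]
          rintro _ ⟨d', -, rfl⟩
          exact abs_nonneg _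
        rw [ENNReal.ofReal_add (abs_nonneg _) hs]
        refine le_trans (le_of_eq ?_) (add_le_add a2 a1)
        ring
    rw [projSum_cons, pairSum_cons, ENNReal.ofReal_add _ (pairSum_nonneg l)]
    swap
    · refine List.sum_nonneg ?_
      simp only [List.mem_map]
      rintro _ ⟨d', -, rfl⟩
      exact abs_nonneg _
    calc volume A + (ENNReal.ofReal ((l.map fun d' => |crs d d'|).sum)
          + ENNReal.ofReal (pairSum l))
        ≤ (volume (compress d A) + volume (proj d A)) +
          (ENNReal.ofReal ((l.map fun d' => |crs d d'|).sum) + ENNReal.ofReal (pairSum l)) :=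
          add_le_add_left h1 _
      _ = (volume (compress d A) + ENNReal.ofReal (pairSum l)) + volume (proj d A) +
          ENNReal.ofReal ((l.map fun d' => |crs d d'|).sum) := by ring
      _ ≤ (volume (compressList l (compress d A)) + projSum l (compress d A)) +
          volume (proj d A) + ENNReal.ofReal ((l.map fun d' => |crs d d'|).sum) := by gcongr
      _ = volume (compressList l (compress d A)) + volume (proj d A) +
          (projSum l (compress d A) + ENNReal.ofReal ((l.map fun d' => |crs d d'|).sum)) := by
          ring
      _ ≤ volume (compressList l (compress d A)) + volume (proj d A) + projSum l A := by gcongr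
      _ = _ := by simp only [compressList]; ring

lemma convex_erode {H : Set Plane} (hH : Convex ℝ H) (Z : Set Plane) :
    Convex ℝ (erode H Z) := by
  intro x hx y hy a b ha hb hab z hz
  have := hH (hx z hz) (hy z hz) ha hb hab
  convert this using 1
  have : z = (a + b) • z := by rw [hab, one_smul]
  nth_rewrite 1 [this]
  rw [add_smul]
  simp only [smul_add]
  abel

lemma compressList_subset_erode (l : List Plane) {A H : Set Plane} (hAH : A ⊆ H)
    (hH : Convex ℝ H) : compressList l A ⊆ erode H (zono l) := by
  induction l generalizing A H with
  | nil =>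
    intro x hx z hz
    simp only [zono, mem_singleton_iff] at hz
    rw [hz, add_zero]
    exact hAH hx
  | cons d l ih =>
    have h1 : compress d A ⊆ erode H (seg d) := by
      rintro x hx _ ⟨c, hc, rfl⟩
      exact mem_of_mem_compress hAH hH hx hc
    intro x hx
    have h2 := ih h1 (convex_erode hH _) hx
    rintro _ ⟨y, hy, z, hz, rfl⟩
    have := h2 z hz y hy
    convert this using 1
    simp only
    abel

lemma zono_append (l l' : List Plane) : zono (l ++ l') = zono l + zono l' := by
  induction l with
  | nil => simp [zono]
  | cons d l ih => simp only [List.cons_append, zono, ih, add_assoc]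

lemma zono_map_smul (c : ℝ) (l : List Plane) : zono (l.map (c • ·)) = c • zono l := by
  induction l with
  | nil => simp [zono]
  | cons d l ih =>
    simp only [List.map_cons, zono, ih, smul_add]
    congr 1
    ext x
    simp only [seg, mem_image, Set.mem_smul_set]
    constructor
    · rintro ⟨a, ha, rfl⟩
      exact ⟨a • d, ⟨a, ha, rfl⟩, smul_comm _ _ _⟩
    · rintro ⟨_, ⟨a, ha, rfl⟩, rfl⟩
      exact ⟨a, ha, smul_comm _ _ _⟩

lemma pairSum_map_smul {c : ℝ} (hc : 0 ≤ c) (l : List Plane) :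
    pairSum (l.map (c • ·)) = c ^ 2 * pairSum l := by
  unfold pairSum
  simp only [List.map_map, Function.comp_def, crs_smul_left, crs_smul_right, abs_mul,
    abs_of_nonneg hc, List.sum_map_mul_left]
  ring

lemma conj_smul {c : ℝ} (hc : c ≠ 0) (d : Plane) : conj (c • d) = c⁻¹ • conj d := by
  ext i
  fin_cases i <;> simp [conj] <;> field_simp

lemma volume_proj_smul {c : ℝ} (hc : 0 < c) (d : Plane) (A : Set Plane) :
    volume (proj (c • d) A) = ENNReal.ofReal c * volume (proj d A) := by
  have h1 : proj (c • d) A = (c⁻¹ * ·) ⁻¹' proj d A := by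
    ext t
    simp only [proj, mem_ofPred_eq, mem_preimage]
    have : slice (c • d) A t = (c * ·) ⁻¹' slice d A (c⁻¹ * t) := by
      ext s
      simp only [slice, mem_ofPred_eq, mem_preimage, frame, conj_smul hc.ne', smul_smul]
      rw [mul_comm s c, mul_comm t]
    rw [this, Real.volume_preimage_mul_left hc.ne']
    rw [ENNReal.mul_pos_iff]
    simp [hc.ne']
  rw [h1, Real.volume_preimage_mul_left (by positivity), inv_inv, abs_of_pos hc]

lemma projSum_map_smul {c : ℝ} (hc : 0 < c) (l : List Plane) (A : Set Plane) :
    projSum (l.map (c • ·)) A = ENNReal.ofReal c * projSum l A := by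
  unfold projSum
  simp only [List.map_map, Function.comp_def, volume_proj_smul hc, List.sum_map_mul_left]

lemma sum_map_flatten_replicate {M : Type*} [CommSemiring M] (f : Plane → M) (j : ℕ)
    (l : List Plane) :
    (((List.replicate j l).flatten).map f).sum = j * (l.map f).sum := by
  induction j with
  | zero => simp
  | succ j ih =>
    simp only [List.replicate_succ, List.flatten_cons, List.map_append, List.sum_append, ih]
    push_cast
    ring

lemma pairSum_replicate (j : ℕ) (l : List Plane) :
    pairSum (List.replicate j l).flatten = (j : ℝ) ^ 2 * pairSum l := by
  unfold pairSum
  simp only [sum_map_flatten_replicate, List.sum_map_mul_left]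
  ring

lemma projSum_replicate (j : ℕ) (l : List Plane) (A : Set Plane) :
    projSum (List.replicate j l).flatten A = j * projSum l A :=
  sum_map_flatten_replicate _ _ _

lemma smul_zono_subset (j : ℕ) (l : List Plane) {z : Plane} (hz : z ∈ zono l) :
    (j : ℝ) • z ∈ zono (List.replicate j l).flatten := by
  induction j with
  | zero => simp [zono]
  | succ j ih =>
    simp only [List.replicate_succ, List.flatten_cons, zono_append]
    refine ⟨z, hz, _, ih, ?_⟩
    push_cast
    rw [add_smul, one_smul, add_comm]

lemma projSum_ne_top {l : List Plane} (hl : ∀ d ∈ l, d ≠ 0) {A : Set Plane}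
    (hAb : Bornology.IsBounded A) : projSum l A ≠ ⊤ := by
  induction l with
  | nil => simp [projSum]
  | cons d l ih =>
    rw [projSum_cons]
    exact ENNReal.add_ne_top.mpr ⟨(isBounded_proj (hl d (by simp)) hAb).measure_lt_top.ne,
      ih fun d' hd' => hl d' (by simp [hd'])⟩

/-- Discrete isoperimetric alternative: a bounded set either survives erosion by `r • zono l`,
or it satisfies an isoperimetric inequality with a radius at most `r`. -/
theorem erosion_alternative {l : List Plane} (hl : ∀ d ∈ l, d ≠ 0) {A H : Set Plane}
    (hA : MeasurableSet A) (hAb : Bornology.IsBounded A) (hA0 : volume A ≠ 0)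
    (hAH : A ⊆ H) (hH : Convex ℝ H) {r : ℝ} (hr : 0 < r) {N : ℕ} (hN : 0 < N) :
    (∃ G, G ⊆ A ∧ (∀ x ∈ G, ∀ z ∈ zono l, x + r • z ∈ H) ∧
      volume.real A + r ^ 2 * pairSum l ≤ volume.real G + r * (projSum l A).toReal) ∨
    ∃ s ∈ Icc 0 r, volume.real A + s ^ 2 * pairSum l ≤
      s * (projSum l A).toReal + r / N * (projSum l A).toReal := by
  have hN' : (0 : ℝ) < N := by exact_mod_cast hN
  set c : ℝ := r / N with hc
  have hc0 : 0 < c := by positivity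
  set l' := l.map (c • ·) with hl'
  have hl0 : ∀ d ∈ l', d ≠ 0 := by
    intro d hd
    obtain ⟨e, he, rfl⟩ := List.mem_map.mp hd
    exact smul_ne_zero hc0.ne' (hl e he)
  set F : ℕ → Set Plane := fun j => compressList (List.replicate j l').flatten A with hF
  have hFA : ∀ j, F j ⊆ A := fun j => compressList_subset _ _
  have hFm : ∀ j, MeasurableSet (F j) := fun j => measurableSet_compressList _ hA
  have hAtop : volume A ≠ ⊤ := hAb.measure_lt_top.ne
  have hFtop : ∀ j, volume (F j) ≠ ⊤ := fun j => ne_top_of_le_ne_top hAtop (measure_mono (hFA j))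
  have hptop : projSum l A ≠ ⊤ := projSum_ne_top hl hAb
  have key : ∀ j : ℕ, volume (F j) ≠ 0 → volume.real A + (j * c) ^ 2 * pairSum l ≤
      volume.real (F j) + j * c * (projSum l A).toReal := by
    intro j hj
    have h1 := volume_add_pairSum_le (l := (List.replicate j l').flatten) (by
      intro d hd
      simp only [List.mem_flatten, List.mem_replicate] at hd
      obtain ⟨_, ⟨-, rfl⟩, hd⟩ := hd
      exact hl0 d hd) hA hAb hj
    rw [pairSum_replicate, projSum_replicate, hl', pairSum_map_smul hc0.le,
      projSum_map_smul hc0] at h1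
    have h2 := ENNReal.toReal_mono (by
      refine ENNReal.add_ne_top.mpr ⟨hFtop j, ?_⟩
      exact ENNReal.mul_ne_top (by simp) (ENNReal.mul_ne_top (by simp) hptop)) h1
    rw [ENNReal.toReal_add hAtop ENNReal.ofReal_ne_top, ENNReal.toReal_add (hFtop j)
      (ENNReal.mul_ne_top (by simp) (ENNReal.mul_ne_top (by simp) hptop)),
      ENNReal.toReal_ofReal (by have := pairSum_nonneg l; positivity),
      ENNReal.toReal_mul, ENNReal.toReal_mul, ENNReal.toReal_ofReal hc0.le,
      ENNReal.toReal_natCast] at h2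
    simp only [Measure.real]
    linarith
  have hNc : N * c = r := by rw [hc]; field_simp
  by_cases hlast : volume (F N) = 0
  · right
    have hex : ∃ j, volume (F j) = 0 := ⟨N, hlast⟩
    classical
    set k := Nat.find hex with hk
    have hk0 : volume (F k) = 0 := Nat.find_spec hex
    have hkN : k ≤ N := Nat.find_min' hex hlast
    have hk1 : k ≠ 0 := by
      intro h
      rw [h] at hk0
      exact hA0 hk0
    obtain ⟨j, hj⟩ := Nat.exists_eq_succ_of_ne_zero hk1
    have hjn : volume (F j) ≠ 0 := Nat.find_min hex (by omega)
    have h1 := key j hjn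
    have h2 := volume_le_compressList hl0 (hFm j)
    have h3 : compressList l' (F j) = F k := by
      rw [hj]
      simp only [hF, Nat.succ_eq_add_one, List.replicate_succ', List.flatten_append,
        compressList_append]
      simp
    rw [h3, hk0, zero_add] at h2
    have h4 := h2.trans (projSum_mono l' (hFA j))
    rw [hl', projSum_map_smul hc0] at h4
    have h5 := ENNReal.toReal_mono (ENNReal.mul_ne_top (by simp) hptop) h4
    rw [ENNReal.toReal_mul, ENNReal.toReal_ofReal hc0.le] at h5
    refine ⟨j * c, ⟨by positivity, ?_⟩, ?_⟩
    · rw [← hNc]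
      have : (j : ℝ) ≤ N := by exact_mod_cast (by omega : j ≤ N)
      gcongr
    · simp only [Measure.real] at h1 ⊢
      linarith
  · left
    refine ⟨F N, hFA N, ?_, ?_⟩
    · intro x hx z hz
      refine compressList_subset_erode _ hAH hH hx _ ?_
      have h1 : c • z ∈ zono l' := by
        rw [hl', zono_map_smul]
        exact Set.smul_mem_smul_set hz
      have := smul_zono_subset N l' h1
      rwa [smul_smul, hNc] at this
    · have := key N hlast
      rwa [hNc] at this

lemma locallyIntegrable_of_bounded {g : Plane → ℝ} (hg : Measurable g) {C : ℝ}
    (hC : ∀ x, |g x| ≤ C) : LocallyIntegrable g volume :=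
  (locallyIntegrable_const C).mono hg.aestronglyMeasurable
    (Eventually.of_forall fun x => by
      rw [Real.norm_eq_abs, Real.norm_eq_abs]; exact (hC x).trans (le_abs_self C))

lemma integrable_normed_mul (ρ : ContDiffBump (0 : Plane)) {g : Plane → ℝ} (hg : Measurable g)
    {C : ℝ} (hC : ∀ x, |g x| ≤ C) (x : Plane) :
    Integrable (fun z => ρ.normed volume z • g (x - z)) volume := by
  have h1 : Integrable (ρ.normed (volume : Measure Plane)) volume := ρ.integrable_normed
  refine (h1.bdd_mul (c := C) (f := fun z => g (x - z)) ?_ ?_).congr ?_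
  · exact (hg.comp (measurable_const.sub measurable_id)).aestronglyMeasurable
  · exact Eventually.of_forall fun z => hC _
  · exact Eventually.of_forall fun z => by simp [mul_comm]

lemma convolution_mem_Icc (ρ : ContDiffBump (0 : Plane)) {g : Plane → ℝ} (hg : Measurable g)
    {C : ℝ} (h0 : ∀ x, 0 ≤ g x) (hC : ∀ x, g x ≤ C) (x : Plane) :
    (ρ.normed volume ⋆[ContinuousLinearMap.lsmul ℝ ℝ, volume] g) x ∈ Icc 0 C := by
  rw [convolution_lsmul]
  have hi := integrable_normed_mul ρ hg (C := C)
    (fun x => by rw [abs_of_nonneg (h0 x)]; exact hC x) x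
  constructor
  · exact integral_nonneg fun z => smul_nonneg (ρ.nonneg_normed z) (h0 _)
  · calc ∫ z, ρ.normed volume z • g (x - z) ≤ ∫ z, ρ.normed volume z • C := by
          refine integral_mono hi ?_ fun z => ?_
          · exact ρ.integrable_normed.smul_const C
          · exact smul_le_smul_of_nonneg_left (hC _) (ρ.nonneg_normed z)
      _ = C := ρ.integral_normed_smul volume C

lemma fderiv_convolution_of_line {d : Plane} {ψ g : Plane → ℝ} (hψ : Measurable ψ)
    (hg : Measurable g) {C C' : ℝ} (hψC : ∀ x, |ψ x| ≤ C') (hgC : ∀ x, |g x| ≤ C)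
    (hline : ∀ x, ∀ h : ℝ, 0 ≤ h → ψ (x + h • d) - ψ x = ∫ τ in Ioc 0 h, g (x + τ • d))
    (ρ : ContDiffBump (0 : Plane)) (x : Plane) :
    fderiv ℝ (ρ.normed volume ⋆[ContinuousLinearMap.lsmul ℝ ℝ, volume] ψ) x d =
      (ρ.normed volume ⋆[ContinuousLinearMap.lsmul ℝ ℝ, volume] g) x := by
  set Ψ := ρ.normed volume ⋆[ContinuousLinearMap.lsmul ℝ ℝ, volume] ψ with hΨ
  set G := ρ.normed volume ⋆[ContinuousLinearMap.lsmul ℝ ℝ, volume] g with hG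
  have c1 : ContDiff ℝ 1 Ψ := HasCompactSupport.contDiff_convolution_left (n := 1) _
    ρ.hasCompactSupport_normed ρ.contDiff_normed (locallyIntegrable_of_bounded hψ hψC)
  have c2 : ContDiff ℝ 1 G := HasCompactSupport.contDiff_convolution_left (n := 1) _
    ρ.hasCompactSupport_normed ρ.contDiff_normed (locallyIntegrable_of_bounded hg hgC)
  have key : ∀ h : ℝ, 0 ≤ h → Ψ (x + h • d) - Ψ x = ∫ τ in (0 : ℝ)..h, G (x + τ • d) := by
    intro h hh
    rw [intervalIntegral.integral_of_le hh]
    simp only [hΨ, hG, convolution_lsmul]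
    rw [← integral_sub (integrable_normed_mul ρ hψ hψC _) (integrable_normed_mul ρ hψ hψC _)]
    rw [integral_integral_swap]
    · refine integral_congr_ae (Eventually.of_forall fun z => ?_)
      simp only []
      rw [← smul_sub, integral_smul]
      have e1 : x + h • d - z = x - z + h • d := by abel
      have e2 : ∀ τ : ℝ, x + τ • d - z = x - z + τ • d := fun τ => by abel
      simp only [e1, e2]
      rw [hline (x - z) h hh]
    · have h1 : Integrable (fun p : ℝ × Plane => ρ.normed volume p.2)
          ((volume.restrict (Ioc 0 h)).prod volume) :=
        (ρ.integrable_normed (μ := (volume : Measure Plane))).comp_snd _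
      refine (h1.bdd_mul (c := C) (f := fun p : ℝ × Plane => g (x + p.1 • d - p.2)) ?_ ?_).congr ?_
      · have : Measurable (fun p : ℝ × Plane => x + p.1 • d - p.2) := by fun_prop
        exact (hg.comp this).aestronglyMeasurable
      · exact Eventually.of_forall fun z => hgC _
      · exact Eventually.of_forall fun z => by simp [mul_comm, Function.uncurry]
  have d1 : HasDerivAt (fun h : ℝ => Ψ (x + h • d)) (fderiv ℝ Ψ x d) 0 := by
    have e : HasFDerivAt Ψ (fderiv ℝ Ψ x) (x + (0 : ℝ) • d) := by
      simpa using (c1.differentiable (by norm_num) x).hasFDerivAt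
    have e2 : HasDerivAt (fun h : ℝ => x + h • d) d 0 := by
      simpa using ((hasDerivAt_id (0 : ℝ)).smul_const d).const_add x
    exact e.comp_hasDerivAt (0 : ℝ) e2
  have d2 : HasDerivAt (fun h : ℝ => ∫ τ in (0 : ℝ)..h, G (x + τ • d)) (G x) 0 := by
    have hc : Continuous fun τ : ℝ => G (x + τ • d) := c2.continuous.comp (by fun_prop)
    have := intervalIntegral.integral_hasDerivAt_right (hc.intervalIntegrable 0 0)
      hc.aestronglyMeasurable.stronglyMeasurableAtFilter hc.continuousAt
    simpa using this
  have d3 : HasDerivWithinAt (fun h : ℝ => Ψ (x + h • d) - Ψ x) (G x) (Ici 0) 0 :=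
    d2.hasDerivWithinAt.congr (fun h hh => key h hh) (key 0 le_rfl)
  have d4 := (d1.sub_const (Ψ x)).hasDerivWithinAt (s := Ici 0)
  exact (uniqueDiffWithinAt_Ici (0 : ℝ)).eq_deriv _ d4 d3

lemma volume_slice_ne_top {d : Plane} (hd : d ≠ 0) {F : Set Plane}
    (hF : Bornology.IsBounded F) (t : ℝ) : volume (slice d F t) ≠ ⊤ := by
  have h1 : IsCompact ((fun x => crs x (conj d)) '' closure F) :=
    hF.isCompact_closure.image (by unfold crs; fun_prop)
  refine ne_top_of_le_ne_top h1.measure_ne_top (measure_mono fun s hs => ?_)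
  refine ⟨_, subset_closure hs, ?_⟩
  have := crs_conj hd
  change crs (frame d (s, t)) (conj d) = s
  rw [crs_comm (conj d), frame, crs_add_right, crs_smul_right, crs_smul_right, crs_self,
    crs_comm d (conj d), this]
  ring

/-- The length of the part of `F` behind `x` along `d`, relative to the length of the part of `F`
on the whole line. -/
def fracBehind (d : Plane) (F : Set Plane) (δ : ℝ) (x : Plane) : ℝ :=
  (bwd d F x).toReal / max δ (volume (slice d F (crs d x))).toReal

/-- The density of `fracBehind` along `d`. -/
def fracDensity (d : Plane) (F : Set Plane) (δ : ℝ) (x : Plane) : ℝ :=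
  F.indicator 1 x / max δ (volume (slice d F (crs d x))).toReal

lemma measurable_slice_crs (d : Plane) {F : Set Plane} (hF : MeasurableSet F) (δ : ℝ) :
    Measurable fun x => max δ (volume (slice d F (crs d x))).toReal :=
  measurable_const.max
    ((measurable_volume_slice d hF).comp (continuous_crs d).measurable).ennreal_toReal

lemma measurable_fracBehind (d : Plane) {F : Set Plane} (hF : MeasurableSet F) (δ : ℝ) :
    Measurable (fracBehind d F δ) :=
  (measurable_bwd d hF).ennreal_toReal.div (measurable_slice_crs d hF δ)

lemma measurable_fracDensity (d : Plane) {F : Set Plane} (hF : MeasurableSet F) (δ : ℝ) :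
    Measurable (fracDensity d F δ) :=
  (measurable_one.indicator hF).div (measurable_slice_crs d hF δ)

lemma fracBehind_mem_Icc {d : Plane} (hd : d ≠ 0) {F : Set Plane}
    (hFb : Bornology.IsBounded F) {δ : ℝ} (hδ : 0 < δ) (x : Plane) :
    fracBehind d F δ x ∈ Icc (0 : ℝ) 1 := by
  refine ⟨by unfold fracBehind; positivity, ?_⟩
  unfold fracBehind
  rw [div_le_one (lt_max_of_lt_left hδ)]
  refine le_trans ?_ (le_max_right _ _)
  refine ENNReal.toReal_mono (volume_slice_ne_top hd hFb _) ?_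
  conv_lhs => rw [← frame_inv hd x, bwd_frame]
  exact measure_mono inter_subset_left

lemma fracDensity_nonneg (d : Plane) (F : Set Plane) {δ : ℝ} (hδ : 0 < δ) (x : Plane) :
    0 ≤ fracDensity d F δ x := by
  have : (0 : ℝ) ≤ F.indicator 1 x := indicator_nonneg (fun _ _ => zero_le_one) x
  unfold fracDensity; positivity

lemma fracDensity_le (d : Plane) (F : Set Plane) {δ : ℝ} (hδ : 0 < δ) (x : Plane) :
    fracDensity d F δ x ≤ 1 / δ := by
  have : F.indicator (1 : Plane → ℝ) x ≤ 1 := indicator_le_self' (fun _ _ => zero_le_one) x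
  unfold fracDensity
  exact div_le_div₀ zero_le_one this hδ (le_max_left _ _)

lemma fracBehind_line {d : Plane} (hd : d ≠ 0) {F : Set Plane} (hF : MeasurableSet F)
    (hFb : Bornology.IsBounded F) (δ : ℝ) (x : Plane) (h : ℝ) (hh : 0 ≤ h) :
    fracBehind d F δ (x + h • d) - fracBehind d F δ x =
      ∫ τ in Ioc 0 h, fracDensity d F δ (x + τ • d) := by
  have hc : ∀ τ : ℝ, crs d (x + τ • d) = crs d x := fun τ => by
    simp [crs_add_right, crs_smul_right, crs_self]
  unfold fracBehind fracDensity
  simp only [hc]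
  set t := crs d x with ht
  set s := crs x (conj d) with hs
  have hx : frame d (s, t) = x := frame_inv hd x
  rw [integral_div, ← sub_div]
  congr 1
  have hA := measurableSet_slice d hF t
  have e1 : bwd d F (x + h • d) = volume (slice d F t ∩ Iio (s + h)) := by
    rw [← hx, frame_add, bwd_frame]
  have e2 : bwd d F x = volume (slice d F t ∩ Iio s) := by rw [← hx, bwd_frame]
  have e3 : ∫ τ in Ioc 0 h, F.indicator (1 : Plane → ℝ) (x + τ • d) =
      (volume (slice d F t ∩ Ico s (s + h))).toReal := by
    have f1 : ∀ τ : ℝ, F.indicator (1 : Plane → ℝ) (x + τ • d) =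
        ((fun τ => τ + s) ⁻¹' (slice d F t)).indicator 1 τ := fun τ => by
      have : x + τ • d ∈ F ↔ τ ∈ (fun τ => τ + s) ⁻¹' (slice d F t) := by
        simp only [mem_preimage, slice, mem_ofPred_eq]
        rw [← hx, frame_add, add_comm]
      by_cases hm : x + τ • d ∈ F
      · simp [hm, this.mp hm]
      · simp [hm, mt this.mpr hm]
    simp only [f1]
    have hmA : MeasurableSet ((fun τ : ℝ => τ + s) ⁻¹' slice d F t) :=
      (measurable_id.add_const s) hA
    rw [integral_indicator_one hmA, measureReal_def, Measure.restrict_apply hmA]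
    congr 1
    have : (fun τ => τ + s) ⁻¹' slice d F t ∩ Ioc 0 h =
        (fun τ => τ + s) ⁻¹' (slice d F t ∩ Ioc s (s + h)) := by
      ext τ
      simp only [mem_inter_iff, mem_preimage, mem_Ioc]
      constructor <;> rintro ⟨a, b, c⟩ <;> exact ⟨a, by linarith, by linarith⟩
    change volume ((fun τ => τ + s) ⁻¹' slice d F t ∩ Ioc 0 h) = _
    rw [this, measure_preimage_add_right]
    exact measure_congr ((ae_eq_refl _).inter Ico_ae_eq_Ioc.symm)
  have e4 : slice d F t ∩ Iio (s + h) = slice d F t ∩ Iio s ∪ slice d F t ∩ Ico s (s + h) := by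
    rw [← inter_union_distrib_left, Iio_union_Ico_eq_Iio (by linarith)]
  have hfin : ∀ B, volume (slice d F t ∩ B) ≠ ⊤ := fun B =>
    ne_top_of_le_ne_top (volume_slice_ne_top hd hFb t) (measure_mono inter_subset_left)
  rw [e3, e1, e2, e4, measure_union _ (hA.inter measurableSet_Ico),
    ENNReal.toReal_add (hfin _) (hfin _)]
  · ring
  · refine disjoint_left.mpr fun τ h1 h2 => ?_
    exact absurd h1.2 (not_lt.mpr h2.2.1)

lemma lintegral_comp_crs {d : Plane} (hd : d ≠ 0) {F : Set Plane} (hF : MeasurableSet F)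
    {f : ℝ → ℝ≥0∞} (hf : Measurable f) :
    ∫⁻ x in F, f (crs d x) = ∫⁻ t, f t * volume (slice d F t) := by
  have hm : Measurable (F.indicator fun x => f (crs d x)) :=
    (hf.comp (continuous_crs d).measurable).indicator hF
  rw [← lintegral_indicator hF, ← (measurePreserving_frame hd).lintegral_comp hm,
    Measure.volume_eq_prod, lintegral_prod_symm' (fun a => F.indicator (fun x => f (crs d x)) (frame d a))
      (hm.comp (continuous_frame d).measurable)]
  refine lintegral_congr fun t => ?_
  have : ∀ s, F.indicator (fun x => f (crs d x)) (frame d (s, t)) =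
      (slice d F t).indicator (fun _ => f t) s := fun s => by
    by_cases h : frame d (s, t) ∈ F
    · rw [indicator_of_mem h, indicator_of_mem (show s ∈ slice d F t from h), crs_frame hd]
    · rw [indicator_of_notMem h, indicator_of_notMem (show s ∉ slice d F t from h)]
  simp only [this]
  rw [lintegral_indicator (measurableSet_slice d hF t), setLIntegral_const]

lemma le_integral_fracDensity {d : Plane} (hd : d ≠ 0) {F : Set Plane} (hF : MeasurableSet F)
    (hFb : Bornology.IsBounded F) {δ : ℝ} (hδ : 0 < δ) :
    (volume {t | ENNReal.ofReal δ < volume (slice d F t)}).toReal ≤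
      ∫ x in F, fracDensity d F δ x := by
  have hInt : IntegrableOn (fracDensity d F δ) F volume := by
    refine Integrable.mono' (g := fun _ => 1 / δ) ?_
      (measurable_fracDensity d hF δ).aestronglyMeasurable
      (Eventually.of_forall fun x => ?_)
    · exact integrableOn_const hFb.measure_lt_top.ne
    · rw [Real.norm_eq_abs, abs_of_nonneg (fracDensity_nonneg d F hδ x)]
      exact fracDensity_le d F hδ x
  rw [integral_eq_lintegral_of_nonneg_ae (Eventually.of_forall (fracDensity_nonneg d F hδ))
    (measurable_fracDensity d hF δ).aestronglyMeasurable]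
  refine ENNReal.toReal_mono ?_ ?_
  · exact hInt.lintegral_lt_top.ne
  have e : ∫⁻ x in F, ENNReal.ofReal (fracDensity d F δ x) =
      ∫⁻ x in F, ENNReal.ofReal (1 / max δ (volume (slice d F (crs d x))).toReal) := by
    refine setLIntegral_congr_fun hF fun x hx => ?_
    simp [fracDensity, hx]
  rw [e, lintegral_comp_crs hd hF (f := fun t => ENNReal.ofReal
    (1 / max δ (volume (slice d F t)).toReal))
    (ENNReal.measurable_ofReal.comp (measurable_const.div (measurable_const.max
      (measurable_volume_slice d hF).ennreal_toReal)))]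
  have hms : MeasurableSet {t | ENNReal.ofReal δ < volume (slice d F t)} :=
    measurableSet_lt measurable_const (measurable_volume_slice d hF)
  rw [← lintegral_indicator_one hms]
  refine lintegral_mono fun t => ?_
  by_cases ht : ENNReal.ofReal δ < volume (slice d F t)
  · rw [indicator_of_mem (by exact ht)]
    have hfin := volume_slice_ne_top hd hFb t
    have h1 : δ < (volume (slice d F t)).toReal :=
      (ENNReal.ofReal_lt_iff_lt_toReal hδ.le hfin).mp ht
    rw [max_eq_right h1.le, Pi.one_apply]
    conv_rhs => rw [← ENNReal.ofReal_toReal hfin]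
    rw [← ENNReal.ofReal_mul (by positivity), ENNReal.toReal_ofReal (by positivity),
      one_div, inv_mul_cancel₀ (by linarith)]
    simp
  · rw [indicator_of_notMem (by exact ht)]
    exact zero_le

lemma exists_volume_proj_sub_le {d : Plane} (hd : d ≠ 0) {F : Set Plane}
    (hFb : Bornology.IsBounded F) {ε : ℝ} (hε : 0 < ε) :
    ∃ δ : ℝ, 0 < δ ∧ (volume (proj d F)).toReal - ε ≤
      (volume {t | ENNReal.ofReal δ < volume (slice d F t)}).toReal := by
  let S : ℕ → Set ℝ := fun n => {t | ENNReal.ofReal (1 / ((n : ℝ) + 1)) < volume (slice d F t)}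
  have hmono : Monotone S := fun n k hnk t (ht : _ < _) =>
    lt_of_le_of_lt (ENNReal.ofReal_le_ofReal (one_div_le_one_div_of_le (by positivity)
      (by exact_mod_cast Nat.succ_le_succ hnk))) ht
  have hU : ⋃ n, S n = proj d F := by
    ext t
    simp only [mem_iUnion, S, proj, mem_ofPred_eq]
    constructor
    · rintro ⟨n, hn⟩
      exact lt_of_le_of_lt zero_le hn
    · intro ht
      have hpos : 0 < (volume (slice d F t)).toReal :=
        ENNReal.toReal_pos ht.ne' (volume_slice_ne_top hd hFb t)
      obtain ⟨n, hn⟩ := exists_nat_one_div_lt hpos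
      exact ⟨n, (ENNReal.ofReal_lt_iff_lt_toReal (by positivity)
        (volume_slice_ne_top hd hFb t)).mpr hn⟩
  have ht := tendsto_measure_iUnion_atTop (μ := volume) hmono
  rw [hU] at ht
  have hfin : volume (proj d F) ≠ ⊤ := (isBounded_proj hd hFb).measure_lt_top.ne
  have ht' := (ENNReal.tendsto_toReal hfin).comp ht
  obtain ⟨n, hn⟩ := (ht'.eventually (lt_mem_nhds (show (volume (proj d F)).toReal - ε <
    (volume (proj d F)).toReal by linarith))).exists
  exact ⟨1 / ((n : ℝ) + 1), by positivity, hn.le⟩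

/-- A sequence of bump functions shrinking to the origin. -/
def shrinkBump (n : ℕ) : ContDiffBump (0 : Plane) where
  rIn := 1 / ((n : ℝ) + 1)
  rOut := 2 / ((n : ℝ) + 1)
  rIn_pos := by positivity
  rIn_lt_rOut := by gcongr; norm_num

lemma exists_crossing_field {d : Plane} (hd : d ≠ 0) {F : Set Plane} (hF : MeasurableSet F)
    (hFb : Bornology.IsBounded F) {ε : ℝ} (hε : 0 < ε) :
    ∃ ψ : Plane → ℝ, ContDiff ℝ 1 ψ ∧ HasCompactSupport ψ ∧ (∀ x, |ψ x| ≤ 1 / 2) ∧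
      (volume (proj d F)).toReal - ε ≤ ∫ x in F, fderiv ℝ ψ x d := by
  obtain ⟨δ, hδ, hδ'⟩ := exists_volume_proj_sub_le hd hFb (half_pos hε)
  have hgm := measurable_fracDensity d hF δ
  have hgb : ∀ x, |fracDensity d F δ x| ≤ 1 / δ := fun x => by
    rw [abs_of_nonneg (fracDensity_nonneg d F hδ x)]; exact fracDensity_le d F hδ x
  have hψm := measurable_fracBehind d hF δ
  have hψb : ∀ x, |fracBehind d F δ x| ≤ 1 := fun x => by
    rw [abs_of_nonneg (fracBehind_mem_Icc hd hFb hδ x).1]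
    exact (fracBehind_mem_Icc hd hFb hδ x).2
  let G : ℕ → Plane → ℝ := fun n => (shrinkBump n).normed volume
    ⋆[ContinuousLinearMap.lsmul ℝ ℝ, volume] fracDensity d F δ
  let Ψ : ℕ → Plane → ℝ := fun n => (shrinkBump n).normed volume
    ⋆[ContinuousLinearMap.lsmul ℝ ℝ, volume] fracBehind d F δ
  have hGc : ∀ n, Continuous (G n) := fun n =>
    (HasCompactSupport.contDiff_convolution_left (n := 1) _
      (shrinkBump n).hasCompactSupport_normed (shrinkBump n).contDiff_normed
      (locallyIntegrable_of_bounded hgm hgb)).continuous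
  have hΨc : ∀ n, ContDiff ℝ 1 (Ψ n) := fun n =>
    HasCompactSupport.contDiff_convolution_left (n := 1) _
      (shrinkBump n).hasCompactSupport_normed (shrinkBump n).contDiff_normed
      (locallyIntegrable_of_bounded hψm hψb)
  have hlim : ∀ᵐ x ∂(volume : Measure Plane),
      Tendsto (fun n => G n x) atTop (𝓝 (fracDensity d F δ x)) := by
    refine ContDiffBump.ae_convolution_tendsto_right_of_locallyIntegrable (K := 2) ?_ ?_
      (locallyIntegrable_of_bounded hgm hgb)
    · have := (tendsto_one_div_add_atTop_nhds_zero_nat (𝕜 := ℝ)).const_mul 2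
      simpa [shrinkBump, div_eq_mul_inv] using this
    · exact Eventually.of_forall fun n => by simp [shrinkBump, div_eq_mul_inv]
  have hconv : Tendsto (fun n => ∫ x in F, G n x) atTop (𝓝 (∫ x in F, fracDensity d F δ x)) := by
    refine tendsto_integral_of_dominated_convergence (fun _ => 1 / δ)
      (fun n => (hGc n).aestronglyMeasurable)
      (integrableOn_const hFb.measure_lt_top.ne) ?_ (ae_restrict_of_ae hlim)
    refine fun n => Eventually.of_forall fun x => ?_
    have := convolution_mem_Icc (shrinkBump n) hgm (fracDensity_nonneg d F hδ)
      (fracDensity_le d F hδ) x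
    rw [Real.norm_eq_abs, abs_of_nonneg this.1]
    exact this.2
  obtain ⟨n, hn⟩ := (hconv.eventually (lt_mem_nhds (show (∫ x in F, fracDensity d F δ x) - ε / 2 <
    ∫ x in F, fracDensity d F δ x by linarith))).exists
  obtain ⟨R, hR0, hR⟩ := hFb.subset_ball_lt 0 (0 : Plane)
  let χ : ContDiffBump (0 : Plane) := ⟨R, R + 1, hR0, by linarith⟩
  refine ⟨fun x => χ x * (Ψ n x - 1 / 2), χ.contDiff.mul ((hΨc n).sub contDiff_const),
    χ.hasCompactSupport.mul_right, fun x => ?_, ?_⟩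
  · have h1 := convolution_mem_Icc (shrinkBump n) hψm
      (fun x => (fracBehind_mem_Icc hd hFb hδ x).1) (fun x => (fracBehind_mem_Icc hd hFb hδ x).2) x
    rw [abs_mul, abs_of_nonneg (χ.nonneg)]
    have h2 : |Ψ n x - 1 / 2| ≤ 1 / 2 := abs_le.mpr ⟨by linarith [h1.1], by linarith [h1.2]⟩
    calc χ x * |Ψ n x - 1 / 2| ≤ 1 * (1 / 2) :=
          mul_le_mul χ.le_one h2 (abs_nonneg _) zero_le_one
      _ = 1 / 2 := one_mul _
  · have e : ∫ x in F, fderiv ℝ (fun x => χ x * (Ψ n x - 1 / 2)) x d = ∫ x in F, G n x := by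
      refine setIntegral_congr_fun hF fun x hx => ?_
      have he : (fun x => χ x * (Ψ n x - 1 / 2)) =ᶠ[𝓝 x] fun x => Ψ n x - 1 / 2 := by
        filter_upwards [Metric.isOpen_ball.mem_nhds (hR hx)] with y hy
        rw [χ.one_of_mem_closedBall (Metric.ball_subset_closedBall hy), one_mul]
      rw [he.fderiv_eq, fderiv_sub_const]
      exact fderiv_convolution_of_line hψm hgm hψb hgb
        (fun x h hh => fracBehind_line hd hF hFb δ x h hh) _ x
    rw [e]
    have := le_integral_fracDensity hd hF hFb hδ
    linarith

lemma diverg_smul_const {ψ : Plane → ℝ} (hψ : ContDiff ℝ 1 ψ) (d x : Plane) :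
    diverg (fun y => ψ y • d) x = fderiv ℝ ψ x d := by
  have h1 : HasFDerivAt (fun y => ψ y • d) ((fderiv ℝ ψ x).smulRight d) x :=
    (hψ.differentiable (by norm_num) x).hasFDerivAt.smul_const d
  unfold diverg
  rw [h1.fderiv]
  have h2 : d = d 0 • Pi.single (0 : Fin 2) (1 : ℝ) + d 1 • Pi.single (1 : Fin 2) (1 : ℝ) := by
    ext i; fin_cases i <;> simp
  conv_rhs => rw [h2, map_add, map_smul, map_smul]
  simp [Fin.sum_univ_two, mul_comm]

lemma diverg_add {η ξ : Plane → Plane} (hη : ContDiff ℝ 1 η) (hξ : ContDiff ℝ 1 ξ) (x : Plane) :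
    diverg (η + ξ) x = diverg η x + diverg ξ x := by
  unfold diverg
  rw [fderiv_add (hη.differentiable (by norm_num) x) (hξ.differentiable (by norm_num) x)]
  simp [Fin.sum_univ_two]; ring

lemma continuous_diverg {η : Plane → Plane} (hη : ContDiff ℝ 1 η) : Continuous (diverg η) := by
  unfold diverg
  have := hη.continuous_fderiv (by norm_num)
  fun_prop

lemma integrableOn_diverg {η : Plane → Plane} (hη : ContDiff ℝ 1 η) {F : Set Plane}
    (hFb : Bornology.IsBounded F) : IntegrableOn (diverg η) F volume :=
  ((continuous_diverg hη).continuousOn.integrableOn_compact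
    hFb.isCompact_closure).mono_set subset_closure

lemma exists_zono_field {l : List Plane} (hl : ∀ d ∈ l, d ≠ 0) {F : Set Plane}
    (hF : MeasurableSet F) (hFb : Bornology.IsBounded F) {ε : ℝ} (hε : 0 < ε) :
    ∃ η : Plane → Plane, ContDiff ℝ 1 η ∧ HasCompactSupport η ∧ (∀ x, η x ∈ zono l) ∧
      (projSum l F).toReal - l.length * ε ≤ ∫ x in F, diverg η x := by
  induction l with
  | nil =>
    refine ⟨0, contDiff_zero_fun, HasCompactSupport.zero, fun x => by simp [zono], ?_⟩
    have : diverg (0 : Plane → Plane) = 0 := by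
      ext x; simp [diverg]
    simp [projSum, this]
  | cons d l ih =>
    have hd := hl d (by simp)
    have hl' : ∀ d ∈ l, d ≠ 0 := fun e he => hl e (by simp [he])
    obtain ⟨η, h1, h2, h3, h4⟩ := ih hl'
    obtain ⟨ψ, p1, p2, p3, p4⟩ := exists_crossing_field hd hF hFb hε
    refine ⟨(fun x => ψ x • d) + η, (p1.smul contDiff_const).add h1, ?_, fun x => ?_, ?_⟩
    · exact (p2.smul_right (f' := fun _ => d)).add h2
    · exact add_mem_add ⟨ψ x, abs_le.mp (p3 x), rfl⟩ (h3 x)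
    · have hc : ContDiff ℝ 1 fun x => ψ x • d := p1.smul contDiff_const
      simp only [diverg_add hc h1]
      rw [integral_add (integrableOn_diverg hc hFb) (integrableOn_diverg h1 hFb), projSum_cons,
        ENNReal.toReal_add (isBounded_proj hd hFb).measure_lt_top.ne
        (projSum_ne_top hl' hFb)]
      simp only [diverg_smul_const p1]
      push_cast [List.length_cons]
      linarith

lemma le_anisoPerimeter {φ : Plane → ℝ} {η : Plane → Plane} (h1 : ContDiff ℝ 1 η)
    (h2 : HasCompactSupport η) (h3 : ∀ x, φ (η x) ≤ 1) {F : Set Plane} (hF : MeasurableSet F) :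
    ENNReal.ofReal (∫ x in F, diverg η x) ≤ anisoPerimeter φ F := by
  have : ∫ x in F, diverg η x = ∫ x, F.indicator (1 : Plane → ℝ) x * diverg η x := by
    rw [← integral_indicator hF]
    refine integral_congr_ae (Eventually.of_forall fun x => ?_)
    by_cases h : x ∈ F <;> simp [h]
  rw [this]
  exact le_iSup₂_of_le (f := fun (η : Plane → Plane) (_ : η ∈ {η : Plane → Plane |
    ContDiff ℝ 1 η ∧ HasCompactSupport η ∧ ∀ x, φ (η x) ≤ 1}) =>
    ENNReal.ofReal (∫ x, F.indicator (1 : Plane → ℝ) x * diverg η x)) η ⟨h1, h2, h3⟩ le_rfl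

lemma projSum_le_anisoPerimeter {φ : Plane → ℝ} {l : List Plane} (hl : ∀ d ∈ l, d ≠ 0)
    (hlφ : ∀ z ∈ zono l, φ z ≤ 1) {F : Set Plane} (hF : MeasurableSet F)
    (hFb : Bornology.IsBounded F) : projSum l F ≤ anisoPerimeter φ F := by
  rw [← ENNReal.ofReal_toReal (projSum_ne_top hl hFb)]
  refine ENNReal.le_of_forall_pos_le_add fun ε hε _ => ?_
  obtain ⟨η, h1, h2, h3, h4⟩ := exists_zono_field hl hF hFb
    (ε := ε / (l.length + 1)) (by positivity)
  have h5 : (l.length : ℝ) * (ε / (l.length + 1)) ≤ ε := by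
    rw [mul_div_assoc', div_le_iff₀ (by positivity)]
    nlinarith [ε.coe_nonneg]
  calc ENNReal.ofReal (projSum l F).toReal
      ≤ ENNReal.ofReal ((∫ x in F, diverg η x) + ε) := ENNReal.ofReal_le_ofReal (by linarith)
    _ ≤ ENNReal.ofReal (∫ x in F, diverg η x) + ENNReal.ofReal ε := ENNReal.ofReal_add_le
    _ ≤ anisoPerimeter φ F + ε := by
        rw [ENNReal.ofReal_coe_nnreal]
        gcongr
        exact le_anisoPerimeter h1 h2 (fun x => hlφ _ (h3 x)) hF

namespace IsNorm

variable {φ : Plane → ℝ} (hφ : IsNorm φ)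
include hφ

lemma zero : φ 0 = 0 := (hφ.eq_zero_iff 0).mpr rfl

lemma neg (x : Plane) : φ (-x) = φ x := by
  have := hφ.smul_eq (-1) x
  simpa using this

lemma pos {x : Plane} (hx : x ≠ 0) : 0 < φ x :=
  lt_of_le_of_ne (hφ.nonneg x) fun h => hx ((hφ.eq_zero_iff x).mp h.symm)

lemma sub_comm (x y : Plane) : φ (x - y) = φ (y - x) := by
  rw [← hφ.neg, neg_sub]

lemma smul_of_nonneg {a : ℝ} (ha : 0 ≤ a) (x : Plane) : φ (a • x) = a * φ x := by
  rw [hφ.smul_eq, abs_of_nonneg ha]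

lemma le_mul_norm (x : Plane) :
    φ x ≤ (φ (Pi.single 0 1) + φ (Pi.single 1 1)) * ‖x‖ := by
  have h2 : x = x 0 • Pi.single (0 : Fin 2) (1 : ℝ) + x 1 • Pi.single (1 : Fin 2) (1 : ℝ) := by
    ext i; fin_cases i <;> simp
  have a0 : |x 0| ≤ ‖x‖ := norm_le_pi_norm x 0
  have a1 : |x 1| ≤ ‖x‖ := norm_le_pi_norm x 1
  calc φ x ≤ |x 0| * φ (Pi.single 0 1) + |x 1| * φ (Pi.single 1 1) := by
        conv_lhs => rw [h2]
        rw [← hφ.smul_eq, ← hφ.smul_eq]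
        exact hφ.add_le _ _
    _ ≤ ‖x‖ * φ (Pi.single 0 1) + ‖x‖ * φ (Pi.single 1 1) := by
        gcongr <;> exact hφ.nonneg _
    _ = _ := by ring

lemma abs_sub_le (x y : Plane) : |φ x - φ y| ≤ φ (x - y) := by
  rw [abs_le]
  have h1 := hφ.add_le (x - y) y
  have h2 := hφ.add_le (y - x) x
  rw [sub_add_cancel] at h1 h2
  rw [hφ.sub_comm y x] at h2
  constructor <;> linarith

lemma continuous : Continuous φ := by
  set C := φ (Pi.single 0 1) + φ (Pi.single 1 1)
  have hC : 0 ≤ C := add_nonneg (hφ.nonneg _) (hφ.nonneg _)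
  have : LipschitzWith ⟨C, hC⟩ φ := LipschitzWith.of_dist_le_mul fun x y => by
    rw [Real.dist_eq, dist_eq_norm]
    exact (hφ.abs_sub_le x y).trans (hφ.le_mul_norm _)
  exact this.continuous

lemma exists_mul_norm_le : ∃ c : ℝ, 0 < c ∧ ∀ x, c * ‖x‖ ≤ φ x := by
  have hcomp : IsCompact (Metric.sphere (0 : Plane) 1) := isCompact_sphere 0 1
  obtain ⟨x₀, hx₀, hmin⟩ := hcomp.exists_isMinOn (NormedSpace.sphere_nonempty.mpr zero_le_one)
    hφ.continuous.continuousOn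
  have hx₀' : x₀ ≠ 0 := by
    rintro rfl
    simp at hx₀
  refine ⟨φ x₀, hφ.pos hx₀', fun x => ?_⟩
  rcases eq_or_ne x 0 with rfl | hx
  · simp [hφ.zero]
  have hn : 0 < ‖x‖ := norm_pos_iff.mpr hx
  have h1 : φ x₀ ≤ φ (‖x‖⁻¹ • x) := by
    refine hmin ?_
    simp [norm_smul, hn.ne']
  rw [hφ.smul_of_nonneg (by positivity), inv_mul_eq_div, le_div_iff₀ hn] at h1
  exact h1

end IsNorm

/-- The closed Wulff ball centred at the origin. -/
def wb (φ : Plane → ℝ) (s : ℝ) : Set Plane := {x | φ x ≤ s}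

namespace IsNorm

variable {φ : Plane → ℝ} (hφ : IsNorm φ)
include hφ

lemma isClosed_wb (s : ℝ) : IsClosed (wb φ s) := isClosed_le hφ.continuous continuous_const

lemma isCompact_wb (s : ℝ) : IsCompact (wb φ s) := by
  obtain ⟨c, hc, h⟩ := hφ.exists_mul_norm_le
  refine Metric.isCompact_of_isClosed_isBounded (hφ.isClosed_wb s) ?_
  refine Metric.isBounded_closedBall (x := (0 : Plane)) (r := s / c) |>.subset fun x hx => ?_
  rw [mem_closedBall_zero_iff, le_div_iff₀ hc, mul_comm]
  exact (h x).trans hx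

lemma convex_wb (s : ℝ) : Convex ℝ (wb φ s) := by
  intro x hx y hy a b ha hb hab
  have := hφ.add_le (a • x) (b • y)
  rw [hφ.smul_of_nonneg ha, hφ.smul_of_nonneg hb] at this
  calc φ (a • x + b • y) ≤ a * φ x + b * φ y := this
    _ ≤ a * s + b * s := by gcongr <;> assumption
    _ = s := by rw [← add_mul, hab, one_mul]

lemma wb_smul {s : ℝ} (hs : 0 < s) : wb φ s = s • wb φ 1 := by
  ext x
  rw [mem_smul_set_iff_inv_smul_mem₀ hs.ne']
  simp only [wb, mem_ofPred_eq]
  rw [hφ.smul_of_nonneg (by positivity), inv_mul_le_iff₀ hs, mul_one]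

lemma zero_mem_wb {s : ℝ} (hs : 0 ≤ s) : (0 : Plane) ∈ wb φ s := by
  change φ 0 ≤ s; rwa [hφ.zero]

lemma wb_zero : wb φ 0 = {0} := by
  ext x
  simp only [wb, mem_ofPred_eq, mem_singleton_iff]
  rw [← hφ.eq_zero_iff]
  exact ⟨fun h => le_antisymm h (hφ.nonneg x), fun h => h.le⟩

lemma wb_add {s t : ℝ} (hs : 0 ≤ s) (ht : 0 ≤ t) : wb φ s + wb φ t = wb φ (s + t) := by
  refine Subset.antisymm ?_ fun x hx => ?_
  · rintro _ ⟨x, hx, y, hy, rfl⟩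
    exact (hφ.add_le x y).trans (add_le_add hx hy)
  · rcases hs.eq_or_lt with rfl | hs
    · exact ⟨0, hφ.zero_mem_wb le_rfl, x, by simpa using hx, by simp⟩
    have hst : 0 < s + t := by linarith
    refine ⟨(s / (s + t)) • x, ?_, (t / (s + t)) • x, ?_, ?_⟩
    · change φ _ ≤ s
      rw [hφ.smul_of_nonneg (by positivity), div_mul_eq_mul_div, div_le_iff₀ hst]
      exact mul_le_mul_of_nonneg_left hx hs.le
    · change φ _ ≤ t
      rw [hφ.smul_of_nonneg (by positivity), div_mul_eq_mul_div, div_le_iff₀ hst]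
      exact mul_le_mul_of_nonneg_left hx ht
    · simp only []
      rw [← add_smul, ← add_div, div_self hst.ne', one_smul]

lemma isOpen_wulffBall (x : Plane) (r : ℝ) : IsOpen (wulffBall φ x r) :=
  isOpen_lt (hφ.continuous.comp (continuous_id.sub continuous_const)) continuous_const

lemma mem_wulffBall_self {r : ℝ} (hr : 0 < r) (x : Plane) : x ∈ wulffBall φ x r := by
  change φ (x - x) < r
  rwa [sub_self, hφ.zero]

lemma closure_wulffBall {r : ℝ} (hr : 0 < r) (x : Plane) :
    closure (wulffBall φ x r) = {y | φ (y - x) ≤ r} := by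
  refine Subset.antisymm ?_ fun y hy => ?_
  · refine closure_minimal (fun y (hy : φ (y - x) < r) => hy.le) ?_
    exact isClosed_le (hφ.continuous.comp (continuous_id.sub continuous_const)) continuous_const
  · have h1 : Tendsto (fun t : ℝ => x + t • (y - x)) (𝓝[<] 1) (𝓝 (x + (1 : ℝ) • (y - x))) :=
      (Continuous.tendsto (by fun_prop) 1).mono_left nhdsWithin_le_nhds
    have h2 : x + (1 : ℝ) • (y - x) = y := by simp
    rw [h2] at h1
    refine mem_closure_of_tendsto h1 ?_
    filter_upwards [Ioo_mem_nhdsLT (show (0 : ℝ) < 1 by norm_num)] with t ht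
    change φ (x + t • (y - x) - x) < r
    rw [add_sub_cancel_left, hφ.smul_of_nonneg ht.1.le]
    rcases (hφ.nonneg (y - x)).eq_or_lt with h | h
    · rw [← h]; simpa using hr
    · exact lt_of_lt_of_le (by nlinarith [ht.2]) hy

lemma frontier_wulffBall {r : ℝ} (hr : 0 < r) (x : Plane) :
    frontier (wulffBall φ x r) = {y | φ (y - x) = r} := by
  rw [frontier, hφ.closure_wulffBall hr, (hφ.isOpen_wulffBall x r).interior_eq]
  ext y
  simp only [wulffBall, Set.mem_sdiff, mem_ofPred_eq, not_lt]
  exact ⟨fun h => le_antisymm h.1 h.2, fun h => ⟨h.le, h.ge⟩⟩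

end IsNorm

lemma dt_add_right (ν x y : Plane) : dt ν (x + y) = dt ν x + dt ν y := by simp [dt]; ring
lemma dt_smul_right (ν x : Plane) (c : ℝ) : dt ν (c • x) = c * dt ν x := by simp [dt]; ring
lemma dt_sub_right (ν x y : Plane) : dt ν (x - y) = dt ν x - dt ν y := by simp [dt]; ring
lemma dt_neg_right (ν x : Plane) : dt ν (-x) = -dt ν x := by simp [dt]; ring
lemma dt_add_left (ν x y : Plane) : dt (x + y) ν = dt x ν + dt y ν := by simp [dt]; ring
lemma dt_smul_left (ν x : Plane) (c : ℝ) : dt (c • x) ν = c * dt x ν := by simp [dt]; ring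
lemma dt_neg_left (ν x : Plane) : dt (-ν) x = -dt ν x := by simp [dt]; ring

lemma continuous_dt (ν : Plane) : Continuous (dt ν) := by unfold dt; fun_prop

lemma exists_dt_eq (f : Plane →L[ℝ] ℝ) : ∃ ν, ∀ x, f x = dt ν x := by
  refine ⟨![f (Pi.single 0 1), f (Pi.single 1 1)], fun x => ?_⟩
  have h2 : x = x 0 • Pi.single (0 : Fin 2) (1 : ℝ) + x 1 • Pi.single (1 : Fin 2) (1 : ℝ) := by
    ext i; fin_cases i <;> simp
  conv_lhs => rw [h2, map_add, map_smul, map_smul]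
  simp [dt, mul_comm]

/-- The support function of a set. -/
def supp (K : Set Plane) (ν : Plane) : ℝ := sSup (dt ν '' K)

lemma exists_supp {K : Set Plane} (hK : IsCompact K) (hne : K.Nonempty) (ν : Plane) :
    ∃ x ∈ K, dt ν x = supp K ν :=
  (hK.image (continuous_dt ν)).sSup_mem (hne.image _)

lemma dt_le_supp {K : Set Plane} (hK : IsCompact K) (ν : Plane) {x : Plane} (hx : x ∈ K) :
    dt ν x ≤ supp K ν :=
  le_csSup (hK.image (continuous_dt ν)).bddAbove (mem_image_of_mem _ hx)

lemma supp_le {K : Set Plane} (hne : K.Nonempty) {ν : Plane} {c : ℝ}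
    (h : ∀ x ∈ K, dt ν x ≤ c) : supp K ν ≤ c :=
  csSup_le (hne.image _) (by rintro _ ⟨x, hx, rfl⟩; exact h x hx)

lemma supp_eq {K : Set Plane} {ν : Plane} {c : ℝ} (h : ∀ x ∈ K, dt ν x ≤ c)
    {x : Plane} (hx : x ∈ K) (hxc : dt ν x = c) : supp K ν = c :=
  IsGreatest.csSup_eq ⟨⟨x, hx, hxc⟩, by rintro _ ⟨x, hx, rfl⟩; exact h x hx⟩

lemma supp_add {K L : Set Plane} (hK : IsCompact K) (hK0 : K.Nonempty) (hL : IsCompact L)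
    (hL0 : L.Nonempty) (ν : Plane) : supp (K + L) ν = supp K ν + supp L ν := by
  obtain ⟨x, hx, hx'⟩ := exists_supp hK hK0 ν
  obtain ⟨y, hy, hy'⟩ := exists_supp hL hL0 ν
  refine supp_eq ?_ (add_mem_add hx hy) (by rw [dt_add_right, hx', hy'])
  rintro _ ⟨a, ha, b, hb, rfl⟩
  simp only []
  rw [dt_add_right]
  exact add_le_add (dt_le_supp hK ν ha) (dt_le_supp hL ν hb)

lemma supp_smul_left {K : Set Plane} (hK : IsCompact K) (hK0 : K.Nonempty) {c : ℝ} (hc : 0 ≤ c)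
    (ν : Plane) : supp (c • K) ν = c * supp K ν := by
  obtain ⟨x, hx, hx'⟩ := exists_supp hK hK0 ν
  refine supp_eq ?_ (smul_mem_smul_set hx) (by rw [dt_smul_right, hx'])
  rintro _ ⟨a, ha, rfl⟩
  simp only [dt_smul_right]
  exact mul_le_mul_of_nonneg_left (dt_le_supp hK ν ha) hc

lemma supp_smul_right {K : Set Plane} (hK : IsCompact K) (hK0 : K.Nonempty) {c : ℝ} (hc : 0 ≤ c)
    (ν : Plane) : supp K (c • ν) = c * supp K ν := by
  obtain ⟨x, hx, hx'⟩ := exists_supp hK hK0 ν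
  refine supp_eq ?_ hx (by rw [dt_smul_left, hx'])
  intro a ha
  rw [dt_smul_left]
  exact mul_le_mul_of_nonneg_left (dt_le_supp hK ν ha) hc

lemma supp_add_right_le {K : Set Plane} (hK : IsCompact K) (hK0 : K.Nonempty) (ν μ : Plane) :
    supp K (ν + μ) ≤ supp K ν + supp K μ :=
  supp_le hK0 fun x hx => by
    rw [dt_add_left]
    exact add_le_add (dt_le_supp hK ν hx) (dt_le_supp hK μ hx)

lemma subset_of_supp_le {K L : Set Plane} (hK : IsCompact K) (hL : IsCompact L)
    (hL0 : L.Nonempty) (hLc : Convex ℝ L) (h : ∀ ν, supp K ν ≤ supp L ν) : K ⊆ L := by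
  intro x hx
  by_contra hxL
  obtain ⟨f, u, h1, h2⟩ := geometric_hahn_banach_closed_point hLc hL.isClosed hxL
  obtain ⟨ν, hν⟩ := exists_dt_eq f
  have h3 : supp L ν ≤ u := supp_le hL0 fun y hy => by rw [← hν]; exact (h1 y hy).le
  have h4 := dt_le_supp hK ν hx
  rw [← hν] at h4
  linarith [h ν]

lemma isCompact_seg (d : Plane) : IsCompact (seg d) :=
  isCompact_Icc.image (by fun_prop)

lemma convex_seg (d : Plane) : Convex ℝ (seg d) := by
  have : seg d = (LinearMap.toSpanSingleton ℝ Plane d) '' Icc (-(1 / 2)) (1 / 2) := by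
    ext; simp [seg]
  rw [this]
  exact (convex_Icc _ _).linear_image _

lemma zero_mem_seg (d : Plane) : (0 : Plane) ∈ seg d := ⟨0, by norm_num, by simp⟩

lemma supp_seg (d ν : Plane) : supp (seg d) ν = |dt ν d| / 2 := by
  have h : ∀ x ∈ seg d, dt ν x ≤ |dt ν d| / 2 := by
    rintro _ ⟨c, hc, rfl⟩
    simp only [dt_smul_right]
    calc c * dt ν d ≤ |c| * |dt ν d| := by rw [← abs_mul]; exact le_abs_self _
      _ ≤ 1 / 2 * |dt ν d| := by gcongr; exact abs_le.mpr hc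
      _ = _ := by ring
  rcases abs_cases (dt ν d) with ⟨h1, -⟩ | ⟨h1, -⟩
  · exact supp_eq h (x := (1 / 2 : ℝ) • d) ⟨1 / 2, by norm_num, rfl⟩
      (by rw [dt_smul_right, h1]; ring)
  · exact supp_eq h (x := (-(1 / 2) : ℝ) • d) ⟨-(1 / 2), by norm_num, rfl⟩
      (by rw [dt_smul_right, h1]; ring)

lemma isCompact_zono (l : List Plane) : IsCompact (zono l) := by
  induction l with
  | nil => exact isCompact_singleton
  | cons d l ih => exact (isCompact_seg d).add ih

lemma convex_zono (l : List Plane) : Convex ℝ (zono l) := by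
  induction l with
  | nil => exact convex_singleton 0
  | cons d l ih => exact (convex_seg d).add ih

lemma zero_mem_zono (l : List Plane) : (0 : Plane) ∈ zono l := by
  induction l with
  | nil => exact mem_singleton 0
  | cons d l ih => exact ⟨0, zero_mem_seg d, 0, ih, by simp⟩

lemma supp_zono (l : List Plane) (ν : Plane) :
    supp (zono l) ν = (l.map fun d => |dt ν d|).sum / 2 := by
  induction l with
  | nil => simp [zono, supp, dt]
  | cons d l ih =>
    rw [zono, supp_add (isCompact_seg d) ⟨_, zero_mem_seg d⟩ (isCompact_zono l)
      ⟨_, zero_mem_zono l⟩, supp_seg, ih]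
    simp; ring

lemma zono_filter (l : List Plane) : zono (l.filter (· ≠ 0)) = zono l := by
  induction l with
  | nil => rfl
  | cons d l ih =>
    rcases eq_or_ne d 0 with rfl | hd
    · have : seg (0 : Plane) = {0} := by
        ext x
        simp only [seg, smul_zero, mem_image, mem_singleton_iff]
        exact ⟨fun ⟨_, _, h⟩ => h.symm, fun h => ⟨0, by norm_num, h.symm⟩⟩
      rw [List.filter_cons_of_neg (by simp), ih, zono, this]
      simp
    · rw [List.filter_cons_of_pos (by simpa using hd), zono, zono, ih]

/-- The sum of the functions `c |t - a|` over the pairs `(c, a)` of a list. -/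
def absSum (L : List (ℝ × ℝ)) (t : ℝ) : ℝ := (L.map fun p => p.1 * |t - p.2|).sum

lemma absSum_cons (p : ℝ × ℝ) (L : List (ℝ × ℝ)) (t : ℝ) :
    absSum (p :: L) t = p.1 * |t - p.2| + absSum L t := by simp [absSum]

lemma eventually_absSum (L : List (ℝ × ℝ)) :
    ∀ᶠ t in atTop, absSum L t + absSum L (-t) = 2 * t * (L.map Prod.fst).sum := by
  induction L with
  | nil => simp [absSum]
  | cons p L ih =>
    filter_upwards [ih, eventually_ge_atTop |p.2|] with t ht hp
    obtain ⟨h1, h2⟩ := abs_le.mp hp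
    rw [absSum_cons, absSum_cons, abs_of_nonneg (show 0 ≤ t - p.2 by linarith),
      abs_of_nonpos (show -t - p.2 ≤ 0 by linarith), List.map_cons, List.sum_cons]
    linarith

/-- Interpolation from above of a convex function by a piecewise affine one. -/
lemma exists_interpolation {f : ℝ → ℝ} {S : ℝ}
    (hconv : ∀ x y z, x < y → y < z → (z - x) * f y ≤ (z - y) * f x + (y - x) * f z)
    (hlip : ∀ s t, |f s - f t| ≤ S * |s - t|) (a : ℝ) {h : ℝ} (hh : 0 < h) (n : ℕ) :
    ∃ (L : List (ℝ × ℝ)) (α s : ℝ), (∀ p ∈ L, 0 ≤ p.1) ∧ s ≤ S ∧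
      (L.map Prod.fst).sum + (S - s) / 2 = S ∧
      (∀ t, a + n * h ≤ t → f (a + n * h) + s * (t - (a + n * h)) ≤ f t) ∧
      (∀ t, f t ≤ α + absSum L t + (S - s) / 2 * |t - (a + n * h)|) ∧
      (∀ t, a ≤ t → t ≤ a + n * h →
        α + absSum L t + (S - s) / 2 * |t - (a + n * h)| ≤ f t + 2 * S * h) ∧
      (∀ t, a + n * h ≤ t → α + absSum L t + (S - s) / 2 * |t - (a + n * h)| =
        f (a + n * h) + S * (t - (a + n * h))) ∧
      (∀ t, t ≤ a → α + absSum L t + (S - s) / 2 * |t - (a + n * h)| = f a + S * (a - t)) := by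
  have hS : 0 ≤ S := by
    have := (abs_nonneg _).trans (hlip 1 0)
    simpa using this
  have lip1 : ∀ s t, s ≤ t → f t ≤ f s + S * (t - s) := fun s t hst => by
    have := (abs_le.mp (hlip t s)).2
    rw [abs_of_nonneg (by linarith : 0 ≤ t - s)] at this
    linarith
  have lip2 : ∀ s t, s ≤ t → f s ≤ f t + S * (t - s) := fun s t hst => by
    have := (abs_le.mp (hlip t s)).1
    rw [abs_of_nonneg (by linarith : 0 ≤ t - s)] at this
    linarith
  induction n with
  | zero =>
    refine ⟨[], f a, -S, by simp, by linarith, by simp, ?_, ?_, ?_, ?_, ?_⟩ <;>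
      simp only [Nat.cast_zero, zero_mul, add_zero, absSum, List.map_nil, List.sum_nil]
    · intro t ht
      have := lip2 a t ht
      linarith
    · intro t
      have := (abs_le.mp (hlip t a)).2
      linarith
    · intro t h1 h2
      have : t = a := le_antisymm h2 h1
      subst this
      simp
      positivity
    · intro t ht
      rw [abs_of_nonneg (by linarith)]; ring
    · intro t ht
      rw [abs_of_nonpos (by linarith)]; ring
  | succ n ih =>
    obtain ⟨L, α, s, hL, hsS, hsum, hsub, hle, hclose, hright, hleft⟩ := ih
    set b := a + n * h with hb
    have hb' : a + ((n + 1 : ℕ) : ℝ) * h = b + h := by push_cast; rw [hb]; ring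
    have hab : a ≤ b := by rw [hb]; have : 0 ≤ n * h := by positivity
                           linarith
    rw [hb']
    set s' := (f (b + h) - f b) / h with hs'
    have hs'h : s' * h = f (b + h) - f b := by rw [hs']; field_simp
    have h1 : s ≤ s' := by
      have := hsub (b + h) (by linarith)
      have : s * h ≤ s' * h := by rw [hs'h]; nlinarith
      exact le_of_mul_le_mul_right this hh
    have h2 : s' ≤ S := by
      have := lip1 b (b + h) (by linarith)
      have : s' * h ≤ S * h := by rw [hs'h]; nlinarith
      exact le_of_mul_le_mul_right this hh
    have hg : ∀ t, α - (S - s') / 2 * h + absSum (((s' - s) / 2, b) :: L) t +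
        (S - s') / 2 * |t - (b + h)| = α + absSum L t + (S - s) / 2 * |t - b| +
        (S - s') / 2 * (|t - (b + h)| - |t - b| - h) := fun t => by
      rw [absSum_cons]; ring
    have g1 : ∀ t, t ≤ b → |t - (b + h)| - |t - b| - h = 0 := fun t ht => by
      rw [abs_of_nonpos (by linarith), abs_of_nonpos (by linarith)]; ring
    have g2 : ∀ t, b + h ≤ t → |t - (b + h)| - |t - b| - h = -2 * h := fun t ht => by
      rw [abs_of_nonneg (by linarith), abs_of_nonneg (by linarith)]; ring
    have g3 : ∀ t, b ≤ t → t ≤ b + h → |t - (b + h)| - |t - b| - h = -2 * (t - b) :=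
      fun t ht ht' => by
        rw [abs_of_nonpos (by linarith), abs_of_nonneg (by linarith)]; ring
    refine ⟨((s' - s) / 2, b) :: L, α - (S - s') / 2 * h, s', ?_, h2, ?_, ?_, ?_, ?_, ?_, ?_⟩
    · intro p hp
      rcases List.mem_cons.mp hp with rfl | hp
      · change 0 ≤ (s' - s) / 2
        linarith
      · exact hL p hp
    · rw [List.map_cons, List.sum_cons]
      linarith
    · intro t ht
      rcases ht.eq_or_lt with rfl | ht
      · simp
      have := hconv b (b + h) t (by linarith) ht
      have e : h * (f (b + h) + s' * (t - (b + h))) ≤ h * f t := by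
        have : h * (s' * (t - (b + h))) = (f (b + h) - f b) * (t - (b + h)) := by
          rw [← hs'h]; ring
        rw [mul_add, this]
        nlinarith
      exact le_of_mul_le_mul_left e hh
    · intro t
      rw [hg]
      rcases le_total t b with ht | ht
      · rw [g1 t ht, mul_zero, add_zero]; exact hle t
      rcases le_total t (b + h) with ht' | ht'
      · rw [g3 t ht ht', hright t ht]
        rcases ht.eq_or_lt with rfl | ht
        · simp
        rcases ht'.eq_or_lt with rfl | ht'
        · linarith
        have := hconv b t (b + h) ht ht'
        have e : h * f t ≤ h * (f b + s' * (t - b)) := by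
          have : h * (s' * (t - b)) = (f (b + h) - f b) * (t - b) := by rw [← hs'h]; ring
          rw [mul_add, this]
          nlinarith
        have := le_of_mul_le_mul_left e hh
        linarith
      · rw [g2 t ht', hright t ht]
        have := lip1 (b + h) t ht'
        linarith
    · intro t h3 h4
      rw [hg]
      rcases le_total t b with ht | ht
      · rw [g1 t ht, mul_zero, add_zero]; exact hclose t h3 ht
      · rw [g3 t ht h4, hright t ht]
        have := lip2 b t ht
        have e1 : s' * (t - b) ≤ S * (t - b) := by gcongr
        have e2 : S * (t - b) ≤ S * h := by gcongr; linarith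
        linarith
    · intro t ht
      rw [hg, g2 t ht, hright t (by linarith)]
      linarith
    · intro t ht
      rw [hg, g1 t (by linarith), mul_zero, add_zero]
      exact hleft t ht

lemma exists_absSum_approx {f : ℝ → ℝ} {S : ℝ}
    (hconv : ∀ x y z, x < y → y < z → (z - x) * f y ≤ (z - y) * f x + (y - x) * f z)
    (hlip : ∀ s t, |f s - f t| ≤ S * |s - t|) (hpos : ∀ s t, 0 ≤ f t - S * t + (f s + S * s))
    {ε : ℝ} (hε : 0 < ε) :
    ∃ (L : List (ℝ × ℝ)) (α : ℝ), (∀ p ∈ L, 0 ≤ p.1) ∧ 0 ≤ α ∧ (L.map Prod.fst).sum = S ∧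
      ∀ t, f t ≤ α + absSum L t ∧ α + absSum L t ≤ f t + ε := by
  have hS : 0 ≤ S := by
    have := (abs_nonneg _).trans (hlip 1 0)
    simpa using this
  have lip1 : ∀ s t, s ≤ t → f t ≤ f s + S * (t - s) := fun s t hst => by
    have := (abs_le.mp (hlip t s)).2
    rw [abs_of_nonneg (by linarith : 0 ≤ t - s)] at this
    linarith
  have lip2 : ∀ s t, s ≤ t → f s ≤ f t + S * (t - s) := fun s t hst => by
    have := (abs_le.mp (hlip t s)).1
    rw [abs_of_nonneg (by linarith : 0 ≤ t - s)] at this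
    linarith
  have b1 : BddBelow (range fun t => f t - S * t) :=
    ⟨-(f 0 + S * 0), by rintro _ ⟨t, rfl⟩; simp only; linarith [hpos 0 t]⟩
  have b2 : BddBelow (range fun t => f t + S * t) :=
    ⟨-(f 0 - S * 0), by rintro _ ⟨t, rfl⟩; simp only; linarith [hpos t 0]⟩
  obtain ⟨T1, hT1⟩ := exists_lt_of_ciInf_lt (show (⨅ t, f t - S * t) < (⨅ t, f t - S * t) + ε by
    linarith)
  obtain ⟨T0, hT0⟩ := exists_lt_of_ciInf_lt (show (⨅ t, f t + S * t) < (⨅ t, f t + S * t) + ε by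
    linarith)
  set a := min T0 (T1 - 1) with ha
  have haT0 : a ≤ T0 := min_le_left _ _
  have haT1 : a < T1 := by have := min_le_right T0 (T1 - 1); linarith
  obtain ⟨n, hn⟩ := exists_nat_gt (2 * S * (T1 - a) / ε)
  have hn0 : (0 : ℝ) < n := lt_of_le_of_lt (by
    have : 0 ≤ T1 - a := by linarith
    positivity) hn
  have hh : 0 < (T1 - a) / n := div_pos (by linarith) hn0
  have hend : a + n * ((T1 - a) / n) = T1 := by field_simp; ring
  have hstep : 2 * S * ((T1 - a) / n) ≤ ε := by
    rw [div_lt_iff₀ hε] at hn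
    rw [mul_div_assoc', div_le_iff₀ hn0]
    linarith
  obtain ⟨L, α, s, hL, hsS, hsum, -, hle, hclose, hright, hleft⟩ :=
    exists_interpolation hconv hlip a hh n
  rw [hend] at hle hclose hright hleft
  have key : ∀ t, f t ≤ α + absSum (((S - s) / 2, T1) :: L) t ∧
      α + absSum (((S - s) / 2, T1) :: L) t ≤ f t + ε := by
    intro t
    have e : α + absSum (((S - s) / 2, T1) :: L) t =
        α + absSum L t + (S - s) / 2 * |t - T1| := by rw [absSum_cons]; ring
    rw [e]
    refine ⟨hle t, ?_⟩
    rcases le_total t a with h1 | h1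
    · rw [hleft t h1]
      have := ciInf_le b2 t
      have := lip1 a T0 haT0
      have := lip2 a T0 haT0
      linarith
    rcases le_total t T1 with h2 | h2
    · linarith [hclose t h1 h2]
    · rw [hright t h2]
      have := ciInf_le b1 t
      linarith
  have hsum' : ((((S - s) / 2, T1) :: L).map Prod.fst).sum = S := by
    rw [List.map_cons, List.sum_cons]; linarith
  refine ⟨((S - s) / 2, T1) :: L, α, ?_, ?_, hsum', key⟩
  · intro p hp
    rcases List.mem_cons.mp hp with rfl | hp
    · change 0 ≤ (S - s) / 2
      linarith
    · exact hL p hp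
  · obtain ⟨t, ht⟩ := (eventually_absSum (((S - s) / 2, T1) :: L)).exists
    rw [hsum'] at ht
    have h1 := (key t).1
    have h2 := (key (-t)).1
    have h3 := hpos (-t) t
    linarith

namespace IsNorm

variable {φ : Plane → ℝ} (hφ : IsNorm φ)
include hφ

lemma nonempty_wb {s : ℝ} (hs : 0 ≤ s) : (wb φ s).Nonempty := ⟨0, hφ.zero_mem_wb hs⟩

lemma neg_mem_wb {s : ℝ} {x : Plane} (hx : x ∈ wb φ s) : -x ∈ wb φ s := by
  change φ (-x) ≤ s
  rw [hφ.neg]; exact hx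

lemma supp_wb_neg (ν : Plane) : supp (wb φ 1) (-ν) = supp (wb φ 1) ν := by
  obtain ⟨x, hx, hx'⟩ := exists_supp (hφ.isCompact_wb 1) (hφ.nonempty_wb zero_le_one) ν
  refine supp_eq (fun y hy => ?_) (hφ.neg_mem_wb hx) (by rw [← hx']; simp [dt])
  have := dt_le_supp (hφ.isCompact_wb 1) ν (hφ.neg_mem_wb hy)
  rw [dt_neg_left, ← dt_neg_right]; exact this

lemma supp_wb_smul (c : ℝ) (ν : Plane) : supp (wb φ 1) (c • ν) = |c| * supp (wb φ 1) ν := by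
  rcases le_total 0 c with h | h
  · rw [supp_smul_right (hφ.isCompact_wb 1) (hφ.nonempty_wb zero_le_one) h, abs_of_nonneg h]
  · have : c • ν = -((-c) • ν) := by simp
    rw [this, hφ.supp_wb_neg, supp_smul_right (hφ.isCompact_wb 1) (hφ.nonempty_wb zero_le_one)
      (by linarith), abs_of_nonpos h]

lemma supp_wb_pos {ν : Plane} (hν : ν ≠ 0) : 0 < supp (wb φ 1) ν := by
  have h1 := sq_add_sq_pos hν
  have h2 := hφ.pos hν
  have h3 : (φ ν)⁻¹ • ν ∈ wb φ 1 := by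
    change φ _ ≤ 1
    rw [hφ.smul_of_nonneg (by positivity), inv_mul_cancel₀ h2.ne']
  refine lt_of_lt_of_le ?_ (dt_le_supp (hφ.isCompact_wb 1) ν h3)
  rw [dt_smul_right]
  have : dt ν ν = ν 0 ^ 2 + ν 1 ^ 2 := by simp [dt]; ring
  rw [this]
  positivity

lemma exists_zono_supp {ε : ℝ} (hε : 0 < ε) :
    ∃ l : List Plane, ∀ ν, supp (wb φ 1) ν ≤ supp (zono l) ν ∧
      supp (zono l) ν ≤ (1 + ε) * supp (wb φ 1) ν := by
  set K := wb φ 1 with hKdef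
  have hK : IsCompact K := hφ.isCompact_wb 1
  have hK0 : K.Nonempty := hφ.nonempty_wb zero_le_one
  set f : ℝ → ℝ := fun t => supp K ![1, t] with hf
  set S := supp K ![0, 1] with hS
  have hS0 : 0 < S := hφ.supp_wb_pos (by intro h; simpa using congrFun h 1)
  have hconv : ∀ x y z, x < y → y < z → (z - x) * f y ≤ (z - y) * f x + (y - x) * f z := by
    intro x y z hxy hyz
    have e : (z - x) • ![1, y] = (z - y) • ![1, x] + (y - x) • ![1, z] := by
      ext i; fin_cases i <;> simp <;> ring
    simp only [hf]
    rw [← supp_smul_right hK hK0 (by linarith), ← supp_smul_right hK hK0 (by linarith),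
      ← supp_smul_right hK hK0 (by linarith), e]
    exact supp_add_right_le hK hK0 _ _
  have hlip' : ∀ s t, f s - f t ≤ S * |s - t| := by
    intro s t
    have e : ![1, s] = ![1, t] + (s - t) • ![0, 1] := by
      ext i; fin_cases i <;> simp
    have := supp_add_right_le hK hK0 ![1, t] ((s - t) • ![0, 1])
    rw [← e, hφ.supp_wb_smul] at this
    simp only [hf]
    linarith
  have hlip : ∀ s t, |f s - f t| ≤ S * |s - t| := by
    intro s t
    rw [abs_le]
    have := hlip' t s
    rw [abs_sub_comm] at this
    exact ⟨by linarith, hlip' s t⟩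
  obtain ⟨w, hw, hw'⟩ := exists_supp hK hK0 ![0, 1]
  have hw1 : w 1 = S := by rw [hS, ← hw']; simp [dt]
  have hpos : ∀ s t, 0 ≤ f t - S * t + (f s + S * s) := by
    intro s t
    have h1 := dt_le_supp hK ![1, t] hw
    have h2 := dt_le_supp hK ![1, s] (hφ.neg_mem_wb hw)
    simp only [dt, Matrix.cons_val_zero, Matrix.cons_val_one, hw1, Pi.neg_apply] at h1 h2
    simp only [hf]
    linarith
  have hpe : 0 < φ (Pi.single 0 1) := hφ.pos (by intro h; simpa using congrFun h 0)
  set c₀ := (φ (Pi.single 0 1))⁻¹ with hc₀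
  have hc₀pos : 0 < c₀ := by positivity
  have hlow : ∀ t, c₀ ≤ f t := by
    intro t
    have h3 : c₀ • Pi.single 0 1 ∈ K := by
      change φ _ ≤ 1
      rw [hφ.smul_of_nonneg (by positivity), hc₀, inv_mul_cancel₀ hpe.ne']
    have := dt_le_supp hK ![1, t] h3
    simpa [dt] using this
  obtain ⟨L, α, hL, hα, hsum, hg⟩ := exists_absSum_approx hconv hlip hpos (mul_pos hε hc₀pos)
  set l : List Plane := ![2 * α, 0] :: L.map (fun p => ![-(2 * p.1 * p.2), 2 * p.1]) with hl
  have hl1 : ∀ t, supp (zono l) ![1, t] = α + absSum L t := by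
    intro t
    rw [supp_zono, hl, List.map_cons, List.sum_cons, List.map_map]
    have e : ((fun d => |dt ![1, t] d|) ∘ fun p : ℝ × ℝ => ![-(2 * p.1 * p.2), 2 * p.1]) =
        fun p : ℝ × ℝ => |2 * (p.1 * (t - p.2))| := by
      funext p
      simp only [Function.comp_apply, dt, Matrix.cons_val_zero, Matrix.cons_val_one]
      congr 1; ring
    have e2 : (L.map fun p : ℝ × ℝ => |2 * (p.1 * (t - p.2))|) =
        L.map fun p => 2 * (p.1 * |t - p.2|) := by
      refine List.map_congr_left fun p hp => ?_
      rw [abs_mul, abs_mul, abs_of_nonneg (hL p hp)]; simp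
    rw [e, e2, List.sum_map_mul_left, absSum]
    simp [dt, abs_of_nonneg hα]
    ring
  have hl2 : supp (zono l) ![0, 1] = S := by
    rw [supp_zono, hl, List.map_cons, List.sum_cons, List.map_map]
    have e : ((fun d => |dt ![0, 1] d|) ∘ fun p : ℝ × ℝ => ![-(2 * p.1 * p.2), 2 * p.1]) =
        fun p : ℝ × ℝ => |2 * p.1| := by
      funext p; simp [dt]
    have e2 : (L.map fun p : ℝ × ℝ => |2 * p.1|) = L.map fun p => 2 * p.1 := by
      refine List.map_congr_left fun p hp => ?_
      rw [abs_mul, abs_of_nonneg (hL p hp)]; simp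
    rw [e, e2, List.sum_map_mul_left]
    change (_ + 2 * (L.map Prod.fst).sum) / 2 = S
    rw [hsum]
    simp [dt]
  have hzs : ∀ (c : ℝ) ν, supp (zono l) (c • ν) = |c| * supp (zono l) ν := by
    intro c ν
    rw [supp_zono, supp_zono]
    simp only [dt_smul_left, abs_mul, List.sum_map_mul_left]
    ring
  refine ⟨l, fun ν => ?_⟩
  rcases eq_or_ne (ν 0) 0 with h | h
  · have e : ν = ν 1 • ![0, 1] := by ext i; fin_cases i <;> simp [h]
    rw [e, hzs, hφ.supp_wb_smul, hl2]
    refine ⟨le_rfl, ?_⟩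
    have : 0 ≤ |ν 1| * S := by positivity
    change |ν 1| * S ≤ (1 + ε) * (|ν 1| * S)
    nlinarith
  · have e : ν = ν 0 • ![1, ν 1 / ν 0] := by
      ext i; fin_cases i <;> simp; field_simp
    rw [e, hzs, hφ.supp_wb_smul, hl1]
    obtain ⟨h1, h2⟩ := hg (ν 1 / ν 0)
    refine ⟨mul_le_mul_of_nonneg_left h1 (abs_nonneg _), ?_⟩
    have h3 := hlow (ν 1 / ν 0)
    calc |ν 0| * (α + absSum L (ν 1 / ν 0)) ≤ |ν 0| * ((1 + ε) * f (ν 1 / ν 0)) := by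
          gcongr; nlinarith
      _ = _ := by simp only [hf]; ring

lemma exists_zono_approx {ε : ℝ} (hε : 0 < ε) :
    ∃ l : List Plane, (∀ d ∈ l, d ≠ 0) ∧ zono l ⊆ wb φ 1 ∧ wb φ 1 ⊆ (1 + ε) • zono l := by
  obtain ⟨l, hl⟩ := hφ.exists_zono_supp hε
  have hpos : 0 < 1 + ε := by linarith
  refine ⟨(l.map ((1 + ε)⁻¹ • ·)).filter (· ≠ 0), fun d hd => ?_, ?_, ?_⟩
  · simpa using (List.mem_filter.mp hd).2
  · rw [zono_filter, zono_map_smul]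
    have h1 : zono l ⊆ (1 + ε) • wb φ 1 := by
      refine subset_of_supp_le (isCompact_zono l) ((hφ.isCompact_wb 1).smul _)
        ((hφ.nonempty_wb zero_le_one).smul_set) ((hφ.convex_wb 1).smul _) fun ν => ?_
      rw [supp_smul_left (hφ.isCompact_wb 1) (hφ.nonempty_wb zero_le_one) hpos.le]
      exact (hl ν).2
    rintro _ ⟨x, hx, rfl⟩
    exact (mem_smul_set_iff_inv_smul_mem₀ hpos.ne' _ _).mp (h1 hx)
  · rw [zono_filter, zono_map_smul, smul_inv_smul₀ hpos.ne']
    exact subset_of_supp_le (hφ.isCompact_wb 1) (isCompact_zono l) ⟨_, zero_mem_zono l⟩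
      (convex_zono l) fun ν => (hl ν).1

end IsNorm

/-- Rotation by a right angle. -/
def perp (d : Plane) : Plane := ![-d 1, d 0]

lemma crs_eq_dt_perp (d x : Plane) : crs d x = dt (perp d) x := by
  simp [crs, dt, perp]; ring

/-- The extent of `K` transversally to `d`. -/
def width (K : Set Plane) (d : Plane) : ℝ := supp K (perp d) + supp K (-perp d)

lemma image_crs_eq_Icc {K : Set Plane} (hK : IsCompact K) (hK0 : K.Nonempty)
    (hKc : Convex ℝ K) (d : Plane) :
    crs d '' K = Icc (-supp K (-perp d)) (supp K (perp d)) := by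
  obtain ⟨x, hx, hx'⟩ := exists_supp hK hK0 (perp d)
  obtain ⟨y, hy, hy'⟩ := exists_supp hK hK0 (-perp d)
  refine Subset.antisymm ?_ ?_
  · rintro _ ⟨z, hz, rfl⟩
    have h1 := dt_le_supp hK (perp d) hz
    have h2 := dt_le_supp hK (-perp d) hz
    rw [dt_neg_left] at h2
    rw [crs_eq_dt_perp]
    exact ⟨by linarith, h1⟩
  · have hpre : IsPreconnected (crs d '' K) :=
      hKc.isPreconnected.image _ (continuous_crs d).continuousOn
    have hmx : supp K (perp d) ∈ crs d '' K := ⟨x, hx, by rw [crs_eq_dt_perp, hx']⟩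
    have hmy : -supp K (-perp d) ∈ crs d '' K :=
      ⟨y, hy, by rw [crs_eq_dt_perp, ← hy', dt_neg_left, neg_neg]⟩
    exact hpre.Icc_subset hmy hmx

lemma width_nonneg {K : Set Plane} (hK : IsCompact K) (hK0 : K.Nonempty) (d : Plane) :
    0 ≤ width K d := by
  obtain ⟨x, hx⟩ := hK0
  have h1 := dt_le_supp hK (perp d) hx
  have h2 := dt_le_supp hK (-perp d) hx
  rw [dt_neg_left] at h2
  unfold width; linarith

lemma volume_image_crs {K : Set Plane} (hK : IsCompact K) (hK0 : K.Nonempty)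
    (hKc : Convex ℝ K) (d : Plane) : volume (crs d '' K) = ENNReal.ofReal (width K d) := by
  rw [image_crs_eq_Icc hK hK0 hKc, Real.volume_Icc, width, sub_neg_eq_add]

lemma width_add_seg {K : Set Plane} (hK : IsCompact K) (hK0 : K.Nonempty) (d e : Plane) :
    width (K + seg e) d = width K d + |crs d e| := by
  unfold width
  rw [supp_add hK hK0 (isCompact_seg e) ⟨_, zero_mem_seg e⟩,
    supp_add hK hK0 (isCompact_seg e) ⟨_, zero_mem_seg e⟩, supp_seg, supp_seg, dt_neg_left,
    abs_neg, ← crs_eq_dt_perp]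
  ring

lemma isCompact_slice {d : Plane} (hd : d ≠ 0) {K : Set Plane} (hK : IsCompact K) (t : ℝ) :
    IsCompact (slice d K t) := by
  have h1 : IsCompact ((fun x => crs x (conj d)) '' K) := hK.image (by unfold crs; fun_prop)
  refine h1.of_isClosed_subset ?_ fun s hs => ⟨_, hs, ?_⟩
  · exact hK.isClosed.preimage ((continuous_frame d).comp (by fun_prop))
  · have := crs_conj hd
    change crs (frame d (s, t)) (conj d) = s
    rw [crs_comm (conj d), frame, crs_add_right, crs_smul_right, crs_smul_right, crs_self,
      crs_comm d (conj d), this]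
    ring

lemma convex_slice (d : Plane) {K : Set Plane} (hK : Convex ℝ K) (t : ℝ) :
    Convex ℝ (slice d K t) := by
  intro x hx y hy a b ha hb hab
  have := hK hx hy ha hb hab
  change frame d (a • x + b • y, t) ∈ K
  convert this using 1
  simp only [frame, smul_eq_mul]
  have : t = a * t + b * t := by rw [← add_mul, hab, one_mul]
  conv_lhs => rw [this]
  module

lemma slice_add_seg (d : Plane) (K : Set Plane) (t : ℝ) :
    slice d (K + seg d) t = slice d K t + Icc (-(1 / 2)) (1 / 2) := by
  ext s
  constructor
  · rintro ⟨x, hx, _, ⟨c, hc, rfl⟩, hxs⟩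
    refine ⟨s - c, ?_, c, hc, by ring⟩
    change frame d (s - c, t) ∈ K
    have : frame d (s - c, t) = x := by
      have : frame d (s, t) = x + c • d := hxs.symm
      rw [eq_sub_of_add_eq this.symm]
      simp [frame, sub_smul]; abel
    rwa [this]
  · rintro ⟨a, ha, c, hc, rfl⟩
    exact ⟨_, ha, _, ⟨c, hc, rfl⟩, frame_add d a t c⟩

lemma volume_add_unit {S : Set ℝ} (hS : IsCompact S) (hSc : Convex ℝ S) (hS0 : S.Nonempty) :
    volume (S + Icc (-(1 / 2)) (1 / 2)) = volume S + 1 := by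
  have hconn : IsConnected S := ⟨hS0, hSc.isPreconnected⟩
  rw [eq_Icc_of_connected_compact hconn hS]
  have h : sInf S ≤ sSup S := csInf_le_csSup hS0 hS.bddBelow hS.bddAbove
  have e : Icc (sInf S) (sSup S) + Icc (-(1 / 2)) (1 / 2) =
      Icc (sInf S - 1 / 2) (sSup S + 1 / 2) := by
    ext x
    constructor
    · rintro ⟨a, ha, b, hb, rfl⟩
      exact ⟨by linarith [ha.1, hb.1], by linarith [ha.2, hb.2]⟩
    · intro hx
      refine ⟨max (sInf S) (min x (sSup S)), ⟨le_max_left _ _, max_le h (min_le_right _ _)⟩,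
        x - max (sInf S) (min x (sSup S)), ?_, by ring⟩
      rcases le_total x (sSup S) with h1 | h1
      · rw [min_eq_left h1]
        rcases le_total x (sInf S) with h2 | h2
        · rw [max_eq_left h2]; exact ⟨by linarith [hx.1], by linarith⟩
        · rw [max_eq_right h2]; norm_num
      · rw [min_eq_right h1, max_eq_right h]
        exact ⟨by linarith, by linarith [hx.2]⟩
  rw [e, Real.volume_Icc, Real.volume_Icc, ← ENNReal.ofReal_one,
    ← ENNReal.ofReal_add (by linarith) zero_le_one]
  congr 1; ring

lemma volume_add_seg {d : Plane} (hd : d ≠ 0) {K : Set Plane} (hK : IsCompact K)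
    (hK0 : K.Nonempty) (hKc : Convex ℝ K) :
    volume (K + seg d) = volume K + ENNReal.ofReal (width K d) := by
  rw [volume_eq_lintegral_slice hd (hK.add (isCompact_seg d)).measurableSet,
    volume_eq_lintegral_slice hd hK.measurableSet, ← volume_image_crs hK hK0 hKc,
    ← lintegral_indicator_one (hK.image (continuous_crs d)).measurableSet,
    ← lintegral_add_left (measurable_volume_slice d hK.measurableSet)]
  refine lintegral_congr fun t => ?_
  rw [slice_add_seg]
  by_cases ht : t ∈ crs d '' K
  · have hne : (slice d K t).Nonempty := by
      obtain ⟨x, hx, rfl⟩ := ht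
      refine ⟨crs x (conj d), ?_⟩
      change frame d _ ∈ K
      rwa [frame_inv hd]
    rw [volume_add_unit (isCompact_slice hd hK t) (convex_slice d hKc t) hne,
      indicator_of_mem ht, Pi.one_apply]
  · have : slice d K t = ∅ := by
      refine eq_empty_of_forall_notMem fun s hs => ht ⟨_, hs, crs_frame hd (s, t)⟩
    simp [this, ht]

/-- Sum of the widths of `K` transversally to the vectors of a list. -/
def widthSum (l : List Plane) (K : Set Plane) : ℝ := (l.map (width K)).sum

lemma widthSum_nonneg (l : List Plane) {K : Set Plane} (hK : IsCompact K) (hK0 : K.Nonempty) :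
    0 ≤ widthSum l K := by
  refine List.sum_nonneg fun x hx => ?_
  obtain ⟨d, -, rfl⟩ := List.mem_map.mp hx
  exact width_nonneg hK hK0 d

lemma volume_add_zono {l : List Plane} (hl : ∀ d ∈ l, d ≠ 0) {K : Set Plane} (hK : IsCompact K)
    (hK0 : K.Nonempty) (hKc : Convex ℝ K) :
    volume.real (K + zono l) = volume.real K + widthSum l K + pairSum l := by
  induction l generalizing K with
  | nil => simp [zono, widthSum, pairSum]
  | cons d l ih =>
    have hd := hl d (by simp)
    rw [zono, ← add_assoc, ih (fun e he => hl e (by simp [he])) (hK.add (isCompact_seg d))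
      (hK0.add ⟨_, zero_mem_seg d⟩) (hKc.add (convex_seg d)), pairSum_cons]
    have h1 : volume.real (K + seg d) = volume.real K + width K d := by
      rw [measureReal_def, volume_add_seg hd hK hK0 hKc, ENNReal.toReal_add
        hK.measure_lt_top.ne ENNReal.ofReal_ne_top,
        ENNReal.toReal_ofReal (width_nonneg hK hK0 d), measureReal_def]
    have h2 : widthSum l (K + seg d) = widthSum l K + (l.map fun e => |crs d e|).sum := by
      unfold widthSum
      rw [← List.sum_map_add]
      congr 1
      refine List.map_congr_left fun e _ => ?_
      rw [width_add_seg hK hK0, abs_crs_comm]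
    rw [h1, h2]
    simp only [widthSum, List.map_cons, List.sum_cons]
    ring

lemma volume_zono {l : List Plane} (hl : ∀ d ∈ l, d ≠ 0) :
    volume.real (zono l) = pairSum l := by
  have h := volume_add_zono hl (isCompact_singleton (x := (0 : Plane))) (singleton_nonempty 0)
    (convex_singleton 0)
  have hw : widthSum l {0} = 0 := by
    unfold widthSum
    have : width ({0} : Set Plane) = fun _ => 0 := by
      funext d; simp [width, supp, dt]
    simp [this]
  have h0 : ({0} : Set Plane) + zono l = zono l := by
    rw [singleton_zero, zero_add]
  rw [h0, hw] at h
  simpa [measureReal_def] using h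

lemma projSum_le_widthSum {l : List Plane} (hl : ∀ d ∈ l, d ≠ 0) {K : Set Plane}
    (hK : IsCompact K) (hK0 : K.Nonempty) (hKc : Convex ℝ K) :
    (projSum l K).toReal ≤ widthSum l K := by
  refine ENNReal.toReal_le_of_le_ofReal (widthSum_nonneg l hK hK0) ?_
  induction l with
  | nil => simp [projSum]
  | cons d l ih =>
    have hd := hl d (by simp)
    have e : widthSum (d :: l) K = width K d + widthSum l K := by simp [widthSum]
    rw [projSum_cons, e, ENNReal.ofReal_add (width_nonneg hK hK0 d) (widthSum_nonneg l hK hK0)]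
    refine add_le_add ?_ (ih fun e he => hl e (by simp [he]))
    rw [← volume_image_crs hK hK0 hKc]
    exact measure_mono (proj_subset_image hd K)

/-- Mixed area functional: `|K + W| = |K| + mixed φ K + |W|`. -/
def mixed (φ : Plane → ℝ) (K : Set Plane) : ℝ :=
  volume.real (K + wb φ 1) - volume.real K - volume.real (wb φ 1)

lemma volume_real_smul {c : ℝ} (hc : 0 ≤ c) (A : Set Plane) :
    volume.real (c • A) = c ^ 2 * volume.real A := by
  rw [measureReal_def, Measure.addHaar_smul, ENNReal.toReal_mul, measureReal_def,
    ENNReal.toReal_ofReal (abs_nonneg _), abs_of_nonneg (by positivity)]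
  simp

lemma width_translate {K : Set Plane} (hK : IsCompact K) (hK0 : K.Nonempty) (x d : Plane) :
    width (K + {x}) d = width K d := by
  have h : ∀ ν, supp {x} ν = dt ν x := fun ν => by simp [supp]
  unfold width
  rw [supp_add hK hK0 isCompact_singleton (singleton_nonempty x),
    supp_add hK hK0 isCompact_singleton (singleton_nonempty x), h, h, dt_neg_left]
  ring

lemma width_smul {K : Set Plane} (hK : IsCompact K) (hK0 : K.Nonempty) {c : ℝ} (hc : 0 ≤ c)
    (d : Plane) : width (c • K) d = c * width K d := by
  unfold width
  rw [supp_smul_left hK hK0 hc, supp_smul_left hK hK0 hc, mul_add]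

lemma width_smul_right {K : Set Plane} (hK : IsCompact K) (hK0 : K.Nonempty) {c : ℝ} (hc : 0 ≤ c)
    (d : Plane) : width K (c • d) = c * width K d := by
  have h : perp (c • d) = c • perp d := by
    ext i; fin_cases i <;> simp [perp]
  unfold width
  rw [h, ← smul_neg, supp_smul_right hK hK0 hc, supp_smul_right hK hK0 hc, mul_add]

lemma volume_add_smul_zono {l : List Plane} (hl : ∀ d ∈ l, d ≠ 0) {K : Set Plane}
    (hK : IsCompact K) (hK0 : K.Nonempty) (hKc : Convex ℝ K) {s : ℝ} (hs : 0 ≤ s) :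
    volume.real (K + s • zono l) = volume.real K + s * widthSum l K + s ^ 2 * pairSum l := by
  rcases hs.eq_or_lt with rfl | hs
  · rw [zero_smul_set ⟨_, zero_mem_zono l⟩, add_zero]; ring
  have h1 : ∀ d ∈ l.map (s • ·), d ≠ 0 := by
    intro d hd
    obtain ⟨e, he, rfl⟩ := List.mem_map.mp hd
    exact smul_ne_zero hs.ne' (hl e he)
  have h2 : widthSum (l.map (s • ·)) K = s * widthSum l K := by
    unfold widthSum
    rw [List.map_map, ← List.sum_map_mul_left]
    congr 1
    exact List.map_congr_left fun d _ => width_smul_right hK hK0 hs.le d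
  rw [← zono_map_smul, volume_add_zono h1 hK hK0 hKc, h2, pairSum_map_smul hs.le]

namespace IsNorm

variable {φ : Plane → ℝ} (hφ : IsNorm φ)
include hφ

lemma volume_wb_pos : 0 < volume.real (wb φ 1) := by
  have h : wulffBall φ 0 1 ⊆ wb φ 1 := fun x hx => by
    change φ (x - 0) < 1 at hx
    rw [sub_zero] at hx
    exact hx.le
  refine ENNReal.toReal_pos ?_ (hφ.isCompact_wb 1).measure_lt_top.ne
  exact (((hφ.isOpen_wulffBall 0 1).measure_pos volume
    ⟨0, hφ.mem_wulffBall_self one_pos 0⟩).trans_le (measure_mono h)).ne'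

lemma volume_wb {s : ℝ} (hs : 0 ≤ s) : volume.real (wb φ s) = s ^ 2 * volume.real (wb φ 1) := by
  rcases hs.eq_or_lt with rfl | hs
  · rw [hφ.wb_zero]; simp [measureReal_def]
  · rw [hφ.wb_smul hs, volume_real_smul hs.le]

/-- A sequence of inner zonotope approximations of the unit ball. -/
lemma exists_zono_seq : ∃ l : ℕ → List Plane, (∀ n, ∀ d ∈ l n, d ≠ 0) ∧
    (∀ n, zono (l n) ⊆ wb φ 1) ∧ (∀ n : ℕ, wb φ 1 ⊆ (1 + 1 / ((n : ℝ) + 1)) • zono (l n)) := by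
  choose l h1 h2 h3 using fun n : ℕ => hφ.exists_zono_approx (ε := 1 / ((n : ℝ) + 1)) (by positivity)
  exact ⟨l, h1, h2, h3⟩

omit hφ in
lemma tendsto_one_add : Tendsto (fun n : ℕ => 1 + 1 / ((n : ℝ) + 1)) atTop (𝓝 1) := by
  simpa using tendsto_one_div_add_atTop_nhds_zero_nat.const_add (1 : ℝ)

lemma pairSum_le {l : List Plane} (h1 : ∀ d ∈ l, d ≠ 0) (h2 : zono l ⊆ wb φ 1) :
    pairSum l ≤ volume.real (wb φ 1) := by
  rw [← volume_zono h1]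
  exact measureReal_mono h2 (hφ.isCompact_wb 1).measure_lt_top.ne

lemma tendsto_pairSum {l : ℕ → List Plane} (h1 : ∀ n, ∀ d ∈ l n, d ≠ 0)
    (h2 : ∀ n, zono (l n) ⊆ wb φ 1)
    (h3 : ∀ n : ℕ, wb φ 1 ⊆ (1 + 1 / ((n : ℝ) + 1)) • zono (l n)) :
    Tendsto (fun n => pairSum (l n)) atTop (𝓝 (volume.real (wb φ 1))) := by
  have hlow : ∀ n : ℕ, ((1 + 1 / ((n : ℝ) + 1)) ^ 2)⁻¹ * volume.real (wb φ 1) ≤ pairSum (l n) := by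
    intro n
    have hc : 0 < 1 + 1 / ((n : ℝ) + 1) := by positivity
    rw [inv_mul_le_iff₀ (by positivity), ← volume_zono (h1 n)]
    refine (measureReal_mono (h3 n)
      ((isCompact_zono (l n)).smul (1 + 1 / ((n : ℝ) + 1))).measure_lt_top.ne).trans ?_
    rw [volume_real_smul hc.le]
  refine tendsto_of_tendsto_of_tendsto_of_le_of_le ?_ tendsto_const_nhds hlow
    fun n => hφ.pairSum_le (h1 n) (h2 n)
  simpa using ((tendsto_one_add.pow 2).inv₀ (by norm_num)).mul_const (volume.real (wb φ 1))

lemma tendsto_widthSum {l : ℕ → List Plane} (h1 : ∀ n, ∀ d ∈ l n, d ≠ 0)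
    (h2 : ∀ n, zono (l n) ⊆ wb φ 1)
    (h3 : ∀ n : ℕ, wb φ 1 ⊆ (1 + 1 / ((n : ℝ) + 1)) • zono (l n))
    {K : Set Plane} (hK : IsCompact K) (hK0 : K.Nonempty) (hKc : Convex ℝ K) :
    Tendsto (fun n => widthSum (l n) K) atTop (𝓝 (mixed φ K)) := by
  have hp := hφ.tendsto_pairSum h1 h2 h3
  have hup : ∀ n, widthSum (l n) K ≤ mixed φ K + volume.real (wb φ 1) - pairSum (l n) := by
    intro n
    have h := volume_add_zono (h1 n) hK hK0 hKc
    have h' : volume.real (K + zono (l n)) ≤ volume.real (K + wb φ 1) :=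
      measureReal_mono (add_subset_add_left (h2 n)) (hK.add (hφ.isCompact_wb 1)).measure_lt_top.ne
    unfold mixed
    linarith
  have hlow : ∀ n : ℕ, (1 + 1 / ((n : ℝ) + 1))⁻¹ * (mixed φ K + volume.real (wb φ 1) -
      (1 + 1 / ((n : ℝ) + 1)) ^ 2 * pairSum (l n)) ≤ widthSum (l n) K := by
    intro n
    have hc : 0 < 1 + 1 / ((n : ℝ) + 1) := by positivity
    rw [inv_mul_le_iff₀ hc]
    have h := volume_add_smul_zono (h1 n) hK hK0 hKc hc.le
    have h' : volume.real (K + wb φ 1) ≤ volume.real (K + (1 + 1 / ((n : ℝ) + 1)) • zono (l n)) :=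
      measureReal_mono (add_subset_add_left (h3 n))
        (hK.add ((isCompact_zono (l n)).smul (1 + 1 / ((n : ℝ) + 1)))).measure_lt_top.ne
    unfold mixed
    linarith
  refine tendsto_of_tendsto_of_tendsto_of_le_of_le ?_ ?_ hlow hup
  · simpa using (tendsto_one_add.inv₀ (by norm_num)).mul
      (((tendsto_one_add.pow 2).mul hp).const_sub (mixed φ K + volume.real (wb φ 1)))
  · simpa using hp.const_sub (mixed φ K + volume.real (wb φ 1))

/-- Steiner's formula for the sum of a planar convex body and a multiple of the unit ball. -/
lemma volume_add_wb {K : Set Plane} (hK : IsCompact K) (hK0 : K.Nonempty) (hKc : Convex ℝ K)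
    {s : ℝ} (hs : 0 ≤ s) :
    volume.real (K + wb φ s) =
      volume.real K + s * mixed φ K + s ^ 2 * volume.real (wb φ 1) := by
  rcases hs.eq_or_lt with rfl | hs
  · rw [hφ.wb_zero, singleton_zero, add_zero]; ring
  obtain ⟨l, h1, h2, h3⟩ := hφ.exists_zono_seq
  have hp := hφ.tendsto_pairSum h1 h2 h3
  have hw := hφ.tendsto_widthSum h1 h2 h3 hK hK0 hKc
  have hcpt := hφ.isCompact_wb s
  rw [hφ.wb_smul hs] at hcpt ⊢
  refine le_antisymm ?_ ?_
  · have key : ∀ n : ℕ, volume.real (K + s • wb φ 1) ≤ volume.real K +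
        (s * (1 + 1 / ((n : ℝ) + 1))) * widthSum (l n) K +
        (s * (1 + 1 / ((n : ℝ) + 1))) ^ 2 * pairSum (l n) := by
      intro n
      rw [← volume_add_smul_zono (h1 n) hK hK0 hKc (by positivity)]
      refine measureReal_mono (add_subset_add_left ?_)
        (hK.add ((isCompact_zono (l n)).smul _)).measure_lt_top.ne
      rw [mul_smul]
      exact smul_set_mono (h3 n)
    refine ge_of_tendsto' (x := atTop) ?_ key
    have h4 := tendsto_one_add.const_mul s
    rw [mul_one] at h4
    exact ((h4.mul hw).const_add _).add ((h4.pow 2).mul hp)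
  · have key : ∀ n : ℕ, volume.real K + s * widthSum (l n) K + s ^ 2 * pairSum (l n) ≤
        volume.real (K + s • wb φ 1) := by
      intro n
      rw [← volume_add_smul_zono (h1 n) hK hK0 hKc hs.le]
      exact measureReal_mono (add_subset_add_left (smul_set_mono (h2 n)))
        (hK.add hcpt).measure_lt_top.ne
    exact le_of_tendsto' (((hw.const_mul s).const_add _).add (hp.const_mul _)) key

lemma mixed_nonneg {K : Set Plane} (hK : IsCompact K) (hK0 : K.Nonempty) (hKc : Convex ℝ K) :
    0 ≤ mixed φ K := by
  obtain ⟨l, h1, h2, h3⟩ := hφ.exists_zono_seq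
  exact ge_of_tendsto' (hφ.tendsto_widthSum h1 h2 h3 hK hK0 hKc)
    fun n => widthSum_nonneg (l n) hK hK0

lemma mixed_smul_translate {K : Set Plane} (hK : IsCompact K) (hK0 : K.Nonempty)
    (hKc : Convex ℝ K) {c : ℝ} (hc : 0 ≤ c) (x : Plane) :
    mixed φ (c • K + {x}) = c * mixed φ K := by
  obtain ⟨l, h1, h2, h3⟩ := hφ.exists_zono_seq
  refine tendsto_nhds_unique (hφ.tendsto_widthSum h1 h2 h3
    ((hK.smul c).add isCompact_singleton) (hK0.smul_set.add (singleton_nonempty x))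
    ((hKc.smul c).add (convex_singleton x))) ?_
  have h : ∀ n, widthSum (l n) (c • K + {x}) = c * widthSum (l n) K := by
    intro n
    unfold widthSum
    rw [← List.sum_map_mul_left]
    congr 1
    refine List.map_congr_left fun d _ => ?_
    rw [width_translate (hK.smul c) hK0.smul_set, width_smul hK hK0 hc]
  simp only [h]
  exact (hφ.tendsto_widthSum h1 h2 h3 hK hK0 hKc).const_mul c

end IsNorm

/-- The total projections of `F` along inner zonotope approximations of the unit ball are bounded
by `B`, up to the area defect of the approximation. -/
def ProjBound (φ : Plane → ℝ) (F : Set Plane) (B : ℝ) : Prop :=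
  ∀ l : List Plane, (∀ d ∈ l, d ≠ 0) → zono l ⊆ wb φ 1 →
    (projSum l F).toReal ≤ B + (volume.real (wb φ 1) - pairSum l)

lemma isClosed_erode {H : Set Plane} (hH : IsClosed H) (Z : Set Plane) : IsClosed (erode H Z) := by
  have : erode H Z = ⋂ z ∈ Z, (fun x => x + z) ⁻¹' H := by
    ext x; simp [erode]
  rw [this]
  exact isClosed_biInter fun z _ => hH.preimage (by fun_prop)

namespace IsNorm

variable {φ : Plane → ℝ} (hφ : IsNorm φ)
include hφ

lemma projBound_anisoPerimeter {F : Set Plane} (hF : MeasurableSet F)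
    (hFb : Bornology.IsBounded F) (hP : anisoPerimeter φ F ≠ ∞) :
    ProjBound φ F (anisoPerimeter φ F).toReal := fun l h1 h2 => by
  have h := projSum_le_anisoPerimeter h1 (fun z hz => h2 hz) hF hFb
  have := hφ.pairSum_le h1 h2
  linarith [ENNReal.toReal_mono hP h]

lemma projBound_mixed {K : Set Plane} (hK : IsCompact K) (hK0 : K.Nonempty) (hKc : Convex ℝ K) :
    ProjBound φ K (mixed φ K) := fun l h1 h2 => by
  have h := projSum_le_widthSum h1 hK hK0 hKc
  have h' := volume_add_zono h1 hK hK0 hKc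
  have h'' : volume.real (K + zono l) ≤ volume.real (K + wb φ 1) :=
    measureReal_mono (add_subset_add_left h2) (hK.add (hφ.isCompact_wb 1)).measure_lt_top.ne
  unfold mixed
  linarith

lemma erode_wb_subset {H : Set Plane} {r : ℝ} (hr : 0 ≤ r) : erode H (wb φ r) ⊆ H := fun x hx => by
  simpa using hx 0 (hφ.zero_mem_wb hr)

omit hφ in
lemma erode_wb_anti (H : Set Plane) {s r : ℝ} (h : s ≤ r) : erode H (wb φ r) ⊆ erode H (wb φ s) :=
  fun _ hx z hz => hx z (le_trans hz h)

omit hφ in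
lemma one_add_inv_mul_lt {r : ℝ} (hr : 0 < r) (n : ℕ) :
    0 < (1 + 1 / ((n : ℝ) + 1))⁻¹ * r ∧ (1 + 1 / ((n : ℝ) + 1))⁻¹ * r < r := by
  have : 0 < 1 / ((n : ℝ) + 1) := by positivity
  exact ⟨by positivity, mul_lt_of_lt_one_left hr (inv_lt_one_of_one_lt₀ (by linarith))⟩

omit hφ in
lemma monotone_one_add_inv_mul {r : ℝ} (hr : 0 < r) :
    Monotone fun n : ℕ => (1 + 1 / ((n : ℝ) + 1))⁻¹ * r := fun n k hnk => by
  refine mul_le_mul_of_nonneg_right (inv_anti₀ (by positivity) ?_) hr.le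
  gcongr

lemma iInter_erode {H : Set Plane} (hH : IsClosed H) {r : ℝ} (hr : 0 < r) :
    ⋂ n : ℕ, erode H (wb φ ((1 + 1 / ((n : ℝ) + 1))⁻¹ * r)) = erode H (wb φ r) := by
  refine Subset.antisymm (fun x hx z hz => ?_)
    (subset_iInter fun n => erode_wb_anti H (one_add_inv_mul_lt hr n).2.le)
  rw [mem_iInter] at hx
  have hlim : Tendsto (fun n : ℕ => x + (1 + 1 / ((n : ℝ) + 1))⁻¹ • z) atTop (𝓝 (x + z)) := by
    have := ((tendsto_one_add.inv₀ (by norm_num)).smul_const z).const_add x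
    simpa using this
  refine hH.mem_of_tendsto hlim (Eventually.of_forall fun n => hx n _ ?_)
  have hpos : 0 ≤ (1 + 1 / ((n : ℝ) + 1))⁻¹ := by positivity
  change φ _ ≤ _
  rw [hφ.smul_of_nonneg hpos]
  exact mul_le_mul_of_nonneg_left hz hpos

lemma tendsto_volume_erode {H : Set Plane} (hH : IsCompact H) {r : ℝ} (hr : 0 < r) :
    Tendsto (fun n : ℕ => volume.real (erode H (wb φ ((1 + 1 / ((n : ℝ) + 1))⁻¹ * r)))) atTop
      (𝓝 (volume.real (erode H (wb φ r)))) := by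
  have hanti : Antitone fun n : ℕ => erode H (wb φ ((1 + 1 / ((n : ℝ) + 1))⁻¹ * r)) :=
    fun n k hnk => erode_wb_anti H (monotone_one_add_inv_mul hr hnk)
  have htop : ∀ s : ℝ, 0 ≤ s → volume (erode H (wb φ s)) ≠ ∞ := fun s hs =>
    ((measure_mono (hφ.erode_wb_subset hs)).trans_lt hH.measure_lt_top).ne
  have := tendsto_measure_iInter_atTop (μ := volume)
    (fun n => (isClosed_erode hH.isClosed _).nullMeasurableSet) hanti
    ⟨0, htop _ (one_add_inv_mul_lt hr 0).1.le⟩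
  rw [hφ.iInter_erode hH.isClosed hr] at this
  exact (ENNReal.tendsto_toReal (htop r hr.le)).comp this

/-- Either the erosion of `H` by the ball of radius `r` has the expected area, or the projection
bound is large at some smaller radius. -/
theorem erosion_dichotomy {A H : Set Plane} (hA : MeasurableSet A) (hA0 : volume A ≠ 0)
    (hAH : A ⊆ H) (hH : IsCompact H) (hHc : Convex ℝ H) {B : ℝ} (hB : ProjBound φ A B)
    {r : ℝ} (hr : 0 < r) :
    volume.real A + r ^ 2 * volume.real (wb φ 1) ≤ volume.real (erode H (wb φ r)) + r * B ∨
      ∃ s ∈ Ioc 0 r, volume.real A + s ^ 2 * volume.real (wb φ 1) ≤ s * B := by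
  obtain ⟨l, h1, h2, h3⟩ := hφ.exists_zono_seq
  have hp := hφ.tendsto_pairSum h1 h2 h3
  have hAb : Bornology.IsBounded A := hH.isBounded.subset hAH
  have hApos : 0 < volume.real A :=
    ENNReal.toReal_pos hA0 ((measure_mono hAH).trans_lt hH.measure_lt_top).ne
  have hBn : Tendsto (fun n => B + (volume.real (wb φ 1) - pairSum (l n))) atTop (𝓝 B) := by
    simpa using (hp.const_sub (volume.real (wb φ 1))).const_add B
  by_cases hfreq : ∃ᶠ n in atTop, ∃ G, G ⊆ A ∧ (∀ x ∈ G, ∀ z ∈ zono (l n), x + r • z ∈ H) ∧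
      volume.real A + r ^ 2 * pairSum (l n) ≤ volume.real G + r * (projSum (l n) A).toReal
  · left
    by_contra! hlt
    have e1 : Tendsto (fun n : ℕ => volume.real (erode H (wb φ ((1 + 1 / ((n : ℝ) + 1))⁻¹ * r))) +
        r * (B + (volume.real (wb φ 1) - pairSum (l n)))) atTop
        (𝓝 (volume.real (erode H (wb φ r)) + r * B)) :=
      (hφ.tendsto_volume_erode hH hr).add (hBn.const_mul r)
    have e2 := (hp.const_mul (r ^ 2)).const_add (volume.real A)
    obtain ⟨n, ⟨G, hGA, hG, hGv⟩, hn⟩ := (hfreq.and_eventually (e1.eventually_lt e2 hlt)).exists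
    have hpos : 0 < 1 + 1 / ((n : ℝ) + 1) := by positivity
    have hGs : G ⊆ erode H (wb φ ((1 + 1 / ((n : ℝ) + 1))⁻¹ * r)) := by
      intro x hx z hz
      have hz' : (r⁻¹ * (1 + 1 / ((n : ℝ) + 1))) • z ∈ wb φ 1 := by
        change φ _ ≤ 1
        rw [hφ.smul_of_nonneg (by positivity)]
        calc r⁻¹ * (1 + 1 / ((n : ℝ) + 1)) * φ z
            ≤ r⁻¹ * (1 + 1 / ((n : ℝ) + 1)) * ((1 + 1 / ((n : ℝ) + 1))⁻¹ * r) := by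
              gcongr; exact hz
          _ = 1 := by field_simp
      obtain ⟨w, hw, hwz⟩ := h3 n hz'
      have : z = r • w := by
        simp only at hwz
        rw [mul_comm, mul_smul] at hwz
        have h := smul_right_injective Plane hpos.ne' hwz
        rw [h, smul_smul, mul_inv_cancel₀ hr.ne', one_smul]
      rw [this]
      exact hG x hx w hw
    have hGle := measureReal_mono (μ := volume) hGs
      ((measure_mono (hφ.erode_wb_subset (by positivity))).trans_lt hH.measure_lt_top).ne
    have hBl := mul_le_mul_of_nonneg_left (hB (l n) (h1 n) (h2 n)) hr.le
    linarith
  · right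
    rw [not_frequently] at hfreq
    have hs : ∀ᶠ n : ℕ in atTop, ∃ s ∈ Icc 0 r, volume.real A + s ^ 2 * pairSum (l n) ≤
        s * (projSum (l n) A).toReal + r / ((n + 1 : ℕ) : ℝ) * (projSum (l n) A).toReal := by
      filter_upwards [hfreq] with n hn
      exact (erosion_alternative (h1 n) hA hAb hA0 hAH hHc hr n.succ_pos).resolve_left hn
    obtain ⟨n₀, hn₀⟩ := eventually_atTop.mp hs
    choose! s hs1 hs2 using hn₀
    obtain ⟨s', hs', k, hk, hlim⟩ := isCompact_Icc.tendsto_subseq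
      (x := fun n : ℕ => s (n + n₀)) fun n => hs1 _ (Nat.le_add_left _ _)
    have hkt : Tendsto (fun n => k n + n₀) atTop atTop :=
      tendsto_atTop_mono (fun n => Nat.le_add_right _ _) hk.tendsto_atTop
    have hr0 : Tendsto (fun n : ℕ => r / ((n + 1 : ℕ) : ℝ)) atTop (𝓝 0) := by
      have := (tendsto_one_div_add_atTop_nhds_zero_nat (𝕜 := ℝ)).const_mul r
      simpa [div_eq_mul_inv] using this
    have key : volume.real A + s' ^ 2 * volume.real (wb φ 1) ≤ s' * B + 0 * B := by
      refine le_of_tendsto_of_tendsto' (((hlim.pow 2).mul (hp.comp hkt)).const_add (volume.real A))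
        ((hlim.mul (hBn.comp hkt)).add ((hr0.comp hkt).mul (hBn.comp hkt))) fun n => ?_
      have hle := Nat.le_add_left n₀ (k n)
      refine (hs2 _ hle).trans ?_
      have hb := hB (l (k n + n₀)) (h1 _) (h2 _)
      exact add_le_add (mul_le_mul_of_nonneg_left hb (hs1 _ hle).1)
        (mul_le_mul_of_nonneg_left hb (by positivity))
    rw [zero_mul, add_zero] at key
    refine ⟨s', ⟨lt_of_le_of_ne hs'.1 ?_, hs'.2⟩, key⟩
    rintro rfl
    linarith

lemma volume_erode_eq_zero {H : Set Plane} (hH : IsCompact H) {r : ℝ} (hr : 0 ≤ r)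
    (h : volume.real H < r ^ 2 * volume.real (wb φ 1)) : erode H (wb φ r) = ∅ := by
  by_contra hne
  obtain ⟨x, hx⟩ := nonempty_iff_ne_empty.mpr hne
  have hsub : (fun z => x + z) '' wb φ r ⊆ H := by
    rintro _ ⟨z, hz, rfl⟩; exact hx z hz
  have := measureReal_mono (μ := volume) hsub hH.measure_lt_top.ne
  rw [measureReal_def, image_add_left, measure_preimage_add, ← measureReal_def,
    hφ.volume_wb hr] at this
  linarith

/-- Isoperimetric inequality in terms of projection bounds. -/
lemma exists_radius_of_projBound {A : Set Plane} (hA : MeasurableSet A) (hA0 : volume A ≠ 0)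
    (hAb : Bornology.IsBounded A) {B : ℝ} (hB : ProjBound φ A B) :
    ∃ s : ℝ, 0 < s ∧ volume.real A + s ^ 2 * volume.real (wb φ 1) ≤ s * B := by
  set H := closure (convexHull ℝ A)
  have hH : IsCompact H := (isBounded_convexHull.mpr hAb).isCompact_closure
  have hHc : Convex ℝ H := (convex_convexHull ℝ A).closure
  have hAH : A ⊆ H := (subset_convexHull ℝ A).trans subset_closure
  have hW := hφ.volume_wb_pos
  obtain ⟨r, hr⟩ := ((tendsto_pow_atTop (α := ℝ) two_ne_zero).atTop_mul_const hW).eventually_gt_atTop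
    (volume.real H) |>.and (eventually_gt_atTop 0) |>.exists
  rcases hφ.erosion_dichotomy hA hA0 hAH hH hHc hB hr.2 with h | ⟨s, hs, h⟩
  · rw [hφ.volume_erode_eq_zero hH hr.2.le hr.1] at h
    exact ⟨r, hr.2, by simpa using h⟩
  · exact ⟨s, hs.1, h⟩

lemma four_mul_le_sq_of_projBound {A : Set Plane} (hA : MeasurableSet A) (hA0 : volume A ≠ 0)
    (hAb : Bornology.IsBounded A) {B : ℝ} (hB : ProjBound φ A B) :
    0 < B ∧ 4 * volume.real (wb φ 1) * volume.real A ≤ B ^ 2 := by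
  obtain ⟨s, hs, h⟩ := hφ.exists_radius_of_projBound hA hA0 hAb hB
  have hW := hφ.volume_wb_pos
  have hA' : 0 ≤ volume.real A := measureReal_nonneg
  have hBpos : 0 < B := by
    by_contra! hB'
    nlinarith [mul_pos (pow_pos hs 2) hW]
  refine ⟨hBpos, ?_⟩
  nlinarith [sq_nonneg (2 * s * volume.real (wb φ 1) - B)]

end IsNorm

lemma setIntegral_diverg (η : Plane → Plane) {F : Set Plane} (hF : MeasurableSet F) :
    ∫ x, F.indicator (1 : Plane → ℝ) x * diverg η x = ∫ x in F, diverg η x := by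
  rw [← integral_indicator hF]
  refine integral_congr_ae (Eventually.of_forall fun x => ?_)
  by_cases h : x ∈ F <;> simp [h]

lemma anisoPerimeter_le {φ : Plane → ℝ} {F : Set Plane} (hF : MeasurableSet F) {c : ℝ}
    (h : ∀ η : Plane → Plane, ContDiff ℝ 1 η → HasCompactSupport η → (∀ x, φ (η x) ≤ 1) →
      ∫ x in F, diverg η x ≤ c) : anisoPerimeter φ F ≤ ENNReal.ofReal c := by
  refine iSup₂_le fun η hη => ?_
  rw [setIntegral_diverg η hF]
  exact ENNReal.ofReal_le_ofReal (h η hη.1 hη.2.1 hη.2.2)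

/-- Union of the open balls of radius `r` centred in `C`. -/
def fatten (φ : Plane → ℝ) (C : Set Plane) (r : ℝ) : Set Plane := ⋃ c ∈ C, wulffBall φ c r

lemma mem_fatten {φ : Plane → ℝ} {C : Set Plane} {r : ℝ} {x : Plane} :
    x ∈ fatten φ C r ↔ ∃ c ∈ C, φ (x - c) < r := by
  simp [fatten, wulffBall]

/-- Jacobian determinant of a planar vector field. -/
def jac (η : Plane → Plane) (x : Plane) : ℝ :=
  fderiv ℝ η x (Pi.single 0 1) 0 * fderiv ℝ η x (Pi.single 1 1) 1 -
    fderiv ℝ η x (Pi.single 1 1) 0 * fderiv ℝ η x (Pi.single 0 1) 1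

lemma continuous_jac {η : Plane → Plane} (hη : ContDiff ℝ 1 η) : Continuous (jac η) := by
  unfold jac
  have := hη.continuous_fderiv (by norm_num)
  fun_prop

lemma det_id_add_smul_fderiv (η : Plane → Plane) (x : Plane) (ε : ℝ) :
    (ContinuousLinearMap.id ℝ Plane + ε • fderiv ℝ η x).det =
      1 + ε * diverg η x + ε ^ 2 * jac η x := by
  rw [ContinuousLinearMap.det, ← LinearMap.det_toMatrix', Matrix.det_fin_two]
  simp only [LinearMap.toMatrix'_apply, diverg, jac, Fin.sum_univ_two]
  simp
  ring

namespace IsNorm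

variable {φ : Plane → ℝ} (hφ : IsNorm φ)
include hφ

lemma isOpen_fatten (C : Set Plane) (r : ℝ) : IsOpen (fatten φ C r) :=
  isOpen_biUnion fun c _ => hφ.isOpen_wulffBall c r

lemma convex_fatten {C : Set Plane} (hC : Convex ℝ C) (r : ℝ) : Convex ℝ (fatten φ C r) := by
  intro x hx y hy a b ha hb hab
  obtain ⟨c, hc, hxc⟩ := mem_fatten.mp hx
  obtain ⟨e, he, hye⟩ := mem_fatten.mp hy
  refine mem_fatten.mpr ⟨a • c + b • e, hC hc he ha hb hab, ?_⟩
  have h := hφ.add_le (a • (x - c)) (b • (y - e))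
  rw [hφ.smul_of_nonneg ha, hφ.smul_of_nonneg hb] at h
  have e1 : a • x + b • y - (a • c + b • e) = a • (x - c) + b • (y - e) := by module
  rw [e1]
  refine h.trans_lt ?_
  rcases ha.eq_or_lt with rfl | ha
  · rw [zero_add] at hab; subst hab; simpa using hye
  · calc a * φ (x - c) + b * φ (y - e) < a * r + b * r :=
        add_lt_add_of_lt_of_le (mul_lt_mul_of_pos_left hxc ha) (by gcongr)
      _ = r := by rw [← add_mul, hab, one_mul]

lemma subset_fatten (C : Set Plane) {r : ℝ} (hr : 0 < r) : C ⊆ fatten φ C r := fun c hc =>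
  mem_biUnion hc (hφ.mem_wulffBall_self hr c)

omit hφ in
lemma fatten_subset_add (C : Set Plane) (r : ℝ) : fatten φ C r ⊆ C + wb φ r := by
  intro x hx
  obtain ⟨c, hc, hxc⟩ := mem_fatten.mp hx
  exact ⟨c, hc, x - c, hxc.le, by simp⟩

omit hφ in
lemma add_subset_fatten (C : Set Plane) {s r : ℝ} (h : s < r) : C + wb φ s ⊆ fatten φ C r := by
  rintro _ ⟨c, hc, z, hz, rfl⟩
  refine mem_fatten.mpr ⟨c, hc, ?_⟩
  simp only [add_sub_cancel_left]
  exact lt_of_le_of_lt hz h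

lemma volume_fatten {C : Set Plane} (hC : IsCompact C) (hC0 : C.Nonempty) (hCc : Convex ℝ C)
    {r : ℝ} (hr : 0 < r) : volume.real (fatten φ C r) =
      volume.real C + r * mixed φ C + r ^ 2 * volume.real (wb φ 1) := by
  have hfin := (hC.add (hφ.isCompact_wb r)).measure_lt_top (μ := volume)
  refine le_antisymm ?_ ?_
  · rw [← hφ.volume_add_wb hC hC0 hCc hr.le]
    exact measureReal_mono (fatten_subset_add C r) hfin.ne
  · have hcont : Tendsto (fun s : ℝ => volume.real C + s * mixed φ C +
        s ^ 2 * volume.real (wb φ 1)) (𝓝[<] r) (𝓝 (volume.real C + r * mixed φ C +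
          r ^ 2 * volume.real (wb φ 1))) :=
      (Continuous.tendsto (by fun_prop) r).mono_left nhdsWithin_le_nhds
    refine le_of_tendsto hcont ?_
    filter_upwards [Ioo_mem_nhdsLT hr] with s hs
    rw [← hφ.volume_add_wb hC hC0 hCc hs.1.le]
    exact measureReal_mono (add_subset_fatten C hs.2)
      ((measure_mono (fatten_subset_add C r)).trans_lt hfin).ne

/-- Upper bound for the perimeter of a union of balls with centers in a convex body. -/
theorem anisoPerimeter_fatten_le {C : Set Plane} (hC : IsCompact C) (hC0 : C.Nonempty)
    (hCc : Convex ℝ C) {r : ℝ} (hr : 0 < r) :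
    anisoPerimeter φ (fatten φ C r) ≤
      ENNReal.ofReal (mixed φ C + 2 * r * volume.real (wb φ 1)) := by
  have hUm := (hφ.isOpen_fatten C r).measurableSet
  have hUb : Bornology.IsBounded (fatten φ C r) :=
    (hC.add (hφ.isCompact_wb r)).isBounded.subset (fatten_subset_add C r)
  refine anisoPerimeter_le hUm fun η h1 h2 h3 => ?_
  set U := fatten φ C r
  obtain ⟨L, hL⟩ := h1.lipschitzWith_of_hasCompactSupport h2 one_ne_zero
  have hdiv : IntegrableOn (diverg η) U := integrableOn_diverg h1 hUb
  have hjac : IntegrableOn (jac η) U := ((continuous_jac h1).continuousOn.integrableOn_compact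
    hUb.isCompact_closure).mono_set subset_closure
  have hone : IntegrableOn (fun _ : Plane => (1 : ℝ)) U :=
    (continuous_const.continuousOn.integrableOn_compact hUb.isCompact_closure).mono_set
      subset_closure
  have key : ∀ ε : ℝ, 0 < ε → ε * L < 1 → (∫ x in U, diverg η x) + ε * ∫ x in U, jac η x ≤
      mixed φ C + 2 * r * volume.real (wb φ 1) + ε * volume.real (wb φ 1) := by
    intro ε hε hεL
    have hinj : InjOn (fun x => x + ε • η x) U := by
      intro x _ y _ hxy
      simp only at hxy
      have e : x - y = ε • (η y - η x) := by
        rw [smul_sub, sub_eq_sub_iff_add_eq_add, hxy]; abel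
      have h4 : ‖η y - η x‖ ≤ L * ‖x - y‖ := by
        rw [norm_sub_rev x y]; exact hL.norm_sub_le y x
      have h5 : ‖x - y‖ ≤ ε * L * ‖x - y‖ := by
        conv_lhs => rw [e, norm_smul, Real.norm_of_nonneg hε.le]
        rw [mul_assoc]
        gcongr
      by_contra hne
      have : 0 < ‖x - y‖ := norm_pos_iff.mpr (sub_ne_zero.mpr hne)
      nlinarith
    have hder : ∀ x ∈ U, HasFDerivWithinAt (fun x => x + ε • η x)
        (ContinuousLinearMap.id ℝ Plane + ε • fderiv ℝ η x) U x := fun x _ =>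
      ((hasFDerivAt_id x).add (((h1.differentiable one_ne_zero) x).hasFDerivAt.const_smul
        ε)).hasFDerivWithinAt
    have hchange := lintegral_abs_det_fderiv_eq_addHaar_image volume hUm hder hinj
    simp only [det_id_add_smul_fderiv] at hchange
    have himg : (fun x => x + ε • η x) '' U ⊆ C + wb φ (r + ε) := by
      rintro _ ⟨x, hx, rfl⟩
      obtain ⟨c, hc, hxc⟩ := mem_fatten.mp hx
      refine ⟨c, hc, x + ε • η x - c, ?_, by simp⟩
      have e : x + ε • η x - c = (x - c) + ε • η x := by abel
      change φ _ ≤ _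
      rw [e]
      refine (hφ.add_le _ _).trans ?_
      rw [hφ.smul_of_nonneg hε.le]
      nlinarith [h3 x]
    have hod : IntegrableOn (fun x => 1 + ε * diverg η x) U := hone.add (hdiv.const_mul ε)
    have hInt : IntegrableOn (fun x => 1 + ε * diverg η x + ε ^ 2 * jac η x) U :=
      hod.add (hjac.const_mul (ε ^ 2))
    have hle : ∫ x in U, (1 + ε * diverg η x + ε ^ 2 * jac η x) ≤
        volume.real (C + wb φ (r + ε)) := by
      calc ∫ x in U, (1 + ε * diverg η x + ε ^ 2 * jac η x)
          ≤ ∫ x in U, |1 + ε * diverg η x + ε ^ 2 * jac η x| :=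
            integral_mono hInt hInt.abs fun x => le_abs_self _
        _ = (∫⁻ x in U, ENNReal.ofReal |1 + ε * diverg η x + ε ^ 2 * jac η x|).toReal := by
            rw [integral_eq_lintegral_of_nonneg_ae (Eventually.of_forall fun x => abs_nonneg _)
              hInt.abs.aestronglyMeasurable]
        _ ≤ _ := by
            rw [hchange]
            exact ENNReal.toReal_mono (hC.add (hφ.isCompact_wb _)).measure_lt_top.ne
              (measure_mono himg)
    have hsum : ∫ x in U, (1 + ε * diverg η x + ε ^ 2 * jac η x) =
        volume.real U + ε * (∫ x in U, diverg η x) + ε ^ 2 * ∫ x in U, jac η x := by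
      rw [integral_add hod (hjac.const_mul (ε ^ 2)),
        integral_add hone (hdiv.const_mul ε), integral_const_mul, integral_const_mul]
      simp
    rw [hsum, hφ.volume_fatten hC hC0 hCc hr, hφ.volume_add_wb hC hC0 hCc (by linarith)] at hle
    refine le_of_mul_le_mul_left ?_ hε
    linarith
  have hlim1 : Tendsto (fun ε : ℝ => (∫ x in U, diverg η x) + ε * ∫ x in U, jac η x) (𝓝[>] 0)
      (𝓝 ((∫ x in U, diverg η x) + 0 * ∫ x in U, jac η x)) :=
    (Continuous.tendsto (by fun_prop) 0).mono_left nhdsWithin_le_nhds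
  have hlim2 : Tendsto (fun ε : ℝ => mixed φ C + 2 * r * volume.real (wb φ 1) +
      ε * volume.real (wb φ 1)) (𝓝[>] 0)
      (𝓝 (mixed φ C + 2 * r * volume.real (wb φ 1) + 0 * volume.real (wb φ 1))) :=
    (Continuous.tendsto (by fun_prop) 0).mono_left nhdsWithin_le_nhds
  have := le_of_tendsto_of_tendsto hlim1 hlim2 (by
    have hL' : ∀ᶠ ε : ℝ in 𝓝[>] 0, ε * L < 1 := by
      have : Tendsto (fun ε : ℝ => ε * L) (𝓝[>] 0) (𝓝 (0 * L)) :=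
        (Continuous.tendsto (by fun_prop) 0).mono_left nhdsWithin_le_nhds
      exact this.eventually_lt_const (by simp)
    filter_upwards [hL', self_mem_nhdsWithin] with ε h h0 using key ε h0 h)
  simpa using this

end IsNorm

lemma exists_deriv_smoothTransition_le : ∃ C : ℝ, 0 ≤ C ∧
    (∀ t, |deriv Real.smoothTransition t| ≤ C) ∧
    ∀ t, t ∉ Icc (0 : ℝ) 1 → deriv Real.smoothTransition t = 0 := by
  have h0 : ∀ t, t ∉ Icc (0 : ℝ) 1 → deriv Real.smoothTransition t = 0 := by
    intro t ht
    rcases lt_or_ge t 0 with h | h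
    · have : Real.smoothTransition =ᶠ[𝓝 t] fun _ => 0 := by
        filter_upwards [Iio_mem_nhds h] with s hs
          using Real.smoothTransition.zero_of_nonpos (le_of_lt hs)
      rw [this.deriv_eq, deriv_const]
    · have h' : 1 < t := by
        by_contra! h1
        exact ht ⟨h, h1⟩
      have : Real.smoothTransition =ᶠ[𝓝 t] fun _ => 1 := by
        filter_upwards [Ioi_mem_nhds h'] with s hs
          using Real.smoothTransition.one_of_one_le (le_of_lt hs)
      rw [this.deriv_eq, deriv_const]
  have hc : Continuous (deriv Real.smoothTransition) :=
    (Real.smoothTransition.contDiff (n := 1)).continuous_deriv (by norm_num)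
  obtain ⟨C, hC⟩ := (isCompact_Icc (a := (0 : ℝ)) (b := 1)).exists_bound_of_continuousOn
    hc.continuousOn
  refine ⟨max C 0, le_max_right _ _, fun t => ?_, h0⟩
  by_cases ht : t ∈ Icc (0 : ℝ) 1
  · exact (hC t ht).trans (le_max_left _ _)
  · rw [h0 t ht, abs_zero]; exact le_max_right _ _

lemma diverg_smul {ψ : Plane → ℝ} (hψ : ContDiff ℝ 1 ψ) {η : Plane → Plane} (hη : ContDiff ℝ 1 η)
    (x : Plane) : diverg (fun y => ψ y • η y) x = ψ x * diverg η x + fderiv ℝ ψ x (η x) := by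
  have h1 : HasFDerivAt (fun y => ψ y • η y)
      (ψ x • fderiv ℝ η x + (fderiv ℝ ψ x).smulRight (η x)) x :=
    (hψ.differentiable (by norm_num) x).hasFDerivAt.smul (hη.differentiable (by norm_num) x).hasFDerivAt
  have h2 : η x = η x 0 • Pi.single (0 : Fin 2) (1 : ℝ) + η x 1 • Pi.single (1 : Fin 2) (1 : ℝ) := by
    ext i; fin_cases i <;> simp
  unfold diverg
  rw [h1.fderiv]
  conv_rhs => rw [h2, map_add, map_smul, map_smul]
  simp [Fin.sum_univ_two]
  ring

/-- The field `η` cut off smoothly to the half plane `{crs d > a}`. -/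
def cutField (d : Plane) (a : ℝ) (n : ℕ) (η : Plane → Plane) (x : Plane) : Plane :=
  Real.smoothTransition (((n : ℝ) + 1) * (crs d x - a)) • η x

lemma contDiff_crs (d : Plane) : ContDiff ℝ 1 (crs d) := by
  unfold crs; fun_prop

lemma contDiff_cutoff (d : Plane) (a : ℝ) (n : ℕ) :
    ContDiff ℝ 1 fun x => Real.smoothTransition (((n : ℝ) + 1) * (crs d x - a)) :=
  (Real.smoothTransition.contDiff (n := 1)).comp
    (contDiff_const.mul ((contDiff_crs d).sub contDiff_const))

lemma contDiff_cutField (d : Plane) (a : ℝ) (n : ℕ) {η : Plane → Plane} (hη : ContDiff ℝ 1 η) :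
    ContDiff ℝ 1 (cutField d a n η) := (contDiff_cutoff d a n).smul hη

lemma hasFDerivAt_crs (d x : Plane) : ∃ L : Plane →L[ℝ] ℝ, HasFDerivAt (crs d) L x ∧
    ∀ v, L v = crs d v := by
  let L : Plane →ₗ[ℝ] ℝ :=
    { toFun := crs d
      map_add' := crs_add_right d
      map_smul' := fun c v => by simp [crs_smul_right] }
  exact ⟨L.toContinuousLinearMap, L.toContinuousLinearMap.hasFDerivAt, fun v => rfl⟩

lemma fderiv_cutoff (d : Plane) (a : ℝ) (n : ℕ) (x v : Plane) :
    fderiv ℝ (fun x => Real.smoothTransition (((n : ℝ) + 1) * (crs d x - a))) x v =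
      deriv Real.smoothTransition (((n : ℝ) + 1) * (crs d x - a)) * (((n : ℝ) + 1) * crs d v) := by
  obtain ⟨L, hL, hLv⟩ := hasFDerivAt_crs d x
  have h1 : HasFDerivAt (fun x => ((n : ℝ) + 1) * (crs d x - a)) (((n : ℝ) + 1) • L) x :=
    (hL.sub_const a).const_mul _
  have h2 : HasDerivAt Real.smoothTransition
      (deriv Real.smoothTransition (((n : ℝ) + 1) * (crs d x - a)))
      (((n : ℝ) + 1) * (crs d x - a)) :=
    (((Real.smoothTransition.contDiff (n := 1)).differentiable (by norm_num)) _).hasDerivAt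
  have h3 := (h2.comp_hasFDerivAt x h1).fderiv
  rw [Function.comp_def] at h3
  rw [h3]
  simp [hLv]

/-- The strip averages of `E` around the line `{crs d = a}` vanish in the limit. -/
def ZeroTrace (E : Set Plane) (d : Plane) (a : ℝ) : Prop :=
  Tendsto (fun n : ℕ => ((n : ℝ) + 1) * volume.real (E ∩ {x | |crs d x - a| ≤ 1 / ((n : ℝ) + 1)}))
    atTop (𝓝 0)

lemma ZeroTrace.neg {E : Set Plane} {d : Plane} {a : ℝ} (h : ZeroTrace E d a) :
    ZeroTrace E (-d) (-a) := by
  unfold ZeroTrace at h ⊢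
  have e : ∀ x, |crs (-d) x - -a| = |crs d x - a| := fun x => by
    rw [← abs_neg]; congr 1; simp [crs]; ring
  simpa only [e] using h

lemma tendsto_setIntegral_diverg_cutField {E : Set Plane}
    (hEb : Bornology.IsBounded E) {d : Plane} {a : ℝ} (h : ZeroTrace E d a)
    {η : Plane → Plane} (h1 : ContDiff ℝ 1 η) (h2 : HasCompactSupport η) :
    Tendsto (fun n => ∫ x in E, diverg (cutField d a n η) x) atTop
      (𝓝 (∫ x in E ∩ {x | a < crs d x}, diverg η x)) := by
  have hdiv := integrableOn_diverg h1 hEb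
  have hmeas : MeasurableSet {x | a < crs d x} :=
    measurableSet_lt measurable_const (continuous_crs d).measurable
  obtain ⟨C, hC0, hC, hCz⟩ := exists_deriv_smoothTransition_le
  have hcrs : Continuous fun x => crs d (η x) := (continuous_crs d).comp h1.continuous
  have hcs : HasCompactSupport fun x => crs d (η x) := h2.comp_left (g := crs d) (by simp [crs])
  obtain ⟨M, hM⟩ := hcs.exists_bound_of_continuous hcrs
  have hM0 : 0 ≤ M := (norm_nonneg _).trans (hM 0)
  have hfirst : Tendsto (fun n : ℕ => ∫ x in E,
      Real.smoothTransition (((n : ℝ) + 1) * (crs d x - a)) * diverg η x) atTop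
      (𝓝 (∫ x in E, {x | a < crs d x}.indicator (diverg η) x)) := by
    refine tendsto_integral_of_dominated_convergence (fun x => |diverg η x|) (fun n => ?_)
      hdiv.abs (fun n => Eventually.of_forall fun x => ?_) (Eventually.of_forall fun x => ?_)
    · exact (((contDiff_cutoff d a n).continuous.mul (continuous_diverg h1))).aestronglyMeasurable
    · rw [Real.norm_eq_abs, abs_mul, abs_of_nonneg (Real.smoothTransition.nonneg _)]
      exact mul_le_of_le_one_left (abs_nonneg _) (Real.smoothTransition.le_one _)
    · by_cases hx : a < crs d x
      · rw [indicator_of_mem (show x ∈ {x | a < crs d x} from hx)]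
        have hlim : Tendsto (fun n : ℕ => ((n : ℝ) + 1) * (crs d x - a)) atTop atTop :=
          (tendsto_atTop_add_const_right _ 1 tendsto_natCast_atTop_atTop).atTop_mul_const
            (by linarith)
        refine tendsto_const_nhds.congr' ?_
        filter_upwards [hlim.eventually_ge_atTop 1] with n hn
        rw [Real.smoothTransition.one_of_one_le hn, one_mul]
      · rw [indicator_of_notMem (show x ∉ {x | a < crs d x} from hx)]
        refine tendsto_const_nhds.congr fun n => ?_
        rw [Real.smoothTransition.zero_of_nonpos, zero_mul]
        exact mul_nonpos_of_nonneg_of_nonpos (by positivity) (by linarith)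
  rw [setIntegral_indicator hmeas] at hfirst
  have hsnd_cont : ∀ n : ℕ, Continuous fun x =>
      deriv Real.smoothTransition (((n : ℝ) + 1) * (crs d x - a)) *
        (((n : ℝ) + 1) * crs d (η x)) := by
    intro n
    have := (Real.smoothTransition.contDiff (n := 1)).continuous_deriv (by norm_num)
    have := continuous_crs d
    fun_prop
  have hsecond : Tendsto (fun n : ℕ => ∫ x in E,
      deriv Real.smoothTransition (((n : ℝ) + 1) * (crs d x - a)) *
        (((n : ℝ) + 1) * crs d (η x))) atTop (𝓝 0) := by
    have hlim := h.const_mul (C * M)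
    rw [mul_zero] at hlim
    refine squeeze_zero_norm (fun n => ?_) hlim
    have hS : MeasurableSet {x | |crs d x - a| ≤ 1 / ((n : ℝ) + 1)} :=
      measurableSet_le (((continuous_crs d).sub continuous_const).abs).measurable measurable_const
    have hfin : volume (E ∩ {x | |crs d x - a| ≤ 1 / ((n : ℝ) + 1)}) ≠ ∞ :=
      ((measure_mono inter_subset_left).trans_lt hEb.measure_lt_top).ne
    calc ‖∫ x in E, deriv Real.smoothTransition (((n : ℝ) + 1) * (crs d x - a)) *
          (((n : ℝ) + 1) * crs d (η x))‖
        ≤ ∫ x in E, {x | |crs d x - a| ≤ 1 / ((n : ℝ) + 1)}.indicator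
            (fun _ => C * (((n : ℝ) + 1) * M)) x := by
          refine norm_integral_le_of_norm_le ?_ (Eventually.of_forall fun x => ?_)
          · refine IntegrableOn.indicator ?_ hS
            exact (integrableOn_const (hEb.measure_lt_top).ne)
          · by_cases hx : |crs d x - a| ≤ 1 / ((n : ℝ) + 1)
            · rw [indicator_of_mem (show x ∈ {x | |crs d x - a| ≤ 1 / ((n : ℝ) + 1)} from hx),
                norm_mul, norm_mul, Real.norm_of_nonneg (show (0 : ℝ) ≤ (n : ℝ) + 1 by positivity)]
              gcongr
              · exact hC _
              · exact hM x
            · rw [indicator_of_notMem (show x ∉ {x | |crs d x - a| ≤ 1 / ((n : ℝ) + 1)} from hx),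
                hCz, zero_mul, norm_zero]
              rintro ⟨ha, hb⟩
              apply hx
              rw [abs_le, le_div_iff₀ (by positivity), mul_comm]
              refine ⟨?_, hb⟩
              have : 0 ≤ crs d x - a := by
                by_contra! hneg
                nlinarith [show (0 : ℝ) < (n : ℝ) + 1 by positivity]
              have h' : (0 : ℝ) ≤ 1 / ((n : ℝ) + 1) := by positivity
              linarith
      _ = C * M * ((↑n + 1) * volume.real (E ∩ {x | |crs d x - a| ≤ 1 / ((n : ℝ) + 1)})) := by
          rw [setIntegral_indicator hS, setIntegral_const, smul_eq_mul]
          ring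
  have hsum := hfirst.add hsecond
  rw [add_zero] at hsum
  refine hsum.congr fun n => ?_
  have hA : IntegrableOn (fun x => Real.smoothTransition (((n : ℝ) + 1) * (crs d x - a)) *
      diverg η x) E :=
    (((contDiff_cutoff d a n).continuous.mul (continuous_diverg h1)).continuousOn.integrableOn_compact
      hEb.isCompact_closure).mono_set subset_closure
  have hB : IntegrableOn (fun x => deriv Real.smoothTransition (((n : ℝ) + 1) * (crs d x - a)) *
        (((n : ℝ) + 1) * crs d (η x))) E :=
    ((hsnd_cont n).continuousOn.integrableOn_compact hEb.isCompact_closure).mono_set subset_closure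
  rw [← integral_add hA hB]
  refine integral_congr_ae (Eventually.of_forall fun x => ?_)
  have := diverg_smul (contDiff_cutoff d a n) h1 x
  rw [fderiv_cutoff] at this
  exact this.symm

namespace IsNorm

variable {φ : Plane → ℝ} (hφ : IsNorm φ)
include hφ

lemma cutField_add_le {d : Plane} {a : ℝ} (n : ℕ) {η ξ : Plane → Plane} (hη : ∀ x, φ (η x) ≤ 1)
    (hξ : ∀ x, φ (ξ x) ≤ 1) (x : Plane) :
    φ ((cutField d a n η + cutField (-d) (-a) n ξ) x) ≤ 1 := by
  have key : ∀ s : ℝ, ∀ z, φ z ≤ 1 → φ (Real.smoothTransition s • z) ≤ 1 := by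
    intro s z hz
    rw [hφ.smul_of_nonneg (Real.smoothTransition.nonneg s)]
    exact mul_le_one₀ (Real.smoothTransition.le_one s) (hφ.nonneg z) hz
  have e : crs (-d) x - -a = -(crs d x - a) := by simp [crs]; ring
  simp only [Pi.add_apply, cutField, e]
  rcases le_total (crs d x - a) 0 with h | h
  · rw [Real.smoothTransition.zero_of_nonpos (mul_nonpos_of_nonneg_of_nonpos (by positivity) h),
      zero_smul, zero_add]
    exact key _ _ (hξ x)
  · rw [Real.smoothTransition.zero_of_nonpos (x := ((n : ℝ) + 1) * -(crs d x - a))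
      (mul_nonpos_of_nonneg_of_nonpos (by positivity) (by linarith)), zero_smul, add_zero]
    exact key _ _ (hη x)

/-- Cutting along a line with vanishing trace does not increase the perimeter. -/
theorem anisoPerimeter_cut_add_le {E : Set Plane} (hE : MeasurableSet E)
    (hEb : Bornology.IsBounded E) (hP : anisoPerimeter φ E ≠ ∞) {d : Plane} {a : ℝ}
    (h : ZeroTrace E d a) :
    anisoPerimeter φ (E ∩ {x | a < crs d x}) ≠ ∞ ∧ anisoPerimeter φ (E ∩ {x | crs d x < a}) ≠ ∞ ∧
    (anisoPerimeter φ (E ∩ {x | a < crs d x})).toReal +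
      (anisoPerimeter φ (E ∩ {x | crs d x < a})).toReal ≤ (anisoPerimeter φ E).toReal := by
  have hA : MeasurableSet (E ∩ {x | a < crs d x}) :=
    hE.inter (measurableSet_lt measurable_const (continuous_crs d).measurable)
  have hB : MeasurableSet (E ∩ {x | crs d x < a}) :=
    hE.inter (measurableSet_lt (continuous_crs d).measurable measurable_const)
  have hset : {x | -a < crs (-d) x} = {x | crs d x < a} := by
    ext x
    have e : crs (-d) x = -crs d x := by simp [crs]; ring
    simp only [mem_ofPred_eq, e, neg_lt_neg_iff]
  have key : ∀ η ξ : Plane → Plane, ContDiff ℝ 1 η → HasCompactSupport η → (∀ x, φ (η x) ≤ 1) →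
      ContDiff ℝ 1 ξ → HasCompactSupport ξ → (∀ x, φ (ξ x) ≤ 1) →
      (∫ x in E ∩ {x | a < crs d x}, diverg η x) + ∫ x in E ∩ {x | crs d x < a}, diverg ξ x ≤
        (anisoPerimeter φ E).toReal := by
    intro η ξ h1 h2 h3 g1 g2 g3
    have l1 := tendsto_setIntegral_diverg_cutField hEb h h1 h2
    have l2 := tendsto_setIntegral_diverg_cutField hEb h.neg g1 g2
    rw [hset] at l2
    refine le_of_tendsto' (l1.add l2) fun n => ?_
    have c1 := contDiff_cutField d a n h1
    have c2 := contDiff_cutField (-d) (-a) n g1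
    have hle := le_anisoPerimeter (φ := φ) (c1.add c2)
      ((h2.smul_left (f := fun x => Real.smoothTransition (((n : ℝ) + 1) * (crs d x - a)))).add
        (g2.smul_left (f := fun x => Real.smoothTransition (((n : ℝ) + 1) * (crs (-d) x - -a)))))
      (hφ.cutField_add_le n h3 g3) hE
    have hle' := (ENNReal.ofReal_le_iff_le_toReal hP).mp hle
    refine le_trans (le_of_eq ?_) hle'
    rw [← integral_add (integrableOn_diverg c1 hEb) (integrableOn_diverg c2 hEb)]
    exact integral_congr_ae (Eventually.of_forall fun x => (diverg_add c1 c2 x).symm)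
  have hz : ∀ x : Plane, φ ((0 : Plane → Plane) x) ≤ 1 := fun x => by
    rw [Pi.zero_apply, hφ.zero]; exact zero_le_one
  have hz1 : ContDiff ℝ 1 (0 : Plane → Plane) := contDiff_const
  have hz2 : HasCompactSupport (0 : Plane → Plane) := HasCompactSupport.zero
  have hdz : ∀ x, diverg (0 : Plane → Plane) x = 0 := fun x => by
    unfold diverg
    simp
  have hPB : ∀ η : Plane → Plane, ContDiff ℝ 1 η → HasCompactSupport η → (∀ x, φ (η x) ≤ 1) →
      anisoPerimeter φ (E ∩ {x | crs d x < a}) ≤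
        ENNReal.ofReal ((anisoPerimeter φ E).toReal - ∫ x in E ∩ {x | a < crs d x}, diverg η x) :=
    fun η h1 h2 h3 => anisoPerimeter_le hB fun ξ g1 g2 g3 => by
      have := key η ξ h1 h2 h3 g1 g2 g3
      linarith
  have hBfin : anisoPerimeter φ (E ∩ {x | crs d x < a}) ≠ ∞ :=
    ((hPB 0 hz1 hz2 hz).trans_lt ENNReal.ofReal_lt_top).ne
  have hPA : anisoPerimeter φ (E ∩ {x | a < crs d x}) ≤ ENNReal.ofReal
      ((anisoPerimeter φ E).toReal - (anisoPerimeter φ (E ∩ {x | crs d x < a})).toReal) := by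
    refine anisoPerimeter_le hA fun η h1 h2 h3 => ?_
    have hk := key η 0 h1 h2 h3 hz1 hz2 hz
    simp only [hdz, integral_zero, add_zero] at hk
    have := ENNReal.toReal_le_of_le_ofReal (by linarith) (hPB η h1 h2 h3)
    linarith
  have hAfin : anisoPerimeter φ (E ∩ {x | a < crs d x}) ≠ ∞ :=
    (hPA.trans_lt ENNReal.ofReal_lt_top).ne
  refine ⟨hAfin, hBfin, ?_⟩
  have hnn : (anisoPerimeter φ (E ∩ {x | crs d x < a})).toReal ≤ (anisoPerimeter φ E).toReal := by
    refine ENNReal.toReal_le_of_le_ofReal ENNReal.toReal_nonneg ((hPB 0 hz1 hz2 hz).trans ?_)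
    simp [hdz]
  have := ENNReal.toReal_le_of_le_ofReal (by linarith) hPA
  linarith

end IsNorm

/-- The closed convex hull of a planar set up to null sets. -/
def essHull (E : Set Plane) : Set Plane := closure (convexHull ℝ (volume.restrict E).support)

lemma convex_essHull (E : Set Plane) : Convex ℝ (essHull E) := (convex_convexHull ℝ _).closure

lemma essHull_subset {E L : Set Plane} (hL : IsClosed L)
    (hLc : Convex ℝ L) (h : volume (E \ L) = 0) : essHull E ⊆ L := by
  refine closure_minimal (convexHull_min ?_ hLc) hL
  refine Measure.support_subset_of_isClosed hL ?_
  rw [mem_ae_iff, Measure.restrict_apply hL.measurableSet.compl]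
  rwa [inter_comm, ← sdiff_eq]

lemma isCompact_essHull {E : Set Plane} (hEb : Bornology.IsBounded E) :
    IsCompact (essHull E) := by
  have h : essHull E ⊆ closure (convexHull ℝ E) := by
    refine essHull_subset isClosed_closure (convex_convexHull ℝ E).closure ?_
    rw [sdiff_eq_empty.mpr ((subset_convexHull ℝ E).trans subset_closure), measure_empty]
  exact ((isBounded_convexHull.mpr hEb).isCompact_closure).of_isClosed_subset isClosed_closure h

lemma volume_diff_essHull {E : Set Plane} : volume (E \ essHull E) = 0 := by
  have h : (volume.restrict E).supportᶜ ⊇ (essHull E)ᶜ :=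
    compl_subset_compl.mpr ((subset_convexHull ℝ _).trans subset_closure)
  have h' := measure_mono_null h (Measure.measure_compl_support (μ := volume.restrict E))
  rw [Measure.restrict_apply (show MeasurableSet (essHull E)ᶜ from
    isClosed_closure.measurableSet.compl)] at h'
  rwa [sdiff_eq, inter_comm]

lemma nonempty_essHull {E : Set Plane} (hE0 : volume E ≠ 0) : (essHull E).Nonempty := by
  by_contra h
  rw [not_nonempty_iff_eq_empty] at h
  have := volume_diff_essHull (E := E)
  rw [h, sdiff_empty] at this
  exact hE0 this

lemma volume_inter_strip {d : Plane} (hd : d ≠ 0) {E : Set Plane} (hE : MeasurableSet E)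
    (hEb : Bornology.IsBounded E) (a δ : ℝ) :
    volume.real (E ∩ {x | |crs d x - a| ≤ δ}) =
      ∫ t in Metric.closedBall a δ, (volume (slice d E t)).toReal := by
  have hS : {x | |crs d x - a| ≤ δ} = crs d ⁻¹' Metric.closedBall a δ := by
    ext x; simp [Real.dist_eq]
  have hm : MeasurableSet (crs d ⁻¹' Metric.closedBall a δ) :=
    (continuous_crs d).measurable Metric.isClosed_closedBall.measurableSet
  have h1 : volume (E ∩ {x | |crs d x - a| ≤ δ}) =
      ∫⁻ t in Metric.closedBall a δ, volume (slice d E t) := by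
    have h := lintegral_comp_crs hd hE (f := (Metric.closedBall a δ).indicator 1)
      (measurable_one.indicator Metric.isClosed_closedBall.measurableSet)
    have e1 : (fun x => (Metric.closedBall a δ).indicator (1 : ℝ → ℝ≥0∞) (crs d x)) =
        (crs d ⁻¹' Metric.closedBall a δ).indicator 1 := by
      ext x; rfl
    have e2 : (fun t => (Metric.closedBall a δ).indicator (1 : ℝ → ℝ≥0∞) t *
        volume (slice d E t)) =
        (Metric.closedBall a δ).indicator fun t => volume (slice d E t) := by
      ext t
      by_cases ht : t ∈ Metric.closedBall a δ <;> simp [ht]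
    rw [e1, e2, lintegral_indicator_one hm, Measure.restrict_apply hm,
      lintegral_indicator Metric.isClosed_closedBall.measurableSet] at h
    rw [hS, inter_comm, h]
  rw [measureReal_def, h1, integral_toReal (measurable_volume_slice d hE).aemeasurable
    (Eventually.of_forall fun t => (volume_slice_ne_top hd hEb t).lt_top)]

lemma exists_zeroTrace {d : Plane} (hd : d ≠ 0) {E : Set Plane} (hE : MeasurableSet E)
    (hEb : Bornology.IsBounded E) (hE0 : volume E ≠ 0)
    (h : volume (proj d E) < ENNReal.ofReal (width (essHull E) d)) :
    ∃ a, ZeroTrace E d a ∧ volume (E ∩ {x | a < crs d x}) ≠ 0 ∧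
      volume (E ∩ {x | crs d x < a}) ≠ 0 := by
  have hK := isCompact_essHull hEb
  have hK0 := nonempty_essHull hE0
  have hKc := convex_essHull E
  rw [← volume_image_crs hK hK0 hKc] at h
  have hIcc := image_crs_eq_Icc hK hK0 hKc d
  set p := -supp (essHull E) (-perp d)
  set q := supp (essHull E) (perp d)
  rw [hIcc] at h
  have hpq : p ≤ q := by
    have : (crs d '' essHull E).Nonempty := hK0.image _
    rw [hIcc, nonempty_Icc] at this
    exact this
  have hInt : Integrable fun t => (volume (slice d E t)).toReal := by
    refine integrable_toReal_of_lintegral_ne_top (measurable_volume_slice d hE).aemeasurable ?_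
    rw [← volume_eq_lintegral_slice hd hE]
    exact hEb.measure_lt_top.ne
  have hN : volume (Ioo p q \ proj d E) ≠ 0 := by
    intro h0
    refine h.not_ge ?_
    rw [Real.volume_Icc, ← Real.volume_Ioo]
    calc volume (Ioo p q) ≤ volume (Ioo p q \ proj d E ∪ proj d E) :=
          measure_mono fun t ht => by
            by_cases h : t ∈ proj d E
            · exact Or.inr h
            · exact Or.inl ⟨ht, h⟩
      _ ≤ volume (Ioo p q \ proj d E) + volume (proj d E) := measure_union_le _ _
      _ = volume (proj d E) := by rw [h0, zero_add]
  have hleb := IsUnifLocDoublingMeasure.ae_tendsto_average volume hInt.locallyIntegrable 1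
  obtain ⟨a, ⟨⟨hpa, haq⟩, ha⟩, hlim⟩ : ∃ a ∈ Ioo p q \ proj d E,
      ∀ {ι : Type} {l : Filter ι} (w : ι → ℝ) (δ : ι → ℝ), Tendsto δ l (𝓝[>] 0) →
      (∀ᶠ j in l, a ∈ Metric.closedBall (w j) (1 * δ j)) →
      Tendsto (fun j => ⨍ y in Metric.closedBall (w j) (δ j), (volume (slice d E y)).toReal) l
        (𝓝 (volume (slice d E a)).toReal) := by
    by_contra! hno
    refine hN (measure_mono_null ?_ (ae_iff.mp hleb))
    intro a ha hcon
    obtain ⟨ι, l, w, δ, h1, h2, h3⟩ := hno a ha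
    exact h3 (hcon w δ h1 h2)
  have hfa : volume (slice d E a) = 0 := by simpa [proj] using ha
  refine ⟨a, ?_, fun h0 => ?_, fun h0 => ?_⟩
  · have hδ : Tendsto (fun n : ℕ => 1 / ((n : ℝ) + 1)) atTop (𝓝[>] 0) :=
      tendsto_nhdsWithin_iff.mpr ⟨tendsto_one_div_add_atTop_nhds_zero_nat,
        Eventually.of_forall fun n => by
          change (0 : ℝ) < 1 / ((n : ℝ) + 1); positivity⟩
    have := (hlim (fun _ => a) (fun n : ℕ => 1 / ((n : ℝ) + 1)) hδ
      (Eventually.of_forall fun n => Metric.mem_closedBall_self (by positivity))).const_mul 2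
    rw [hfa, ENNReal.toReal_zero, mul_zero] at this
    refine this.congr fun n => ?_
    rw [volume_inter_strip hd hE hEb, setAverage_eq, measureReal_def, Real.volume_closedBall,
      ENNReal.toReal_ofReal (by positivity), smul_eq_mul]
    field_simp
  · have hsub : essHull E ⊆ {x | crs d x ≤ a} := by
      refine essHull_subset (isClosed_le (continuous_crs d) continuous_const) ?_ ?_
      · intro x hx y hy s t hs ht hst
        change crs d (s • x + t • y) ≤ a
        rw [crs_add_right, crs_smul_right, crs_smul_right]
        calc s * crs d x + t * crs d y ≤ s * a + t * a := by gcongr <;> assumption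
          _ = a := by rw [← add_mul, hst, one_mul]
      · refine measure_mono_null (t := E ∩ {x | a < crs d x}) (fun x hx => ⟨hx.1, ?_⟩) h0
        have : ¬ crs d x ≤ a := hx.2
        exact not_le.mp this
    obtain ⟨x, hx, hxq⟩ : q ∈ crs d '' essHull E := hIcc ▸ right_mem_Icc.mpr hpq
    have := hsub hx
    have : crs d x ≤ a := this
    linarith
  · have hsub : essHull E ⊆ {x | a ≤ crs d x} := by
      refine essHull_subset (isClosed_le continuous_const (continuous_crs d)) ?_ ?_
      · intro x hx y hy s t hs ht hst
        change a ≤ crs d (s • x + t • y)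
        rw [crs_add_right, crs_smul_right, crs_smul_right]
        calc a = s * a + t * a := by rw [← add_mul, hst, one_mul]
          _ ≤ s * crs d x + t * crs d y := by gcongr <;> assumption
      · refine measure_mono_null (t := E ∩ {x | crs d x < a}) (fun x hx => ⟨hx.1, ?_⟩) h0
        have : ¬ a ≤ crs d x := hx.2
        exact not_le.mp this
    obtain ⟨x, hx, hxq⟩ : p ∈ crs d '' essHull E := hIcc ▸ left_mem_Icc.mpr hpq
    have := hsub hx
    have : a ≤ crs d x := this
    linarith

namespace IsNorm

variable {φ : Plane → ℝ} (hφ : IsNorm φ)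
include hφ

/-- A set that cannot be cut into two pieces without increasing the perimeter controls the
projections of its convex hull. -/
theorem projBound_essHull {E : Set Plane} (hE : MeasurableSet E)
    (hEb : Bornology.IsBounded E) (hE0 : volume E ≠ 0) (hP : anisoPerimeter φ E ≠ ∞)
    (hsplit : ∀ (d : Plane) (a : ℝ), d ≠ 0 → volume (E ∩ {x | a < crs d x}) ≠ 0 →
      volume (E ∩ {x | crs d x < a}) ≠ 0 →
      anisoPerimeter φ (E ∩ {x | a < crs d x}) ≠ ∞ →
      anisoPerimeter φ (E ∩ {x | crs d x < a}) ≠ ∞ →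
      ¬ ((anisoPerimeter φ (E ∩ {x | a < crs d x})).toReal +
        (anisoPerimeter φ (E ∩ {x | crs d x < a})).toReal ≤ (anisoPerimeter φ E).toReal)) :
    ProjBound φ (essHull E) (anisoPerimeter φ E).toReal := by
  have hw : ∀ d, d ≠ 0 → ENNReal.ofReal (width (essHull E) d) ≤ volume (proj d E) := by
    intro d hd
    by_contra! hlt
    obtain ⟨a, h0, h1, h2⟩ := exists_zeroTrace hd hE hEb hE0 hlt
    obtain ⟨g1, g2, g3⟩ := hφ.anisoPerimeter_cut_add_le hE hEb hP h0
    exact hsplit d a hd h1 h2 g1 g2 g3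
  have hK := isCompact_essHull hEb
  have hK0 := nonempty_essHull hE0
  have hKc := convex_essHull E
  intro l h1 h2
  refine le_trans ?_ (hφ.projBound_anisoPerimeter hE hEb hP l h1 h2)
  refine (projSum_le_widthSum h1 hK hK0 hKc).trans ?_
  rw [← ENNReal.ofReal_le_iff_le_toReal (projSum_ne_top h1 hEb)]
  clear h2
  induction l with
  | nil => simp [widthSum, projSum]
  | cons d l ih =>
    have e : widthSum (d :: l) (essHull E) = width (essHull E) d + widthSum l (essHull E) := by
      simp [widthSum]
    rw [projSum_cons, e, ENNReal.ofReal_add (width_nonneg hK hK0 d) (widthSum_nonneg l hK hK0)]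
    exact add_le_add (hw d (h1 d (by simp))) (ih fun e he => h1 e (by simp [he]))

end IsNorm

lemma volume_real_cut {d : Plane} (hd : d ≠ 0) {E : Set Plane} (hE : MeasurableSet E)
    (hEb : Bornology.IsBounded E) (a : ℝ) :
    volume.real (E ∩ {x | a < crs d x}) + volume.real (E ∩ {x | crs d x < a}) =
      volume.real E := by
  have h0 : volume.real (E ∩ {x | |crs d x - a| ≤ 0}) = 0 := by
    rw [volume_inter_strip hd hE hEb, Metric.closedBall_zero,
      setIntegral_measure_zero _ (by simp)]
  have hm1 : MeasurableSet {x | a < crs d x} := measurableSet_lt measurable_const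
    (continuous_crs d).measurable
  have hm2 : MeasurableSet {x | crs d x < a} := measurableSet_lt
    (continuous_crs d).measurable measurable_const
  have h1 := measureReal_inter_add_sdiff (μ := volume) (s := E) hm1 hEb.measure_lt_top.ne
  have h2 := measureReal_inter_add_sdiff (μ := volume) (s := E \ {x | a < crs d x}) hm2
    (hEb.subset sdiff_subset).measure_lt_top.ne
  have e1 : E \ {x | a < crs d x} ∩ {x | crs d x < a} = E ∩ {x | crs d x < a} := by
    ext x
    simp only [mem_inter_iff, Set.mem_sdiff, mem_ofPred_eq]
    constructor
    · rintro ⟨⟨h, _⟩, h'⟩; exact ⟨h, h'⟩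
    · rintro ⟨h, h'⟩; exact ⟨⟨h, h'.le.not_gt⟩, h'⟩
  have e2 : (E \ {x | a < crs d x}) \ {x | crs d x < a} = E ∩ {x | |crs d x - a| ≤ 0} := by
    ext x
    simp only [mem_inter_iff, Set.mem_sdiff, mem_ofPred_eq, abs_nonpos_iff, sub_eq_zero, not_lt]
    constructor
    · rintro ⟨⟨h, h'⟩, h''⟩; exact ⟨h, le_antisymm h' h''⟩
    · rintro ⟨h, h'⟩; exact ⟨⟨h, h'.le⟩, h'.ge⟩
  rw [e1, e2, h0] at h2
  linarith

namespace IsNorm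

variable {φ : Plane → ℝ} (hφ : IsNorm φ)
include hφ

theorem projBound_essHull_of_sq_le {E : Set Plane} (hE : MeasurableSet E)
    (hEb : Bornology.IsBounded E) (hE0 : volume E ≠ 0) (hP : anisoPerimeter φ E ≠ ∞)
    (h : (anisoPerimeter φ E).toReal ^ 2 ≤ 4 * volume.real (wb φ 1) * volume.real E) :
    ProjBound φ (essHull E) (anisoPerimeter φ E).toReal := by
  refine hφ.projBound_essHull hE hEb hE0 hP fun d a hd hA0 hB0 hPA hPB hsum => ?_
  have hAm : MeasurableSet (E ∩ {x | a < crs d x}) :=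
    hE.inter (measurableSet_lt measurable_const (continuous_crs d).measurable)
  have hBm : MeasurableSet (E ∩ {x | crs d x < a}) :=
    hE.inter (measurableSet_lt (continuous_crs d).measurable measurable_const)
  have hAb := hEb.subset (inter_subset_left (s := E) (t := {x | a < crs d x}))
  have hBb := hEb.subset (inter_subset_left (s := E) (t := {x | crs d x < a}))
  obtain ⟨h1, h2⟩ := hφ.four_mul_le_sq_of_projBound hAm hA0 hAb
    (hφ.projBound_anisoPerimeter hAm hAb hPA)
  obtain ⟨h3, h4⟩ := hφ.four_mul_le_sq_of_projBound hBm hB0 hBb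
    (hφ.projBound_anisoPerimeter hBm hBb hPB)
  have h5 := volume_real_cut hd hE hEb a
  rw [← h5] at h
  have h6 := pow_le_pow_left₀ (add_nonneg h1.le h3.le) hsum 2
  nlinarith [mul_pos h1 h3]

lemma volume_erode_cut_add_le {d : Plane} (hd : d ≠ 0) {H : Set Plane} (hH : IsCompact H)
    (a : ℝ) {r : ℝ} (hr : 0 < r) :
    volume.real (erode (H ∩ {x | a ≤ crs d x}) (wb φ r)) +
      volume.real (erode (H ∩ {x | crs d x ≤ a}) (wb φ r)) ≤ volume.real (erode H (wb φ r)) := by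
  have hdisj : Disjoint (erode (H ∩ {x | a ≤ crs d x}) (wb φ r))
      (erode (H ∩ {x | crs d x ≤ a}) (wb φ r)) := by
    rw [disjoint_left]
    intro c h1 h2
    have key : ∀ z ∈ wb φ r, crs d (c + z) = a := fun z hz =>
      le_antisymm (h2 z hz).2 (h1 z hz).2
    have hz0 := key 0 (hφ.zero_mem_wb hr.le)
    have hc : conj d ≠ 0 := fun h => by
      have := crs_conj hd; rw [h] at this; simp [crs] at this
    have hpos := hφ.pos hc
    have hz1 := key ((r / φ (conj d)) • conj d) (by
      change φ _ ≤ r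
      rw [hφ.smul_of_nonneg (by positivity), div_mul_cancel₀ _ hpos.ne'])
    rw [crs_add_right, crs_smul_right, crs_conj hd] at hz1
    rw [add_zero] at hz0
    have : 0 < r / φ (conj d) := by positivity
    linarith
  have hcl : IsClosed (erode (H ∩ {x | crs d x ≤ a}) (wb φ r)) :=
    isClosed_erode (hH.isClosed.inter (isClosed_le (continuous_crs d) continuous_const)) _
  have hsub : ∀ S : Set Plane, erode (H ∩ S) (wb φ r) ⊆ erode H (wb φ r) :=
    fun S x hx z hz => (hx z hz).1
  have hfin : volume (erode H (wb φ r)) ≠ ∞ :=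
    ((measure_mono (hφ.erode_wb_subset hr.le)).trans_lt hH.measure_lt_top).ne
  rw [← measureReal_union hdisj hcl.measurableSet
    ((measure_mono (hsub _)).trans_lt hfin.lt_top).ne
    ((measure_mono (hsub _)).trans_lt hfin.lt_top).ne]
  exact measureReal_mono (union_subset (hsub _) (hsub _)) hfin

omit hφ in
lemma not_both_die {α β r w p q s t : ℝ} (hα : 0 < α) (hβ : 0 < β) (hr : 0 < r) (hw : 0 < w)
    (hs : 0 < s) (hsr : s ≤ r) (ht : 0 < t) (htr : t ≤ r) (h1 : α + s ^ 2 * w ≤ s * p)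
    (h2 : β + t ^ 2 * w ≤ t * q) (hm : r ^ 2 * w ≤ α + β)
    (h : r * (p + q) ≤ α + β + r ^ 2 * w) : False := by
  obtain ⟨x, rfl⟩ : ∃ x, s = x * r := ⟨s / r, by field_simp⟩
  obtain ⟨y, rfl⟩ : ∃ y, t = y * r := ⟨t / r, by field_simp⟩
  have hx : 0 < x := pos_of_mul_pos_left hs hr.le
  have hy : 0 < y := pos_of_mul_pos_left ht hr.le
  have hx1 : x ≤ 1 := by nlinarith
  have hy1 : y ≤ 1 := by nlinarith
  have hW : 0 < r ^ 2 * w := by positivity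
  have e1 : α * (2 - x) + x * (r ^ 2 * w) ≤ r * p := by
    refine le_of_mul_le_mul_left ?_ hx
    nlinarith [mul_nonneg hα.le (sq_nonneg (1 - x))]
  have e2 : β * (2 - y) + y * (r ^ 2 * w) ≤ r * q := by
    refine le_of_mul_le_mul_left ?_ hy
    nlinarith [mul_nonneg hβ.le (sq_nonneg (1 - y))]
  have e3 : α * (1 - x) + β * (1 - y) ≤ r ^ 2 * w * (1 - x - y) := by nlinarith
  rcases le_or_gt 1 (x + y) with hxy | hxy
  · have : 0 ≤ α * (1 - x) := mul_nonneg hα.le (by linarith)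
    have : 0 ≤ β * (1 - y) := mul_nonneg hβ.le (by linarith)
    have hz : r ^ 2 * w * (1 - x - y) ≤ 0 := mul_nonpos_of_nonneg_of_nonpos hW.le (by linarith)
    have h3 : α * (1 - x) = 0 := by linarith
    have h4 : β * (1 - y) = 0 := by linarith
    have h5 : x = 1 := by
      rcases mul_eq_zero.mp h3 with h | h <;> linarith
    have h6 : y = 1 := by
      rcases mul_eq_zero.mp h4 with h | h <;> linarith
    subst h5 h6
    linarith
  · have h3 : α * (1 - x - y) < α * (1 - x) := by
      apply mul_lt_mul_of_pos_left _ hα; linarith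
    have h4 : β * (1 - x - y) < β * (1 - y) := by
      apply mul_lt_mul_of_pos_left _ hβ; linarith
    have h5 := mul_le_mul_of_nonneg_right hm (show 0 ≤ 1 - x - y by linarith)
    linarith

theorem projBound_essHull_of_le {E H : Set Plane} (hE : MeasurableSet E)
    (hE0 : volume E ≠ 0) (hH : IsCompact H) (hHc : Convex ℝ H) (hEH : E ⊆ H)
    (hP : anisoPerimeter φ E ≠ ∞) {r : ℝ} (hr : 0 < r)
    (hm : r ^ 2 * volume.real (wb φ 1) ≤ volume.real E)
    (h : r * (anisoPerimeter φ E).toReal ≤ volume.real E + r ^ 2 * volume.real (wb φ 1) -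
      volume.real (erode H (wb φ r))) :
    ProjBound φ (essHull E) (anisoPerimeter φ E).toReal := by
  have hEb := hH.isBounded.subset hEH
  refine hφ.projBound_essHull hE hEb hE0 hP fun d a hd hA0 hB0 hPA hPB hsum => ?_
  have hAm : MeasurableSet (E ∩ {x | a < crs d x}) :=
    hE.inter (measurableSet_lt measurable_const (continuous_crs d).measurable)
  have hBm : MeasurableSet (E ∩ {x | crs d x < a}) :=
    hE.inter (measurableSet_lt (continuous_crs d).measurable measurable_const)
  have hAb := hEb.subset (inter_subset_left (s := E) (t := {x | a < crs d x}))
  have hBb := hEb.subset (inter_subset_left (s := E) (t := {x | crs d x < a}))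
  have hα : 0 < volume.real (E ∩ {x | a < crs d x}) :=
    ENNReal.toReal_pos hA0 hAb.measure_lt_top.ne
  have hβ : 0 < volume.real (E ∩ {x | crs d x < a}) :=
    ENNReal.toReal_pos hB0 hBb.measure_lt_top.ne
  have hw := hφ.volume_wb_pos
  have hcut := volume_real_cut hd hE hEb a
  have hcc := hφ.volume_erode_cut_add_le hd hH a hr
  have hcA : 0 ≤ volume.real (erode (H ∩ {x | a ≤ crs d x}) (wb φ r)) := measureReal_nonneg
  have hcB : 0 ≤ volume.real (erode (H ∩ {x | crs d x ≤ a}) (wb φ r)) := measureReal_nonneg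
  have hconv1 : Convex ℝ {x | a ≤ crs d x} := fun x hx y hy s t hs ht hst => by
    change a ≤ crs d (s • x + t • y)
    rw [crs_add_right, crs_smul_right, crs_smul_right]
    calc a = s * a + t * a := by rw [← add_mul, hst, one_mul]
      _ ≤ s * crs d x + t * crs d y := by gcongr <;> assumption
  have hconv2 : Convex ℝ {x | crs d x ≤ a} := fun x hx y hy s t hs ht hst => by
    change crs d (s • x + t • y) ≤ a
    rw [crs_add_right, crs_smul_right, crs_smul_right]
    calc s * crs d x + t * crs d y ≤ s * a + t * a := by gcongr <;> assumption
      _ = a := by rw [← add_mul, hst, one_mul]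
  have hdA := hφ.erosion_dichotomy (H := H ∩ {x | a ≤ crs d x}) hAm hA0
    (inter_subset_inter hEH fun x (hx : a < crs d x) => hx.le)
    (hH.inter_right (isClosed_le continuous_const (continuous_crs d))) (hHc.inter hconv1)
    (hφ.projBound_anisoPerimeter hAm hAb hPA) hr
  have hdB := hφ.erosion_dichotomy (H := H ∩ {x | crs d x ≤ a}) hBm hB0
    (inter_subset_inter hEH fun x (hx : crs d x < a) => hx.le)
    (hH.inter_right (isClosed_le (continuous_crs d) continuous_const)) (hHc.inter hconv2)
    (hφ.projBound_anisoPerimeter hBm hBb hPB) hr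
  have hrs := mul_le_mul_of_nonneg_left hsum hr.le
  generalize volume.real (E ∩ {x | a < crs d x}) = α at *
  generalize volume.real (E ∩ {x | crs d x < a}) = β at *
  generalize (anisoPerimeter φ (E ∩ {x | a < crs d x})).toReal = p at *
  generalize (anisoPerimeter φ (E ∩ {x | crs d x < a})).toReal = q at *
  have hW : 0 < r ^ 2 * volume.real (wb φ 1) := by positivity
  have one : ∀ {β s q : ℝ}, 0 < β → 0 < s → s ≤ r → r * q ≤ β →
      β + s ^ 2 * volume.real (wb φ 1) ≤ s * q → False := by
    intro β s q hβ hs hsr h1 h2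
    have h3 : s * (r * q) ≤ r * β :=
      (mul_le_mul_of_nonneg_left h1 hs.le).trans (mul_le_mul_of_nonneg_right hsr hβ.le)
    have h4 := mul_le_mul_of_nonneg_left h2 hr.le
    have : 0 < r * (s ^ 2 * volume.real (wb φ 1)) := by positivity
    nlinarith
  rcases hdA with hA | ⟨s, ⟨hs, hsr⟩, hA⟩ <;> rcases hdB with hB | ⟨t, ⟨ht, htr⟩, hB⟩
  · linarith
  · exact one hβ ht htr (by linarith) hB
  · exact one hα hs hsr (by linarith) hA
  · exact not_both_die hα hβ hr hw hs hsr ht htr hA hB (by linarith) (by linarith)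

end IsNorm

/-- The opening of `H` by balls of radius `r`: the union of the closed balls of radius `r`
contained in `H`. -/
def opening (φ : Plane → ℝ) (H : Set Plane) (r : ℝ) : Set Plane := erode H (wb φ r) + wb φ r

lemma opening_subset (φ : Plane → ℝ) (H : Set Plane) (r : ℝ) : opening φ H r ⊆ H := by
  rintro _ ⟨c, hc, z, hz, rfl⟩
  exact hc z hz

namespace IsNorm

variable {φ : Plane → ℝ} (hφ : IsNorm φ)
include hφ

lemma isCompact_erode_wb {H : Set Plane} (hH : IsCompact H) {r : ℝ} (hr : 0 ≤ r) :
    IsCompact (erode H (wb φ r)) :=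
  hH.of_isClosed_subset (isClosed_erode hH.isClosed _) (hφ.erode_wb_subset hr)

lemma isCompact_opening {H : Set Plane} (hH : IsCompact H) {r : ℝ} (hr : 0 ≤ r) :
    IsCompact (opening φ H r) := (hφ.isCompact_erode_wb hH hr).add (hφ.isCompact_wb r)

lemma opening_anti (H : Set Plane) {r s : ℝ} (hr : 0 ≤ r) (hrs : r ≤ s) :
    opening φ H s ⊆ opening φ H r := by
  rintro _ ⟨c, hc, z, hz, rfl⟩
  rcases (hr.trans hrs).eq_or_lt with h0 | hs
  · obtain rfl : r = s := by linarith
    exact ⟨c, hc, z, hz, rfl⟩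
  have hz' : φ z ≤ s := hz
  have h1 : 0 ≤ r / s := by positivity
  have h2 : r / s ≤ 1 := (div_le_one hs).mpr hrs
  refine ⟨c + (1 - r / s) • z, fun y hy => ?_, (r / s) • z, ?_, by
    change c + (1 - r / s) • z + (r / s) • z = c + z; module⟩
  · have hy' : φ y ≤ r := hy
    rw [add_assoc]
    refine hc _ ((hφ.add_le _ _).trans ?_)
    rw [hφ.smul_of_nonneg (by linarith)]
    calc (1 - r / s) * φ z + φ y ≤ (1 - r / s) * s + r := by gcongr
      _ = s := by field_simp; ring
  · change φ _ ≤ r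
    rw [hφ.smul_of_nonneg h1]
    calc r / s * φ z ≤ r / s * s := by gcongr
      _ = r := by field_simp

lemma opening_zero (H : Set Plane) : opening φ H 0 = H := by
  rw [opening, hφ.wb_zero]
  ext x; simp [erode]

lemma erode_nonempty_of_forall_lt {H : Set Plane} (hH : IsCompact H) {r : ℝ} (hr : 0 < r)
    (h : ∀ s, 0 < s → s < r → (erode H (wb φ s)).Nonempty) : (erode H (wb φ r)).Nonempty := by
  rw [← hφ.iInter_erode hH.isClosed hr]
  refine IsCompact.nonempty_iInter_of_sequence_nonempty_isCompact_isClosed _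
    (fun n => erode_wb_anti H (monotone_one_add_inv_mul hr n.le_succ))
    (fun n => h _ (one_add_inv_mul_lt hr n).1 (one_add_inv_mul_lt hr n).2)
    (hφ.isCompact_erode_wb hH (one_add_inv_mul_lt hr 0).1.le)
    fun n => isClosed_erode hH.isClosed _

lemma iInter_opening {H : Set Plane} (hH : IsCompact H) {r : ℝ} (hr : 0 < r) :
    ⋂ n : ℕ, opening φ H ((1 + 1 / ((n : ℝ) + 1))⁻¹ * r) = opening φ H r := by
  refine Subset.antisymm (fun x hx => ?_) (subset_iInter fun n =>
    hφ.opening_anti H (one_add_inv_mul_lt hr n).1.le (one_add_inv_mul_lt hr n).2.le)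
  rw [mem_iInter] at hx
  have hcl : IsClosed {c | φ (x - c) ≤ r} :=
    isClosed_le (hφ.continuous.comp (by fun_prop)) continuous_const
  obtain ⟨c, hc⟩ := IsCompact.nonempty_iInter_of_sequence_nonempty_isCompact_isClosed
    (fun n : ℕ => erode H (wb φ ((1 + 1 / ((n : ℝ) + 1))⁻¹ * r)) ∩ {c | φ (x - c) ≤ r})
    (fun n => inter_subset_inter_left _
      (erode_wb_anti H (monotone_one_add_inv_mul hr n.le_succ)))
    (fun n => by
      obtain ⟨c, hc, z, hz, rfl⟩ := hx n
      refine ⟨c, hc, ?_⟩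
      change φ (c + z - c) ≤ r
      rw [add_sub_cancel_left]
      exact le_trans hz (one_add_inv_mul_lt hr n).2.le)
    ((hφ.isCompact_erode_wb hH (one_add_inv_mul_lt hr 0).1.le).inter_right hcl)
    fun n => (isClosed_erode hH.isClosed _).inter hcl
  rw [mem_iInter] at hc
  refine ⟨c, ?_, x - c, (hc 0).2, by simp⟩
  rw [← hφ.iInter_erode hH.isClosed hr, mem_iInter]
  exact fun n => (hc n).1

lemma le_volume_opening_of_forall_lt {H : Set Plane} (hH : IsCompact H) {r m : ℝ} (hr : 0 < r)
    (h : ∀ s, 0 < s → s < r → m ≤ volume.real (opening φ H s)) :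
    m ≤ volume.real (opening φ H r) := by
  have hanti : Antitone fun n : ℕ => opening φ H ((1 + 1 / ((n : ℝ) + 1))⁻¹ * r) :=
    fun n k hnk => hφ.opening_anti H (one_add_inv_mul_lt hr n).1.le
      (monotone_one_add_inv_mul hr hnk)
  have htop : ∀ s : ℝ, 0 ≤ s → volume (opening φ H s) ≠ ∞ := fun s hs =>
    (hφ.isCompact_opening hH hs).measure_lt_top.ne
  have := tendsto_measure_iInter_atTop (μ := volume)
    (fun n => (hφ.isCompact_opening hH (one_add_inv_mul_lt hr n).1.le).isClosed.nullMeasurableSet)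
    hanti ⟨0, htop _ (one_add_inv_mul_lt hr 0).1.le⟩
  rw [hφ.iInter_opening hH hr] at this
  exact ge_of_tendsto ((ENNReal.tendsto_toReal (htop r hr.le)).comp this)
    (Eventually.of_forall fun n => h _ (one_add_inv_mul_lt hr n).1 (one_add_inv_mul_lt hr n).2)

lemma mul_volume_opening_le {H : Set Plane} (hH : IsCompact H) (hHc : Convex ℝ H) {r R t : ℝ}
    (hr : 0 ≤ r) (hR : 0 ≤ R) (hR0 : (erode H (wb φ R)).Nonempty) (ht0 : 0 ≤ t) (ht1 : t ≤ 1) :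
    (1 - t) ^ 2 * volume.real (opening φ H r) ≤
      volume.real (opening φ H ((1 - t) * r + t * R)) := by
  obtain ⟨x, hx⟩ := hR0
  have ht : 0 ≤ 1 - t := by linarith
  have hpos : 0 ≤ (1 - t) * r + t * R := by positivity
  have hsub : (fun y => t • x + y) '' ((1 - t) • opening φ H r) ⊆
      opening φ H ((1 - t) * r + t * R) := by
    rintro _ ⟨_, ⟨_, ⟨c, hc, z, hz, rfl⟩, rfl⟩, rfl⟩
    have hz' : φ z ≤ r := hz
    refine ⟨t • x + (1 - t) • c, fun y hy => ?_, (1 - t) • z, ?_, by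
      change t • x + (1 - t) • c + (1 - t) • z = t • x + (1 - t) • (c + z); module⟩
    · rcases hpos.eq_or_lt with h0 | h0
      · rw [← h0, hφ.wb_zero] at hy
        obtain rfl : y = 0 := hy
        have h1 := hx 0 (hφ.zero_mem_wb hR)
        have h2 := hc 0 (hφ.zero_mem_wb hr)
        rw [add_zero] at h1 h2 ⊢
        exact hHc h1 h2 ht0 ht (by ring)
      · have hy' : φ y ≤ (1 - t) * r + t * R := hy
        set P := (1 - t) * r + t * R
        have key : ∀ s, 0 ≤ s → (s / P) • y ∈ wb φ s := fun s hs => by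
          change φ _ ≤ s
          rw [hφ.smul_of_nonneg (by positivity)]
          calc s / P * φ y ≤ s / P * P := by gcongr
            _ = s := by field_simp
        have h1 := hx _ (key R hR)
        have h2 := hc _ (key r hr)
        have h3 := hHc h1 h2 ht0 ht (by ring)
        convert h3 using 1
        have e : y = ((1 - t) * (r / P) + t * (R / P)) • y := by
          have : (1 - t) * (r / P) + t * (R / P) = 1 := by
            rw [← mul_div_assoc, ← mul_div_assoc, ← add_div, div_self h0.ne']
          rw [this, one_smul]
        nth_rewrite 1 [e]
        module
    · change φ _ ≤ _
      rw [hφ.smul_of_nonneg ht]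
      have : 0 ≤ t * R := by positivity
      nlinarith
  have := measureReal_mono (μ := volume) hsub (hφ.isCompact_opening hH hpos).measure_lt_top.ne
  rwa [measureReal_def, image_add_left, measure_preimage_add, ← measureReal_def,
    volume_real_smul ht] at this

lemma volume_opening {H : Set Plane} (hH : IsCompact H) (hHc : Convex ℝ H) {r : ℝ} (hr : 0 ≤ r)
    (h0 : (erode H (wb φ r)).Nonempty) : volume.real (opening φ H r) =
      volume.real (erode H (wb φ r)) + r * mixed φ (erode H (wb φ r)) +
        r ^ 2 * volume.real (wb φ 1) :=
  hφ.volume_add_wb (hφ.isCompact_erode_wb hH hr) h0 (convex_erode hHc _) hr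

/-- The largest radius of a ball contained in a convex body. -/
lemma exists_inradius {H : Set Plane} (hH : IsCompact H) (hHc : Convex ℝ H)
    (hH0 : volume H ≠ 0) : ∃ R : ℝ, 0 < R ∧ (erode H (wb φ R)).Nonempty ∧
      volume (erode H (wb φ R)) = 0 ∧ ∀ r, 0 ≤ r → r < R → 0 < volume.real (erode H (wb φ r)) := by
  have hball : ∀ S : Set Plane, Convex ℝ S → volume S ≠ 0 →
      ∃ ε, 0 < ε ∧ (erode S (wb φ ε)).Nonempty := by
    intro S hS hS0
    have hInt : (interior S).Nonempty := by
      by_contra hne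
      rw [not_nonempty_iff_eq_empty] at hne
      have h := hS.addHaar_frontier volume
      rw [frontier, hne, sdiff_empty] at h
      exact hS0 (measure_mono_null subset_closure h)
    obtain ⟨x, hx⟩ := hInt
    obtain ⟨δ, hδ, hδS⟩ := Metric.isOpen_iff.mp isOpen_interior x hx
    obtain ⟨c, hc, hcφ⟩ := hφ.exists_mul_norm_le
    refine ⟨c * δ / 2, by positivity, x, fun z hz => interior_subset (hδS ?_)⟩
    have hz' : φ z ≤ c * δ / 2 := hz
    have h1 := hcφ z
    rw [Metric.mem_ball, dist_eq_norm, add_sub_cancel_left]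
    have : c * ‖z‖ < c * δ := by nlinarith [mul_pos hc hδ]
    exact lt_of_mul_lt_mul_left this hc.le
  have hw := hφ.volume_wb_pos
  set S := {r : ℝ | 0 < r ∧ (erode H (wb φ r)).Nonempty}
  have hS0 : S.Nonempty := hball H hHc hH0
  have hSb : BddAbove S := by
    obtain ⟨N, hN⟩ := (((tendsto_pow_atTop (α := ℝ) two_ne_zero).atTop_mul_const
      hw).eventually_gt_atTop (volume.real H)).and (eventually_ge_atTop 0) |>.exists
    refine ⟨N, fun r ⟨hr, hne⟩ => ?_⟩
    by_contra! hlt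
    have := hφ.volume_erode_eq_zero hH hN.2 hN.1
    exact (this ▸ hne.mono (erode_wb_anti H hlt.le)).ne_empty rfl
  have hmem : ∀ r, r < sSup S → (erode H (wb φ r)).Nonempty := by
    intro r hr
    obtain ⟨s, hs, hrs⟩ := exists_lt_of_lt_csSup hS0 hr
    exact hs.2.mono (erode_wb_anti H hrs.le)
  have hR : 0 < sSup S := by
    obtain ⟨s, hs⟩ := hS0
    exact hs.1.trans_le (le_csSup hSb hs)
  have hRne := hφ.erode_nonempty_of_forall_lt hH hR fun s _ hs => hmem s hs
  refine ⟨sSup S, hR, hRne, ?_, fun r hr0 hr => ?_⟩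
  · by_contra hne
    obtain ⟨ε, hε, x, hx⟩ := hball _ (convex_erode hHc _) hne
    have : sSup S + ε ∈ S := by
      refine ⟨by positivity, x, fun z hz => ?_⟩
      rw [← hφ.wb_add hR.le hε.le] at hz
      obtain ⟨a, ha, b, hb, rfl⟩ := hz
      have := hx b hb a ha
      rwa [add_assoc, add_comm b a] at this
    linarith [le_csSup hSb this]
  · obtain ⟨x, hx⟩ := hRne
    have hsub : (fun z => x + z) '' wb φ (sSup S - r) ⊆ erode H (wb φ r) := by
      rintro _ ⟨z, hz, rfl⟩ y hy
      have hz' : φ z ≤ _ := hz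
      have hy' : φ y ≤ _ := hy
      rw [add_assoc]
      exact hx _ ((hφ.add_le _ _).trans (by linarith))
    have := measureReal_mono (μ := volume) hsub
      (hφ.isCompact_erode_wb hH hr0).measure_lt_top.ne
    rw [measureReal_def, image_add_left, measure_preimage_add, ← measureReal_def,
      hφ.volume_wb (by linarith)] at this
    have h2 : 0 < (sSup S - r) ^ 2 * volume.real (wb φ 1) :=
      mul_pos (pow_pos (by linarith) 2) hw
    linarith

end IsNorm

lemma volume_real_le_essHull {E : Set Plane} (hEb : Bornology.IsBounded E) :
    volume.real E ≤ volume.real (essHull E) := by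
  refine ENNReal.toReal_mono (isCompact_essHull hEb).measure_lt_top.ne ?_
  exact measure_mono_ae (ae_le_set.mpr volume_diff_essHull)

lemma ae_eq_of_volume_essHull_le {E U : Set Plane} (hE : MeasurableSet E)
    (hEb : Bornology.IsBounded E) (hU : MeasurableSet U)
    (h : volume.real (essHull E) ≤ volume.real E) (hUK : U ⊆ essHull E)
    (hEU : volume.real E ≤ volume.real U) : E =ᵐ[volume] U := by
  have hK := isCompact_essHull hEb
  have hKfin : volume (essHull E) ≠ ∞ := hK.measure_lt_top.ne
  have hUfin : volume U ≠ ∞ := ((measure_mono hUK).trans_lt hK.measure_lt_top).ne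
  have h1 : E =ᵐ[volume] essHull E :=
    ae_eq_of_ae_subset_of_measure_ge (ae_le_set.mpr volume_diff_essHull)
      ((ENNReal.toReal_le_toReal hKfin hEb.measure_lt_top.ne).mp h) hE.nullMeasurableSet hKfin
  have h2 : U =ᵐ[volume] essHull E :=
    ae_eq_of_subset_of_measure_ge hUK
      ((ENNReal.toReal_le_toReal hKfin hUfin).mp (h.trans hEU)) hU.nullMeasurableSet hKfin
  exact h1.trans h2.symm

lemma subset_of_volume_le {D C : Set Plane} (hC : IsCompact C) (hCc : Convex ℝ C)
    (hC0 : volume C ≠ 0) (hD : IsClosed D) (hDC : D ⊆ C)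
    (h : volume.real C ≤ volume.real D) : C ⊆ D := by
  have hDfin : volume D ≠ ∞ := ((measure_mono hDC).trans_lt hC.measure_lt_top).ne
  have hInt : (interior C).Nonempty := by
    by_contra hne
    rw [not_nonempty_iff_eq_empty] at hne
    have h := hCc.addHaar_frontier volume
    rw [frontier, hne, sdiff_empty] at h
    exact hC0 (measure_mono_null subset_closure h)
  have hae : D =ᵐ[volume] C := ae_eq_of_subset_of_measure_ge hDC
    ((ENNReal.toReal_le_toReal hC.measure_lt_top.ne hDfin).mp h)
    hD.measurableSet.nullMeasurableSet hC.measure_lt_top.ne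
  have h0 : volume (C \ D) = 0 := (ae_le_set.mp hae.symm.le)
  have hsub : interior C ⊆ D := by
    have hopen : IsOpen (interior C \ D) := isOpen_interior.sdiff hD
    have : interior C \ D = ∅ :=
      (hopen.measure_eq_zero_iff volume).mp
        (measure_mono_null (sdiff_subset_sdiff_left interior_subset) h0)
    exact sdiff_eq_empty.mp this
  calc C ⊆ closure C := subset_closure
    _ = closure (interior C) := (hCc.closure_interior_eq_closure_of_nonempty_interior hInt).symm
    _ ⊆ D := closure_minimal hsub hD

namespace IsNorm

variable {φ : Plane → ℝ} (hφ : IsNorm φ)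
include hφ

omit hφ in
lemma fatten_subset_of_subset_erode {Ω C : Set Plane} (hΩ : IsOpen Ω) (hΩc : Convex ℝ Ω)
    {r : ℝ} (h : C ⊆ erode (closure Ω) (wb φ r))
    (hopen : IsOpen (fatten φ C r)) : fatten φ C r ⊆ Ω := by
  have hsub : fatten φ C r ⊆ closure Ω := by
    refine (fatten_subset_add C r).trans ?_
    rintro _ ⟨c, hc, z, hz, rfl⟩
    exact h hc z hz
  rcases Ω.eq_empty_or_nonempty with rfl | hne
  · simpa using hsub
  have := interior_maximal hsub hopen
  rwa [hΩc.interior_closure_eq_interior_of_nonempty_interior (by rwa [hΩ.interior_eq]),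
    hΩ.interior_eq] at this

lemma volume_fatten_eq {C : Set Plane} (hC : IsCompact C) (hC0 : C.Nonempty) (hCc : Convex ℝ C)
    {r : ℝ} (hr : 0 < r) : volume.real (fatten φ C r) = volume.real (C + wb φ r) := by
  rw [hφ.volume_fatten hC hC0 hCc hr, hφ.volume_add_wb hC hC0 hCc hr.le]

lemma mixed_singleton (x : Plane) : mixed φ {x} = 0 := by
  have h := hφ.mixed_smul_translate isCompact_singleton (singleton_nonempty (0 : Plane))
    (convex_singleton 0) (c := 0) le_rfl x
  simpa using h

lemma anisoPerimeter_le_of_minimizer {Ω E C : Set Plane} (hΩ : IsOpen Ω) (hΩc : Convex ℝ Ω)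
    {m : ℝ} (hE : IsIsopMinimizer φ Ω m E) (hC : IsCompact C) (hC0 : C.Nonempty)
    (hCc : Convex ℝ C) {r : ℝ} (hr : 0 < r) (h : C ⊆ erode (closure Ω) (wb φ r))
    (hm : volume.real C + r * mixed φ C + r ^ 2 * volume.real (wb φ 1) = m) :
    anisoPerimeter φ E ≠ ∞ ∧
      (anisoPerimeter φ E).toReal ≤ mixed φ C + 2 * r * volume.real (wb φ 1) := by
  have hopen := hφ.isOpen_fatten C r
  have h1 := hE.2.2.2 _ hopen.measurableSet (fatten_subset_of_subset_erode hΩ hΩc h hopen)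
    ((hφ.volume_fatten hC hC0 hCc hr).trans hm)
  have h2 := h1.trans (hφ.anisoPerimeter_fatten_le hC hC0 hCc hr)
  have hnn : 0 ≤ mixed φ C + 2 * r * volume.real (wb φ 1) := by
    have := hφ.mixed_nonneg hC hC0 hCc
    have := hφ.volume_wb_pos
    positivity
  refine ⟨(h2.trans_lt ENNReal.ofReal_lt_top).ne, ?_⟩
  have := ENNReal.toReal_mono ENNReal.ofReal_ne_top h2
  rwa [ENNReal.toReal_ofReal hnn] at this

omit hφ in
lemma false_of_mul_le {K m P r s w : ℝ} (hw : 0 < w) (hs : 0 < s) (hsr : s < r)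
    (hm : r ^ 2 * w ≤ m) (hKm : m ≤ K) (hP : r * P ≤ m + r ^ 2 * w)
    (h : K + s ^ 2 * w ≤ s * P) : False := by
  have hr : 0 < r := hs.trans hsr
  have h1 := mul_le_mul_of_nonneg_left h hr.le
  have h2 := mul_le_mul_of_nonneg_left hP hs.le
  have h3 := mul_le_mul_of_nonneg_left hKm hr.le
  have h4 : 0 < (r - s) * r * w := by
    have : 0 < r - s := by linarith
    positivity
  have h5 := mul_le_mul_of_nonneg_left hm (show 0 ≤ r - s by linarith)
  have h6 : 0 < (r - s) ^ 2 * w * r := by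
    have : 0 < r - s := by linarith
    positivity
  nlinarith

lemma volume_essHull_le {E H : Set Plane} (hEH : E ⊆ H) (hH : IsCompact H) (hHc : Convex ℝ H)
    (hE0 : volume E ≠ 0) {P : ℝ} (hK : ProjBound φ (essHull E) P) {r : ℝ} (hr : 0 < r)
    (hm : r ^ 2 * volume.real (wb φ 1) ≤ volume.real E)
    (h : r * P ≤ volume.real E + r ^ 2 * volume.real (wb φ 1) -
      volume.real (erode H (wb φ r))) :
    volume.real (essHull E) ≤ volume.real E := by
  have hEb := hH.isBounded.subset hEH
  have hle := volume_real_le_essHull hEb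
  have hc : 0 ≤ volume.real (erode H (wb φ r)) := measureReal_nonneg
  have hKc := isCompact_essHull hEb
  have hK0 : volume (essHull E) ≠ 0 := fun h0 => by
    have := ENNReal.toReal_pos hE0 hEb.measure_lt_top.ne
    simp [measureReal_def, h0] at hle
    linarith
  have hKH : essHull E ⊆ H := essHull_subset hH.isClosed hHc
    (by rw [sdiff_eq_empty.mpr hEH, measure_empty])
  rcases hφ.erosion_dichotomy hKc.isClosed.measurableSet hK0 hKH hH hHc hK hr with
    h1 | ⟨s, ⟨hs, hsr⟩, h1⟩
  · linarith
  · rcases hsr.eq_or_lt with rfl | hsr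
    · linarith
    · exact (false_of_mul_le hφ.volume_wb_pos hs hsr hm hle (by linarith) h1).elim

/-- The intermediate radius at which the openings of a convex body have prescribed area. -/
lemma exists_opening_radius {H : Set Plane} (hH : IsCompact H) (hHc : Convex ℝ H) {R m : ℝ}
    (hR : 0 < R) (hR0 : (erode H (wb φ R)).Nonempty) (hm : m < volume.real H) :
    ∃ r, 0 < r ∧ r ≤ R ∧ m ≤ volume.real (opening φ H r) ∧
      (r < R → volume.real (opening φ H r) = m) := by
  set S := {r : ℝ | 0 ≤ r ∧ r ≤ R ∧ m ≤ volume.real (opening φ H r)}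
  have hSb : BddAbove S := ⟨R, fun r hr => hr.2.1⟩
  have hlim : Tendsto (fun t : ℝ => (1 - t) ^ 2 * volume.real H) (𝓝[>] 0) (𝓝 (volume.real H)) := by
    have : Continuous fun t : ℝ => (1 - t) ^ 2 * volume.real H := by fun_prop
    have h := this.tendsto 0
    simp only [sub_zero, one_pow, one_mul] at h
    exact h.mono_left nhdsWithin_le_nhds
  obtain ⟨t, ht, ht0, ht1⟩ := ((hlim.eventually_const_lt hm).and
    (Ioc_mem_nhdsGT (zero_lt_one' ℝ))).exists
  have h1 := hφ.mul_volume_opening_le hH hHc le_rfl hR.le hR0 ht0.le ht1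
  rw [hφ.opening_zero] at h1
  have htS : (1 - t) * 0 + t * R ∈ S :=
    ⟨by positivity, by nlinarith, ht.le.trans h1⟩
  have hr : 0 < sSup S :=
    lt_of_lt_of_le (by positivity : 0 < (1 - t) * 0 + t * R) (le_csSup hSb htS)
  have hrR : sSup S ≤ R := csSup_le ⟨_, htS⟩ fun r hr => hr.2.1
  have hmr : m ≤ volume.real (opening φ H (sSup S)) := by
    refine hφ.le_volume_opening_of_forall_lt hH hr fun s hs hsr => ?_
    obtain ⟨u, hu, hsu⟩ := exists_lt_of_lt_csSup ⟨_, htS⟩ hsr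
    exact hu.2.2.trans (measureReal_mono (hφ.opening_anti H hs.le hsu.le)
      (hφ.isCompact_opening hH hs.le).measure_lt_top.ne)
  refine ⟨sSup S, hr, hrR, hmr, fun hlt => le_antisymm ?_ hmr⟩
  have hlim : Tendsto (fun t : ℝ => (1 - t) ^ 2 * volume.real (opening φ H (sSup S))) (𝓝[>] 0)
      (𝓝 (volume.real (opening φ H (sSup S)))) := by
    have : Continuous fun t : ℝ => (1 - t) ^ 2 * volume.real (opening φ H (sSup S)) := by fun_prop
    have h := this.tendsto 0
    simp only [sub_zero, one_pow, one_mul] at h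
    exact h.mono_left nhdsWithin_le_nhds
  refine le_of_tendsto hlim ?_
  filter_upwards [Ioc_mem_nhdsGT (zero_lt_one' ℝ)] with t ht
  refine (hφ.mul_volume_opening_le hH hHc hr.le hR.le hR0 ht.1.le ht.2).trans ?_
  by_contra! hcon
  have hmem : (1 - t) * sSup S + t * R ∈ S :=
    ⟨by nlinarith [ht.1, ht.2], by nlinarith [ht.1, ht.2], hcon.le⟩
  nlinarith [le_csSup hSb hmem, ht.1]

/-- Below the area of the largest inscribed ball, minimizers are balls. -/
lemma exists_eq_ball {E : Set Plane} (hE : MeasurableSet E) (hEb : Bornology.IsBounded E)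
    (hE0 : volume E ≠ 0) (hP : anisoPerimeter φ E ≠ ∞) {r : ℝ} (hr : 0 < r)
    (hm : volume.real E = r ^ 2 * volume.real (wb φ 1))
    (h : (anisoPerimeter φ E).toReal ≤ 2 * r * volume.real (wb φ 1)) :
    ∃ x, E =ᵐ[volume] fatten φ {x} r ∧ {x} + wb φ r ⊆ essHull E := by
  have hw := hφ.volume_wb_pos
  set w := volume.real (wb φ 1)
  set P := (anisoPerimeter φ E).toReal
  set K := essHull E
  have hP0 : 0 ≤ P := ENNReal.toReal_nonneg
  have hKP : ProjBound φ K P := by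
    refine hφ.projBound_essHull_of_sq_le hE hEb hE0 hP ?_
    rw [hm]
    nlinarith [pow_le_pow_left₀ hP0 h 2]
  have hK : IsCompact K := isCompact_essHull hEb
  have hKc : Convex ℝ K := convex_essHull E
  have hle : volume.real E ≤ volume.real K := volume_real_le_essHull hEb
  have hK0 : volume K ≠ 0 := fun h0 => by
    have := ENNReal.toReal_pos hE0 hEb.measure_lt_top.ne
    simp [measureReal_def, h0] at hle
    linarith
  have hKm : volume.real K ≤ volume.real E := by
    have h1 := (hφ.four_mul_le_sq_of_projBound hK.isClosed.measurableSet hK0 hK.isBounded hKP).2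
    have h2 : w * volume.real K ≤ w * volume.real E := by
      rw [hm]
      nlinarith [pow_le_pow_left₀ hP0 h 2]
    exact le_of_mul_le_mul_left h2 hw
  obtain ⟨x, hx⟩ := hφ.erode_nonempty_of_forall_lt hK hr fun s hs hsr => by
    rcases hφ.erosion_dichotomy hK.isClosed.measurableSet hK0 Subset.rfl hK hKc hKP hs with
      h1 | ⟨t, ⟨ht, hts⟩, h1⟩
    · have h2 := mul_le_mul_of_nonneg_left h hs.le
      have h3 : 0 < (r - s) ^ 2 * w := mul_pos (pow_pos (by linarith) 2) hw
      have h4 : 0 < volume.real (erode K (wb φ s)) := by nlinarith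
      refine nonempty_of_measure_ne_zero (μ := volume) fun h0 => ?_
      simp [measureReal_def, h0] at h4
    · have h2 := mul_le_mul_of_nonneg_left h ht.le
      have h3 : 0 < (r - t) ^ 2 * w := mul_pos (pow_pos (by linarith) 2) hw
      nlinarith
  have hsub : {x} + wb φ r ⊆ K := by
    rintro _ ⟨_, rfl, z, hz, rfl⟩
    exact hx z hz
  refine ⟨x, ?_, hsub⟩
  refine ae_eq_of_volume_essHull_le hE hEb (hφ.isOpen_fatten _ r).measurableSet hKm
    ((fatten_subset_add _ r).trans hsub) ?_
  rw [hφ.volume_fatten isCompact_singleton (singleton_nonempty x) (convex_singleton x) hr,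
    hφ.mixed_singleton, hm, mul_zero, add_zero]
  simp [measureReal_def, w]

/-- The case in which the set of centres has positive area. -/
lemma ae_eq_fatten_of_volume_pos {E H : Set Plane} (hE : MeasurableSet E) (hEH : E ⊆ H)
    (hE0 : volume E ≠ 0) (hH : IsCompact H) (hHc : Convex ℝ H)
    (hP : anisoPerimeter φ E ≠ ∞) {r : ℝ} (hr : 0 < r)
    (hm : r ^ 2 * volume.real (wb φ 1) ≤ volume.real E)
    (hC : 0 < volume.real (erode H (wb φ r)))
    (hV : volume.real (opening φ H r) = volume.real E)
    (h : (anisoPerimeter φ E).toReal ≤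
      mixed φ (erode H (wb φ r)) + 2 * r * volume.real (wb φ 1)) :
    E =ᵐ[volume] fatten φ (erode H (wb φ r)) r := by
  have hw := hφ.volume_wb_pos
  have hEb := hH.isBounded.subset hEH
  have hCc := hφ.isCompact_erode_wb hH hr.le
  have hCv := convex_erode hHc (wb φ r)
  have hCn : volume (erode H (wb φ r)) ≠ 0 := fun h0 => by simp [measureReal_def, h0] at hC
  have hC0 : (erode H (wb φ r)).Nonempty := nonempty_of_measure_ne_zero hCn
  have hV' := hφ.volume_opening hH hHc hr.le hC0
  have hrP : r * (anisoPerimeter φ E).toReal ≤ volume.real E + r ^ 2 * volume.real (wb φ 1) -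
      volume.real (erode H (wb φ r)) := by
    have := mul_le_mul_of_nonneg_left h hr.le
    nlinarith
  have hKP := hφ.projBound_essHull_of_le hE hE0 hH hHc hEH hP hr hm hrP
  have hKm := hφ.volume_essHull_le hEH hH hHc hE0 hKP hr hm hrP
  have hle := volume_real_le_essHull hEb
  have hK := isCompact_essHull hEb
  have hKc := convex_essHull E
  have hK0 : volume (essHull E) ≠ 0 := fun h0 => by
    have h1 : volume.real (essHull E) = 0 := by rw [measureReal_def, h0, ENNReal.toReal_zero]
    have h2 : 0 < volume.real E := ENNReal.toReal_pos hE0 hEb.measure_lt_top.ne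
    linarith
  have hKH : essHull E ⊆ H := essHull_subset hH.isClosed hHc
    (by rw [sdiff_eq_empty.mpr hEH, measure_empty])
  have hD : volume.real (erode H (wb φ r)) ≤ volume.real (erode (essHull E) (wb φ r)) := by
    rcases hφ.erosion_dichotomy hK.isClosed.measurableSet hK0 Subset.rfl hK hKc hKP hr with
      h1 | ⟨t, ⟨ht, htr⟩, h1⟩
    · linarith
    · exfalso
      rcases htr.eq_or_lt with rfl | htr
      · linarith
      · exact false_of_mul_le hw ht htr hm hle (by linarith) h1
  have hsub := subset_of_volume_le hCc hCv hCn (isClosed_erode hK.isClosed (wb φ r))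
    (fun x hx z hz => hKH (hx z hz)) hD
  refine ae_eq_of_volume_essHull_le hE hEb (hφ.isOpen_fatten _ r).measurableSet hKm ?_ ?_
  · refine (fatten_subset_add _ r).trans ?_
    rintro _ ⟨c, hc, z, hz, rfl⟩
    exact hsub hc z hz
  · rw [hφ.volume_fatten_eq hCc hC0 hCv hr]
    exact hV.ge

omit hφ in
lemma add_le_mul_of_le_sq {D M s t w : ℝ} (ht : 0 < s) (hst : s ≤ t)
    (hw : 0 < w) (hD : t ^ 2 * w ≤ D) (h : D + s ^ 2 * w ≤ s * M) : D + t ^ 2 * w ≤ t * M := by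
  have ht' : 0 ≤ t := ht.le.trans hst
  have h1 := mul_le_mul_of_nonneg_left h ht'
  have h2 : 0 ≤ (t - s) * (D - s * t * w) := by
    refine mul_nonneg (by linarith) ?_
    have : s * t * w ≤ t ^ 2 * w := by rw [pow_two]; gcongr
    linarith
  refine le_of_mul_le_mul_left ?_ ht
  nlinarith

/-- The case in which the radius is the inradius. -/
lemma exists_eq_fatten_of_volume_eq_zero {E H : Set Plane} (hE : MeasurableSet E) (hEH : E ⊆ H)
    (hE0 : volume E ≠ 0) (hH : IsCompact H) (hHc : Convex ℝ H)
    (hP : anisoPerimeter φ E ≠ ∞) {r : ℝ} (hr : 0 < r)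
    (hm : r ^ 2 * volume.real (wb φ 1) ≤ volume.real E)
    (hC : volume (erode H (wb φ r)) = 0)
    (h : r * (anisoPerimeter φ E).toReal ≤ volume.real E + r ^ 2 * volume.real (wb φ 1)) :
    ∃ C ⊆ erode H (wb φ r), IsCompact C ∧ C.Nonempty ∧ Convex ℝ C ∧
      E =ᵐ[volume] fatten φ C r := by
  have hw := hφ.volume_wb_pos
  have hEb := hH.isBounded.subset hEH
  have hC' : volume.real (erode H (wb φ r)) = 0 := by simp [measureReal_def, hC]
  have hrP : r * (anisoPerimeter φ E).toReal ≤ volume.real E + r ^ 2 * volume.real (wb φ 1) -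
      volume.real (erode H (wb φ r)) := by linarith
  have hKP := hφ.projBound_essHull_of_le hE hE0 hH hHc hEH hP hr hm hrP
  have hKm := hφ.volume_essHull_le hEH hH hHc hE0 hKP hr hm hrP
  have hle := volume_real_le_essHull hEb
  have hEpos : 0 < volume.real E := ENNReal.toReal_pos hE0 hEb.measure_lt_top.ne
  have hK := isCompact_essHull hEb
  have hKc := convex_essHull E
  have hK0 : volume (essHull E) ≠ 0 := fun h0 => by
    have h1 : volume.real (essHull E) = 0 := by rw [measureReal_def, h0, ENNReal.toReal_zero]
    linarith
  have hKH : essHull E ⊆ H := essHull_subset hH.isClosed hHc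
    (by rw [sdiff_eq_empty.mpr hEH, measure_empty])
  have hCKsub : erode (essHull E) (wb φ r) ⊆ erode H (wb φ r) := fun x hx z hz => hKH (hx z hz)
  have hopen : volume.real E ≤ volume.real (opening φ (essHull E) r) := by
    refine hφ.le_volume_opening_of_forall_lt hK hr fun ρ hρ hρr => ?_
    obtain ⟨t, rfl⟩ : ∃ t, r = ρ + t := ⟨r - ρ, by ring⟩
    have ht : 0 < t := by linarith
    have hD : volume.real E + ρ ^ 2 * volume.real (wb φ 1) ≤
        volume.real (erode (essHull E) (wb φ ρ)) + ρ * (anisoPerimeter φ E).toReal := by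
      rcases hφ.erosion_dichotomy hK.isClosed.measurableSet hK0 Subset.rfl hK hKc hKP hρ with
        h1 | ⟨s, ⟨hs, hsr⟩, h1⟩
      · linarith
      · exact (false_of_mul_le hw hs (hsr.trans_lt hρr) hm hle (by linarith) h1).elim
    set D := erode (essHull E) (wb φ ρ) with hDdef
    have hDK : IsCompact D := hφ.isCompact_erode_wb hK hρ.le
    have hDc : Convex ℝ D := convex_erode hKc _
    have hDE : t * volume.real E ≤
        (ρ + t) * volume.real D + ρ * t * (ρ + t) * volume.real (wb φ 1) := by
      have h1 := mul_le_mul_of_nonneg_left hD hr.le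
      have h2 := mul_le_mul_of_nonneg_left h hρ.le
      nlinarith
    have hDt : t ^ 2 * volume.real (wb φ 1) ≤ volume.real D := by
      refine le_of_mul_le_mul_left ?_ hr
      have := mul_le_mul_of_nonneg_left hm ht.le
      nlinarith
    have hDpos : 0 < volume.real D := lt_of_lt_of_le (by positivity) hDt
    have hDn : volume D ≠ 0 := fun h0 => by simp [measureReal_def, h0] at hDpos
    have hD0 : D.Nonempty := nonempty_of_measure_ne_zero hDn
    have hDsub : erode D (wb φ t) ⊆ erode H (wb φ (ρ + t)) := by
      intro x hx z hz
      rw [← hφ.wb_add hρ.le ht.le] at hz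
      obtain ⟨a, ha, b, hb, rfl⟩ := hz
      have := hx b hb a ha
      rw [add_assoc, add_comm b a] at this
      exact hKH this
    have hDz : volume.real (erode D (wb φ t)) = 0 := by
      simp [measureReal_def, measure_mono_null hDsub hC]
    have hM : volume.real D + t ^ 2 * volume.real (wb φ 1) ≤ t * mixed φ D := by
      rcases hφ.erosion_dichotomy hDK.isClosed.measurableSet hDn Subset.rfl hDK hDc
        (hφ.projBound_mixed hDK hD0 hDc) ht with h1 | ⟨s, ⟨hs, hsr⟩, h1⟩
      · linarith
      · exact add_le_mul_of_le_sq hs hsr hw hDt h1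
    rw [hφ.volume_opening hK hKc hρ.le hD0, ← hDdef]
    refine le_of_mul_le_mul_left ?_ ht
    have := mul_le_mul_of_nonneg_left hM hρ.le
    nlinarith
  have hne : (erode (essHull E) (wb φ r)).Nonempty := by
    have : 0 < volume.real (opening φ (essHull E) r) := hEpos.trans_le hopen
    by_contra hne
    rw [not_nonempty_iff_eq_empty] at hne
    simp [opening, hne, measureReal_def] at this
  have hcomp := hφ.isCompact_erode_wb hK hr.le
  have hconv := convex_erode hKc (wb φ r)
  refine ⟨_, hCKsub, hcomp, hne, hconv, ?_⟩
  refine ae_eq_of_volume_essHull_le hE hEb (hφ.isOpen_fatten _ r).measurableSet hKm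
    ((fatten_subset_add _ r).trans (opening_subset φ _ r)) ?_
  rwa [hφ.volume_fatten_eq hcomp hne hconv hr]

/-- Minimizers are, up to null sets, unions of translates of a Wulff ball. -/
theorem exists_eq_fatten {Ω E : Set Plane} (hΩ : IsOpen Ω) (hΩb : Bornology.IsBounded Ω)
    (hΩc : Convex ℝ Ω) {m : ℝ} (hm0 : 0 < m) (hm1 : m < (volume Ω).toReal)
    (hE : IsIsopMinimizer φ Ω m E) :
    ∃ (r : ℝ) (C : Set Plane), 0 < r ∧ IsCompact C ∧ C.Nonempty ∧ Convex ℝ C ∧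
      C ⊆ erode (closure Ω) (wb φ r) ∧ E =ᵐ[volume] fatten φ C r ∧
      ((∃ x, C = {x}) ∨ C = erode (closure Ω) (wb φ r) ∨
        volume (erode (closure Ω) (wb φ r)) = 0) := by
  have hH : IsCompact (closure Ω) := hΩb.isCompact_closure
  have hHc : Convex ℝ (closure Ω) := hΩc.closure
  have hEm := hE.1
  have hEH : E ⊆ closure Ω := hE.2.1.trans subset_closure
  have hEv : volume.real E = m := hE.2.2.1
  have hEb := hΩb.subset hE.2.1
  have hE0 : volume E ≠ 0 := fun h0 => by simp [measureReal_def, h0] at hEv; linarith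
  have hmH : m < volume.real (closure Ω) :=
    hm1.trans_le (measureReal_mono subset_closure hH.measure_lt_top.ne)
  have hH0 : volume (closure Ω) ≠ 0 := fun h0 => by simp [measureReal_def, h0] at hmH; linarith
  have hw := hφ.volume_wb_pos
  obtain ⟨R, hR, hR0, hRn, hRpos⟩ := hφ.exists_inradius hH hHc hH0
  rcases le_or_gt m (R ^ 2 * volume.real (wb φ 1)) with hmR | hmR
  · set r := √(m / volume.real (wb φ 1))
    have hr : 0 < r := Real.sqrt_pos.mpr (by positivity)
    have hr2 : r ^ 2 = m / volume.real (wb φ 1) := Real.sq_sqrt (by positivity)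
    have hrm : r ^ 2 * volume.real (wb φ 1) = m := by rw [hr2]; field_simp
    have hrR : r ≤ R := by
      refine Real.sqrt_le_iff.mpr ⟨hR.le, ?_⟩
      rwa [div_le_iff₀ hw]
    obtain ⟨c, hc⟩ := hR0
    have hcr := erode_wb_anti (φ := φ) _ hrR hc
    obtain ⟨hP, hPle⟩ := hφ.anisoPerimeter_le_of_minimizer hΩ hΩc hE isCompact_singleton
      (singleton_nonempty c) (convex_singleton c) hr (singleton_subset_iff.mpr hcr)
      (by rw [hφ.mixed_singleton, hrm]; simp [measureReal_def])
    rw [hφ.mixed_singleton, zero_add] at hPle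
    obtain ⟨x, hx, hxK⟩ := hφ.exists_eq_ball hEm hEb hE0 hP hr (hEv.trans hrm.symm) hPle
    refine ⟨r, {x}, hr, isCompact_singleton, singleton_nonempty x, convex_singleton x, ?_, hx,
      Or.inl ⟨x, rfl⟩⟩
    have hKH : essHull E ⊆ closure Ω := essHull_subset hH.isClosed hHc
      (by rw [sdiff_eq_empty.mpr hEH, measure_empty])
    rintro _ rfl z hz
    exact hKH (hxK ⟨_, rfl, z, hz, rfl⟩)
  obtain ⟨r, hr, hrR, hV, hVlt⟩ := hφ.exists_opening_radius hH hHc hR hR0 hmH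
  have hCc := hφ.isCompact_erode_wb hH hr.le
  have hCv := convex_erode hHc (wb φ r)
  have hC0 : (erode (closure Ω) (wb φ r)).Nonempty := hR0.mono (erode_wb_anti _ hrR)
  have hmr : r ^ 2 * volume.real (wb φ 1) < m :=
    lt_of_le_of_lt (mul_le_mul_of_nonneg_right (pow_le_pow_left₀ hr.le hrR 2) hw.le) hmR
  have hVr := hφ.volume_opening hH hHc hr.le hC0
  rcases hrR.eq_or_lt with rfl | hlt
  · have hCz : volume.real (erode (closure Ω) (wb φ r)) = 0 := by simp [measureReal_def, hRn]
    rw [hVr, hCz, zero_add] at hV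
    have hMpos : 0 < r * mixed φ (erode (closure Ω) (wb φ r)) := by linarith
    have hM : 0 < mixed φ (erode (closure Ω) (wb φ r)) := pos_of_mul_pos_right hMpos hr.le
    set M := mixed φ (erode (closure Ω) (wb φ r)) with hMdef
    set t := (m - r ^ 2 * volume.real (wb φ 1)) / (r * M)
    have ht0 : 0 ≤ t := div_nonneg (by linarith) hMpos.le
    have ht1 : t ≤ 1 := (div_le_one hMpos).mpr (by linarith)
    have htM : t * (r * M) = m - r ^ 2 * volume.real (wb φ 1) := div_mul_cancel₀ _ hMpos.ne'
    obtain ⟨c, hc⟩ := hC0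
    have hmix := hφ.mixed_smul_translate hCc ⟨c, hc⟩ hCv ht0 ((1 - t) • c)
    have hsub : t • erode (closure Ω) (wb φ r) + {(1 - t) • c} ⊆ erode (closure Ω) (wb φ r) := by
      rintro _ ⟨_, ⟨y, hy, rfl⟩, _, rfl, rfl⟩
      exact hCv hy hc ht0 (by linarith) (by ring)
    have hz : volume.real (t • erode (closure Ω) (wb φ r) + {(1 - t) • c}) = 0 := by
      rw [measureReal_def, measure_mono_null hsub hRn, ENNReal.toReal_zero]
    have hVt : volume.real (t • erode (closure Ω) (wb φ r) + {(1 - t) • c}) +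
        r * mixed φ (t • erode (closure Ω) (wb φ r) + {(1 - t) • c}) +
        r ^ 2 * volume.real (wb φ 1) = m := by
      rw [hmix, hz]
      linarith
    obtain ⟨hP, hPle⟩ := hφ.anisoPerimeter_le_of_minimizer hΩ hΩc hE
      ((hCc.smul t).add isCompact_singleton)
      (Set.Nonempty.add (Set.Nonempty.smul_set ⟨c, hc⟩) (singleton_nonempty _))
      ((hCv.smul t).add (convex_singleton _)) hr hsub hVt
    rw [hmix] at hPle
    have hrP : r * (anisoPerimeter φ E).toReal ≤ m + r ^ 2 * volume.real (wb φ 1) := by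
      have := mul_le_mul_of_nonneg_left hPle hr.le
      nlinarith
    obtain ⟨C, h1, h2, h3, h4, h5⟩ := hφ.exists_eq_fatten_of_volume_eq_zero hEm hEH hE0 hH hHc hP
      hr (hEv ▸ hmr.le) hRn (by rw [hEv]; exact hrP)
    exact ⟨r, C, hr, h2, h3, h4, h1, h5, Or.inr (Or.inr hRn)⟩
  · have hVm := hVlt hlt
    obtain ⟨hP, hPle⟩ := hφ.anisoPerimeter_le_of_minimizer hΩ hΩc hE hCc hC0 hCv hr Subset.rfl
      (by rw [← hVr, hVm])
    exact ⟨r, _, hr, hCc, hC0, hCv, Subset.rfl, hφ.ae_eq_fatten_of_volume_pos hEm hEH hE0 hH hHc hP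
      hr (hEv ▸ hmr.le) (hRpos r hr.le hlt) (hVm.trans hEv.symm) hPle, Or.inr (Or.inl rfl)⟩

end IsNorm

lemma eq_of_dt_eq {ν τ x y : Plane} (h : crs ν τ ≠ 0) (h1 : dt ν x = dt ν y)
    (h2 : dt τ x = dt τ y) : x = y := by
  simp only [crs, dt] at *
  ext i
  fin_cases i
  · refine mul_left_cancel₀ h ?_
    simp only [Fin.zero_eta]
    linear_combination τ 1 * h1 - ν 1 * h2
  · refine mul_left_cancel₀ h ?_
    simp only [Fin.mk_one]
    linear_combination ν 0 * h2 - τ 0 * h1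

lemma exists_dt_eq_and {ν τ : Plane} (h : crs ν τ ≠ 0) (a b : ℝ) :
    ∃ p, dt ν p = a ∧ dt τ p = b := by
  refine ⟨![(a * τ 1 - b * ν 1) / crs ν τ, (b * ν 0 - a * τ 0) / crs ν τ], ?_, ?_⟩ <;>
  · simp only [dt, Matrix.cons_val_zero, Matrix.cons_val_one]
    rw [mul_div_assoc', mul_div_assoc', ← add_div, div_eq_iff h]
    simp only [crs]
    ring

lemma exists_smul_add_smul_eq {ν τ : Plane} (h : crs ν τ ≠ 0) (μ : Plane) :
    ∃ a b : ℝ, μ = a • ν + b • τ := by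
  refine ⟨crs μ τ / crs ν τ, crs ν μ / crs ν τ, ?_⟩
  ext i
  simp only [Pi.add_apply, Pi.smul_apply, smul_eq_mul]
  rw [div_mul_eq_mul_div, div_mul_eq_mul_div, ← add_div, eq_div_iff h]
  fin_cases i <;> simp only [crs, Fin.zero_eta, Fin.mk_one] <;> ring

lemma dt_smul_add_smul_left (a b : ℝ) (ν τ x : Plane) :
    dt (a • ν + b • τ) x = a * dt ν x + b * dt τ x := by
  simp only [dt, Pi.add_apply, Pi.smul_apply, smul_eq_mul]
  ring

/-- The points of `C` that maximize the linear form `dt ν`. -/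
def face (C : Set Plane) (ν : Plane) : Set Plane := {c ∈ C | ∀ x ∈ C, dt ν x ≤ dt ν c}

lemma face_nonempty {C : Set Plane} (hC : IsCompact C) (h0 : C.Nonempty) (ν : Plane) :
    (face C ν).Nonempty := by
  obtain ⟨c, hc, h⟩ := hC.exists_isMaxOn h0 (f := dt ν) (continuous_dt ν).continuousOn
  exact ⟨c, hc, h⟩

/-- The linear forms which are less on `K` than at `ω`. -/
def gap (K : Set Plane) (ω : Plane) : Set Plane := {ν | ∀ x ∈ K, dt ν x < dt ν ω}

lemma isOpen_gap {K : Set Plane} (hK : IsCompact K) (ω : Plane) : IsOpen (gap K ω) := by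
  refine isOpen_iff_eventually.mpr fun ν hν =>
    hK.eventually_forall_of_forall_eventually fun x hx => ?_
  have h1 : Continuous fun p : Plane × Plane => dt p.1 p.2 := by unfold dt; fun_prop
  have h2 : Continuous fun p : Plane × Plane => dt p.1 ω := by unfold dt; fun_prop
  exact h1.continuousAt.eventually_lt h2.continuousAt (hν x hx)

lemma ne_zero_of_mem_gap {K : Set Plane} {ω ν : Plane} (hK : K.Nonempty) (h : ν ∈ gap K ω) :
    ν ≠ 0 := by
  rintro rfl
  obtain ⟨x, hx⟩ := hK
  simpa [dt] using h x hx

/-- Faces of an erosion in two independent directions in which the erosion is not tight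
have a common point. -/
lemma exists_mem_face_erode {H Z : Set Plane} (hH : IsClosed H) (hHc : Convex ℝ H)
    {ω : Plane} (hω : ω ∈ H) {ν τ : Plane} (h : crs ν τ ≠ 0)
    (hν : ν ∈ gap (erode H Z + Z) ω) (hτ : τ ∈ gap (erode H Z + Z) ω)
    {c d : Plane} (hc : c ∈ face (erode H Z) ν) (hd : d ∈ face (erode H Z) τ) :
    ∃ p ∈ erode H Z, dt ν p = dt ν c ∧ dt τ p = dt τ d := by
  obtain ⟨p, hp1, hp2⟩ := exists_dt_eq_and h (dt ν c) (dt τ d)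
  refine ⟨p, fun z hz => ?_, hp1, hp2⟩
  by_contra hpz
  obtain ⟨f, u, hfu, huf⟩ := geometric_hahn_banach_closed_point hHc hH hpz
  obtain ⟨μ, hμ⟩ := exists_dt_eq f
  obtain ⟨a, b, rfl⟩ := exists_smul_add_smul_eq h μ
  simp only [hμ, dt_smul_add_smul_left, dt_add_right] at hfu huf
  have h1 := hfu _ (hc.1 z hz)
  have h2 := hfu _ (hd.1 z hz)
  have h3 := hfu _ hω
  have h4 := hν _ (add_mem_add hc.1 hz)
  have h5 := hτ _ (add_mem_add hd.1 hz)
  have h6 := hc.2 d hd.1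
  have h7 := hd.2 c hc.1
  simp only [dt_add_right] at h1 h2 h4 h5
  rw [hp1, hp2] at huf
  have hb : 0 < b := by
    by_contra hb
    nlinarith
  have ha : 0 < a := by
    by_contra ha
    nlinarith
  nlinarith

lemma exists_add_smul_mem_gap {K : Set Plane} (hK : IsCompact K) {ω ν : Plane}
    (h : ν ∈ gap K ω) (τ : Plane) :
    ∃ ε : ℝ, 0 < ε ∧ ν + ε • τ ∈ gap K ω ∧ ν + (-ε) • τ ∈ gap K ω := by
  have hc : Continuous fun ε : ℝ => ν + ε • τ := by fun_prop
  have hc' : Continuous fun ε : ℝ => ν + (-ε) • τ := by fun_prop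
  have h1 : ∀ᶠ ε in 𝓝 (0 : ℝ), ν + ε • τ ∈ gap K ω :=
    hc.continuousAt.eventually_mem ((isOpen_gap hK ω).mem_nhds (by simpa using h))
  have h2 : ∀ᶠ ε in 𝓝 (0 : ℝ), ν + (-ε) • τ ∈ gap K ω :=
    hc'.continuousAt.eventually_mem ((isOpen_gap hK ω).mem_nhds (by simpa using h))
  obtain ⟨ε, ⟨h3, h4⟩, h5⟩ := (((h1.and h2).filter_mono nhdsWithin_le_nhds).and
    (self_mem_nhdsWithin (s := Ioi (0 : ℝ)))).exists
  exact ⟨ε, h5, h3, h4⟩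

lemma face_erode_subsingleton {H Z : Set Plane} (hH : IsClosed H) (hHc : Convex ℝ H)
    (hC : IsCompact (erode H Z)) (hZ : IsCompact Z) (hZ0 : Z.Nonempty) {ω : Plane} (hω : ω ∈ H)
    {ν : Plane} (hν : ν ∈ gap (erode H Z + Z) ω) : (face (erode H Z) ν).Subsingleton := by
  have key : ∃ q, ∀ c ∈ face (erode H Z) ν, c = q := by
    rcases (erode H Z).eq_empty_or_nonempty with h0 | h0
    · exact ⟨0, fun c hc => by simp [face, h0] at hc⟩
    have hν0 := ne_zero_of_mem_gap (h0.add hZ0) hν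
    have hpos := sq_add_sq_pos hν0
    obtain ⟨ε, hε, h1, h2⟩ := exists_add_smul_mem_gap (hC.add hZ) hν (perp ν)
    have hcr : crs (ν + ε • perp ν) (ν + (-ε) • perp ν) =
        -(2 * ε * (ν 0 ^ 2 + ν 1 ^ 2)) := by
      simp [crs, perp]
      ring
    have hcr0 : crs (ν + ε • perp ν) (ν + (-ε) • perp ν) ≠ 0 := by
      rw [hcr]
      exact neg_ne_zero.mpr (by positivity)
    obtain ⟨c1, hc1⟩ := face_nonempty hC h0 (ν + ε • perp ν)
    obtain ⟨c2, hc2⟩ := face_nonempty hC h0 (ν + (-ε) • perp ν)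
    obtain ⟨q, hq, hq1, hq2⟩ := exists_mem_face_erode hH hHc hω hcr0 h1 h2 hc1 hc2
    refine ⟨q, fun c hc => eq_of_dt_eq hcr0 ?_ ?_⟩
    all_goals
      have h3 := hc1.2 c hc.1
      have h4 := hc2.2 c hc.1
      have h5 := hc.2 q hq
      rw [← hq1] at h3
      rw [← hq2] at h4
      simp only [dt_add_left, dt_smul_left] at *
      linarith
  obtain ⟨q, hq⟩ := key
  exact fun c hc d hd => (hq c hc).trans (hq d hd).symm

/-- All the faces of an erosion in the directions in which it is not tight are the same vertex. -/
lemma eq_of_mem_face_erode {H Z : Set Plane} (hH : IsClosed H) (hHc : Convex ℝ H)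
    (hC : IsCompact (erode H Z)) (hZ : IsCompact Z) (hZ0 : Z.Nonempty) {ω : Plane} (hω : ω ∈ H)
    {ν τ c d : Plane} (hν : ν ∈ gap (erode H Z + Z) ω) (hτ : τ ∈ gap (erode H Z + Z) ω)
    (hc : c ∈ face (erode H Z) ν) (hd : d ∈ face (erode H Z) τ) : c = d := by
  have h0 : (erode H Z).Nonempty := ⟨c, hc.1⟩
  have key : ∀ {ν τ c d : Plane}, ν ∈ gap (erode H Z + Z) ω → τ ∈ gap (erode H Z + Z) ω →
      c ∈ face (erode H Z) ν → d ∈ face (erode H Z) τ → crs ν τ ≠ 0 → c = d := by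
    intro ν τ c d hν hτ hc hd hcr
    obtain ⟨p, hp, h1, h2⟩ := exists_mem_face_erode hH hHc hω hcr hν hτ hc hd
    have hpc := face_erode_subsingleton hH hHc hC hZ hZ0 hω hν hc ⟨hp, fun x hx => h1 ▸ hc.2 x hx⟩
    have hpd := face_erode_subsingleton hH hHc hC hZ hZ0 hω hτ hd ⟨hp, fun x hx => h2 ▸ hd.2 x hx⟩
    exact hpc.trans hpd.symm
  by_cases hcr : crs ν τ = 0
  · have hν0 := sq_add_sq_pos (ne_zero_of_mem_gap (h0.add hZ0) hν)
    have hτ0 := sq_add_sq_pos (ne_zero_of_mem_gap (h0.add hZ0) hτ)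
    obtain ⟨ε, hε, h1, -⟩ := exists_add_smul_mem_gap (hC.add hZ) hν (perp ν)
    obtain ⟨e, he⟩ := face_nonempty hC h0 (ν + ε • perp ν)
    have h2 : crs ν (ν + ε • perp ν) ≠ 0 := by
      have : crs ν (ν + ε • perp ν) = ε * (ν 0 ^ 2 + ν 1 ^ 2) := by
        simp [crs, perp]
        ring
      rw [this]
      positivity
    have h3 : crs τ (ν + ε • perp ν) ≠ 0 := by
      have h4 : crs τ (ν + ε • perp ν) = ε * dt τ ν - crs ν τ := by
        simp [crs, dt, perp]
        ring
      rw [h4, hcr, sub_zero]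
      refine mul_ne_zero hε.ne' fun h5 => ?_
      have h6 : (ν 0 ^ 2 + ν 1 ^ 2) * (τ 0 ^ 2 + τ 1 ^ 2) = dt τ ν ^ 2 + crs ν τ ^ 2 := by
        simp only [crs, dt]
        ring
      have h7 := mul_pos hν0 hτ0
      rw [h6, h5, hcr] at h7
      simp at h7
    exact (key hν h1 hc he h2).trans (key hτ h1 hd he h3).symm
  · exact key hν hτ hc hd hcr

lemma crs_sub_eq_zero_of_volume_eq_zero {C : Set Plane} (hC : Convex ℝ C) (h : volume C = 0)
    {a b c : Plane} (ha : a ∈ C) (hb : b ∈ C) (hc : c ∈ C) : crs (b - a) (c - a) = 0 := by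
  by_contra hD
  set u := b - a with hu
  set v := c - a with hv
  set T : Set Plane := {x | 0 < crs (x - a) v / crs u v ∧ 0 < crs u (x - a) / crs u v ∧
    crs (x - a) v / crs u v + crs u (x - a) / crs u v < 1}
  have h1 : Continuous fun x : Plane => crs (x - a) v / crs u v := by unfold crs; fun_prop
  have h2 : Continuous fun x : Plane => crs u (x - a) / crs u v := by unfold crs; fun_prop
  have hT : IsOpen T := (isOpen_lt continuous_const h1).inter
    ((isOpen_lt continuous_const h2).inter (isOpen_lt (h1.add h2) continuous_const))
  have hTC : T ⊆ C := by
    rintro x ⟨hx1, hx2, hx3⟩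
    have hx : (1 - (crs (x - a) v / crs u v + crs u (x - a) / crs u v)) • a +
        (crs (x - a) v / crs u v) • b + (crs u (x - a) / crs u v) • c = x := by
      have h4 : (crs (x - a) v / crs u v) • u + (crs u (x - a) / crs u v) • v = x - a := by
        ext i
        simp only [Pi.add_apply, Pi.smul_apply, smul_eq_mul]
        rw [div_mul_eq_mul_div, div_mul_eq_mul_div, ← add_div, div_eq_iff hD]
        fin_cases i <;> simp only [crs, Fin.zero_eta, Fin.mk_one] <;> ring
      rw [hu, hv] at h4
      rw [← sub_eq_zero]
      rw [← sub_eq_zero] at h4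
      rw [← h4, hu, hv]
      module
    rw [← hx]
    have := hC.sum_mem (t := Finset.univ) (w := ![1 - (crs (x - a) v / crs u v +
      crs u (x - a) / crs u v), crs (x - a) v / crs u v, crs u (x - a) / crs u v])
      (z := ![a, b, c]) (by intro i _; fin_cases i <;> simp <;> linarith)
      (by simp [Fin.sum_univ_three]; ring) (by intro i _; fin_cases i <;> simpa)
    simpa [Fin.sum_univ_three] using this
  have hTn : T.Nonempty := by
    refine ⟨a + (1 / 3 : ℝ) • u + (1 / 3 : ℝ) • v, ?_⟩
    have h4 : crs (a + (1 / 3 : ℝ) • u + (1 / 3 : ℝ) • v - a) v / crs u v = 1 / 3 := by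
      rw [div_eq_iff hD]
      simp [crs]
      ring
    have h5 : crs u (a + (1 / 3 : ℝ) • u + (1 / 3 : ℝ) • v - a) / crs u v = 1 / 3 := by
      rw [div_eq_iff hD]
      simp [crs]
      ring
    refine ⟨?_, ?_, ?_⟩ <;> simp only [h4, h5] <;> norm_num
  exact (hT.measure_pos volume hTn).ne' (measure_mono_null hTC h)

lemma exists_smul_eq_of_crs_eq_zero {u v : Plane} (hu : u ≠ 0) (h : crs u v = 0) :
    ∃ t : ℝ, v = t • u := by
  have hpos := sq_add_sq_pos hu
  refine ⟨dt u v / (u 0 ^ 2 + u 1 ^ 2), ?_⟩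
  ext i
  rw [Pi.smul_apply, smul_eq_mul, div_mul_eq_mul_div, eq_div_iff hpos.ne']
  simp only [crs] at h
  fin_cases i <;> simp only [dt, Fin.zero_eta, Fin.mk_one]
  · linear_combination -u 1 * h
  · linear_combination u 0 * h

/-- Faces of a convex subset of an erosion are locally constant vertices in the directions in which
the subset is not tight. -/
lemma eventually_eq_of_mem_face {H Z C : Set Plane} (hH : IsClosed H) (hHc : Convex ℝ H)
    (hE : IsCompact (erode H Z)) (hZ : IsCompact Z) (hZ0 : Z.Nonempty) (hC : IsCompact C)
    (hCE : C ⊆ erode H Z)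
    (hcase : (∃ x, C = {x}) ∨ C = erode H Z ∨ volume (erode H Z) = 0)
    {ω : Plane} (hω : ω ∈ H) {ν : Plane} (hν : ν ∈ gap (C + Z) ω) {d : Plane}
    (hd : d ∈ face C ν) : ∀ᶠ τ in 𝓝 ν, ∀ c ∈ face C τ, c = d := by
  rcases hcase with ⟨x, rfl⟩ | rfl | h0
  · exact Eventually.of_forall fun τ c hc => hc.1.trans hd.1.symm
  · filter_upwards [(isOpen_gap (hE.add hZ) ω).mem_nhds hν] with τ hτ c hc
    exact eq_of_mem_face_erode hH hHc hE hZ hZ0 hω hτ hν hc hd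
  rcases C.subsingleton_or_nontrivial with hs | ⟨a, ha, b, hb, hab⟩
  · exact Eventually.of_forall fun τ c hc => hs hc.1 hd.1
  have hu : b - a ≠ 0 := sub_ne_zero.mpr hab.symm
  have hline : ∀ x ∈ erode H Z, ∃ t : ℝ, x = a + t • (b - a) := fun x hx => by
    obtain ⟨t, ht⟩ := exists_smul_eq_of_crs_eq_zero hu
      (crs_sub_eq_zero_of_volume_eq_zero (convex_erode hHc Z) h0 (hCE ha) (hCE hb) hx)
    exact ⟨t, by rw [← ht]; abel⟩
  by_cases hνu : dt ν (b - a) = 0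
  · have heq : ∀ x ∈ erode H Z, dt ν x = dt ν a := fun x hx => by
      obtain ⟨t, rfl⟩ := hline x hx
      rw [dt_add_right, dt_smul_right, hνu]
      ring
    have hg : ν ∈ gap (erode H Z + Z) ω := by
      rintro _ ⟨x, hx, z, hz, rfl⟩
      have := hν _ (add_mem_add ha hz)
      simp only [dt_add_right] at *
      rwa [heq x hx]
    refine (hab (face_erode_subsingleton hH hHc hE hZ hZ0 hω hg ⟨hCE ha, fun x hx => ?_⟩
      ⟨hCE hb, fun x hx => ?_⟩)).elim
    · exact (heq x hx).le
    · rw [heq x hx, heq b (hCE hb)]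
  · have hcont : Continuous fun τ => dt τ (b - a) * dt ν (b - a) := by unfold dt; fun_prop
    filter_upwards [hcont.continuousAt.eventually (lt_mem_nhds (mul_self_pos.mpr hνu))] with τ hτ c hc
    obtain ⟨t, rfl⟩ := hline c (hCE hc.1)
    obtain ⟨s, rfl⟩ := hline d (hCE hd.1)
    have h1 := hc.2 _ hd.1
    have h2 := hd.2 _ hc.1
    simp only [dt_add_right, dt_smul_right] at h1 h2
    have h3 : 0 ≤ (t - s) * dt τ (b - a) := by linarith
    have h4 : 0 ≤ (s - t) * dt ν (b - a) := by linarith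
    have h5 : (t - s) ^ 2 * (dt τ (b - a) * dt ν (b - a)) ≤ 0 := by nlinarith [mul_nonneg h3 h4]
    have h6 : (t - s) ^ 2 = 0 := le_antisymm (by
      by_contra hlt
      push Not at hlt
      nlinarith [mul_pos hlt hτ]) (sq_nonneg _)
    rw [sub_eq_zero.mp (pow_eq_zero_iff two_ne_zero |>.mp h6)]

lemma volume_inter_ball_div_le {U : Set Plane} (hU : MeasurableSet U) (hUc : Convex ℝ U)
    {x : Plane} (hx : x ∉ U) (r : ℝ) :
    volume (U ∩ Metric.ball x r) / volume (Metric.ball x r) ≤ 2⁻¹ := by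
  set V := U ∩ Metric.ball x r
  have hVm : MeasurableSet V := hU.inter Metric.isOpen_ball.measurableSet
  set W := (fun y => x + x - y) ⁻¹' V
  have hmp : MeasurePreserving (fun y : Plane => x + x - y) volume volume :=
    Measure.measurePreserving_sub_left volume (x + x)
  have hWm : MeasurableSet W := hmp.measurable hVm
  have hWV : volume W = volume V := hmp.measure_preimage hVm.nullMeasurableSet
  have hdisj : Disjoint V W := by
    refine Set.disjoint_left.mpr fun y hy hy' => hx ?_
    have h := hUc hy.1 hy'.1 (by norm_num : (0 : ℝ) ≤ 1 / 2) (by norm_num : (0 : ℝ) ≤ 1 / 2)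
      (by norm_num)
    have e : (1 / 2 : ℝ) • y + (1 / 2 : ℝ) • (x + x - y) = x := by module
    rwa [e] at h
  have hWb : W ⊆ Metric.ball x r := fun y hy => by
    have h := hy.2
    rw [mem_ball_iff_norm] at h ⊢
    have e : x + x - y - x = -(y - x) := by abel
    rwa [e, norm_neg] at h
  have hsum : volume V + volume V ≤ volume (Metric.ball x r) := by
    calc volume V + volume V = volume (V ∪ W) := by rw [measure_union hdisj hWm, hWV]
      _ ≤ _ := measure_mono (union_subset inter_subset_right hWb)
  refine ENNReal.div_le_of_le_mul ?_
  rw [mul_comm, ← div_eq_mul_inv,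
    ENNReal.le_div_iff_mul_le (Or.inl two_ne_zero) (Or.inl ofNat_ne_top), mul_two]
  exact hsum

lemma densityPoints_eq_of_ae_eq {E U : Set Plane} (h : E =ᵐ[volume] U) (hU : IsOpen U)
    (hUc : Convex ℝ U) : densityPoints E = U := by
  have heq : ∀ x r, volume (E ∩ Metric.ball x r) = volume (U ∩ Metric.ball x r) := fun x r =>
    measure_congr (h.inter (ae_eq_refl _))
  ext x
  simp only [densityPoints, mem_ofPred_eq, heq]
  constructor
  · intro hlim
    by_contra hx
    have hle := le_of_tendsto hlim (b := 2⁻¹) (by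
      exact Eventually.of_forall fun r => volume_inter_ball_div_le hU.measurableSet hUc hx r)
    norm_num at hle
  · intro hx
    obtain ⟨ε, hε, hball⟩ := Metric.isOpen_iff.mp hU x hx
    refine tendsto_const_nhds.congr' ?_
    filter_upwards [Ioo_mem_nhdsGT hε] with r hr
    rw [inter_eq_right.mpr ((Metric.ball_subset_ball hr.2.le).trans hball),
      ENNReal.div_self (Metric.measure_ball_pos volume x hr.1).ne' measure_ball_lt_top.ne]

lemma exists_normal {U : Set Plane} (hU : IsOpen U) (hUc : Convex ℝ U) (hU0 : U.Nonempty)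
    {y : Plane} (hy : y ∉ U) : ∃ ν ∈ Metric.sphere (0 : Plane) 1, ∀ x ∈ U, dt ν x ≤ dt ν y := by
  obtain ⟨f, hf⟩ := geometric_hahn_banach_open_point hUc hU hy
  obtain ⟨ν, hν⟩ := exists_dt_eq f
  simp only [hν] at hf
  have hν0 : ν ≠ 0 := by
    rintro rfl
    obtain ⟨x, hx⟩ := hU0
    simpa [dt] using hf x hx
  refine ⟨‖ν‖⁻¹ • ν, ?_, fun x hx => ?_⟩
  · rw [mem_sphere_zero_iff_norm, norm_smul, norm_inv, norm_norm,
      inv_mul_cancel₀ (norm_ne_zero_iff.mpr hν0)]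
  · rw [dt_smul_left, dt_smul_left]
    exact mul_le_mul_of_nonneg_left (hf x hx).le (by positivity)

namespace IsNorm

variable {φ : Plane → ℝ} (hφ : IsNorm φ)
include hφ

lemma closure_fatten {C : Set Plane} (hC : IsCompact C) {r : ℝ} (hr : 0 < r) :
    closure (fatten φ C r) = C + wb φ r := by
  refine Subset.antisymm (closure_minimal (fatten_subset_add C r)
    (hC.add (hφ.isCompact_wb r)).isClosed) ?_
  rintro _ ⟨c, hc, z, hz, rfl⟩
  have h1 : wulffBall φ c r ⊆ fatten φ C r := fun x hx => mem_fatten.mpr ⟨c, hc, hx⟩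
  have hz' : φ z ≤ r := hz
  refine closure_mono h1 ?_
  rw [hφ.closure_wulffBall hr c]
  simpa using hz'

lemma exists_center {C : Set Plane} (hC : IsCompact C) {r : ℝ} (hr : 0 < r) {y : Plane}
    (hy : y ∈ frontier (fatten φ C r)) : ∃ c ∈ C, φ (y - c) = r := by
  rw [(hφ.isOpen_fatten C r).frontier_eq, hφ.closure_fatten hC hr] at hy
  obtain ⟨⟨c, hc, z, hz, rfl⟩, hy'⟩ := hy
  have hz' : φ z ≤ r := hz
  refine ⟨c, hc, le_antisymm (by simpa using hz') (not_lt.mp fun h => hy' ?_)⟩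
  exact mem_fatten.mpr ⟨c, hc, h⟩

lemma rWCond_fatten {C : Set Plane} (hC : IsCompact C) {r : ℝ} (hr : 0 < r) :
    rWCond φ (fatten φ C r) r := fun y hy => by
  obtain ⟨c, hc, h⟩ := hφ.exists_center hC hr hy
  refine ⟨c, fun x hx => mem_fatten.mpr ⟨c, hc, hx⟩, ?_⟩
  rw [hφ.frontier_wulffBall hr c]
  exact h

lemma mem_face_of_normal {C : Set Plane} (hC : IsCompact C) {r : ℝ} (hr : 0 < r) {y ν c : Plane}
    (hν : ∀ x ∈ fatten φ C r, dt ν x ≤ dt ν y) (hc : c ∈ C) (hyc : φ (y - c) = r) :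
    c ∈ face C ν ∧ ∀ x ∈ C + wb φ r, dt ν x ≤ dt ν y := by
  have h1 : ∀ x ∈ C + wb φ r, dt ν x ≤ dt ν y := by
    rw [← hφ.closure_fatten hC hr]
    exact closure_minimal (t := {x | dt ν x ≤ dt ν y}) hν
      (isClosed_le (continuous_dt ν) continuous_const)
  refine ⟨⟨hc, fun x hx => ?_⟩, h1⟩
  have := h1 _ (add_mem_add hx (show y - c ∈ wb φ r from hyc.le))
  rw [dt_add_right, dt_sub_right] at this
  linarith

/-- The centres of the balls touching the free boundary are locally constant. -/
lemma eventually_center_eq {Ω C : Set Plane} (hΩ : IsOpen Ω) (hΩb : Bornology.IsBounded Ω)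
    (hΩc : Convex ℝ Ω) {r : ℝ} (hr : 0 < r) (hC : IsCompact C) (hCc : Convex ℝ C)
    (hCE : C ⊆ erode (closure Ω) (wb φ r))
    (hcase : (∃ x, C = {x}) ∨ C = erode (closure Ω) (wb φ r) ∨
      volume (erode (closure Ω) (wb φ r)) = 0)
    {y d : Plane} (hyΩ : y ∈ Ω) (hd : d ∈ C) (hyd : φ (y - d) = r) :
    ∀ᶠ x in 𝓝 y, x ∈ frontier (fatten φ C r) → ∀ c ∈ C, φ (x - c) = r → c = d := by
  have hU0 : (fatten φ C r).Nonempty := ⟨d, hφ.subset_fatten C hr hd⟩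
  have hUo := hφ.isOpen_fatten C r
  have hUc := hφ.convex_fatten hCc r
  have key : ∀ᶠ x in 𝓝 y, ∀ ν ∈ Metric.sphere (0 : Plane) 1,
      (∀ u ∈ fatten φ C r, dt ν u ≤ dt ν x) → ∀ c ∈ C, φ (x - c) = r → c = d := by
    refine (isCompact_sphere (0 : Plane) 1).eventually_forall_of_forall_eventually fun ν hν => ?_
    by_cases hn : ∀ u ∈ fatten φ C r, dt ν u ≤ dt ν y
    · obtain ⟨hdf, hle⟩ := hφ.mem_face_of_normal hC hr hn hd hyd
      have hν0 : ν ≠ 0 := Metric.ne_of_mem_sphere hν one_ne_zero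
      obtain ⟨ω, hω, hyω⟩ : ∃ ω ∈ Ω, dt ν y < dt ν ω := by
        have hcont : Continuous fun t : ℝ => y + t • ν := by fun_prop
        have h1 : ∀ᶠ t in 𝓝 (0 : ℝ), y + t • ν ∈ Ω :=
          hcont.continuousAt.eventually_mem (hΩ.mem_nhds (by simpa using hyΩ))
        obtain ⟨t, ht, ht0⟩ := ((h1.filter_mono nhdsWithin_le_nhds).and
          (self_mem_nhdsWithin (s := Ioi (0 : ℝ)))).exists
        refine ⟨_, ht, ?_⟩
        have h2 : dt ν ν = ν 0 ^ 2 + ν 1 ^ 2 := by simp only [dt]; ring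
        rw [dt_add_right, dt_smul_right, h2]
        have := mul_pos (mem_Ioi.mp ht0) (sq_add_sq_pos hν0)
        linarith
      have hgap : ν ∈ gap (C + wb φ r) ω := fun x hx => (hle x hx).trans_lt hyω
      have hev := eventually_eq_of_mem_face isClosed_closure hΩc.closure
        (hφ.isCompact_erode_wb hΩb.isCompact_closure hr.le) (hφ.isCompact_wb r)
        (hφ.nonempty_wb hr.le) hC hCE hcase (subset_closure hω) hgap hdf
      filter_upwards [continuous_snd.continuousAt.eventually hev] with p hp hpn c hc hpc
      exact hp c (hφ.mem_face_of_normal hC hr hpn hc hpc).1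
    · push Not at hn
      obtain ⟨u, hu, hlt⟩ := hn
      have h1 : Continuous fun p : Plane × Plane => dt p.2 p.1 := by unfold dt; fun_prop
      have h2 : Continuous fun p : Plane × Plane => dt p.2 u := by unfold dt; fun_prop
      filter_upwards [h1.continuousAt.eventually_lt (x₀ := (y, ν)) h2.continuousAt hlt]
        with p hp hpn
      exact absurd (hpn u hu) (not_le.mpr hp)
  filter_upwards [key] with x hx hxf
  rw [hUo.frontier_eq] at hxf
  obtain ⟨ν, hν, hνx⟩ := exists_normal hUo hUc hU0 hxf.2
  exact hx ν hν hνx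

end IsNorm

theorem isop_minimizer_rWCond (φ : (Fin 2 → ℝ) → ℝ) (hφ : IsNorm φ)
    (Ω : Set (Fin 2 → ℝ)) (hΩopen : IsOpen Ω) (hΩbdd : Bornology.IsBounded Ω)
    (hΩconv : Convex ℝ Ω) (m : ℝ) (hm0 : 0 < m) (hm1 : m < (volume Ω).toReal)
    (E : Set (Fin 2 → ℝ)) (hE : IsIsopMinimizer φ Ω m E) :
    ∃ r : ℝ, 0 < r ∧ rWCond φ (densityPoints E) r ∧
      ∀ y ∈ frontier (densityPoints E) ∩ Ω, ∃ x : Fin 2 → ℝ,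
        wulffBall φ x r ⊆ Ω ∧
        connectedComponentIn (frontier (densityPoints E) ∩ Ω) y ⊆
          frontier (wulffBall φ x r) := by
  obtain ⟨r, C, hr, hC, -, hCc, hCE, hEU, hcase⟩ :=
    hφ.exists_eq_fatten hΩopen hΩbdd hΩconv hm0 hm1 hE
  have hUo := hφ.isOpen_fatten C r
  rw [densityPoints_eq_of_ae_eq hEU hUo (hφ.convex_fatten hCc r)]
  refine ⟨r, hr, hφ.rWCond_fatten hC hr, fun y hy => ?_⟩
  obtain ⟨d, hd, hyd⟩ := hφ.exists_center hC hr hy.1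
  refine ⟨d, ?_, ?_⟩
  · refine Subset.trans (fun x hx => mem_fatten.mpr ⟨d, hd, hx⟩)
      (IsNorm.fatten_subset_of_subset_erode hΩopen hΩconv hCE hUo)
  rw [hφ.frontier_wulffBall hr d]
  set A := frontier (fatten φ C r) ∩ Ω with hA
  have hloc : ∀ x ∈ A, φ (x - d) = r → x ∈ interior {x | x ∈ A → φ (x - d) = r} := by
    intro x hx hxd
    rw [mem_interior_iff_mem_nhds]
    filter_upwards [hφ.eventually_center_eq hΩopen hΩbdd hΩconv hr hC hCc hCE hcase hx.2 hd hxd]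
      with z hz hzA
    obtain ⟨c, hc, hzc⟩ := hφ.exists_center hC hr hzA.1
    rwa [hz hzA.1 c hc hzc] at hzc
  have hpre : IsPreconnected (connectedComponentIn A y) := isPreconnected_connectedComponentIn
  have hsub := connectedComponentIn_subset A y
  have hcont : Continuous fun x => φ (x - d) := hφ.continuous.comp (continuous_id.sub continuous_const)
  have hmem : y ∈ connectedComponentIn A y := mem_connectedComponentIn hy
  rcases isPreconnected_iff_subset_of_disjoint.mp hpre (interior {x | x ∈ A → φ (x - d) = r})
    {x | φ (x - d) ≠ r} isOpen_interior (isOpen_ne_fun hcont continuous_const)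
    (fun x hx => (eq_or_ne (φ (x - d)) r).imp (hloc x (hsub hx)) id)
    (eq_empty_of_forall_notMem fun x hx => hx.2.2 (interior_subset hx.2.1 (hsub hx.1)))
    with h | h
  · exact fun x hx => interior_subset (h hx) (hsub hx)
  · exact absurd hyd (h hmem)

end
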